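/- arXiv:1011.3142 — 3 statements merged into one kernel-verified Lean document; each statement's English description precedes it below -/
import Mathlib

section
/- Let K be a field with a nonidentity involution that is a finite extension of Q_p with p ≠ 2, and let K∘ be the fixed field of the involution. Let u be a unit of the ring of integers of K∘ that is not a square in K∘ and let π be a prime element of K∘. Then each Hermitian form over K with nonzero determinant is classified by its dimension and its determinant; moreover, it is equivalent to either x̄₁y₁ + ⋯ + x̄ₙyₙ or t·x̄₁y₁ + x̄₂y₂ + ⋯ + x̄ₙyₙ, where t := π if K = K∘(√u), and t := u if K = K∘(√π) or K = K∘(√(uπ)). -/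
open Polynomial Matrix

namespace Can

noncomputable section

abbrev Mat (F : Type*) (n : ℕ) := Matrix (Fin n) (Fin n) F

variable {F : Type*} [Field F]

/-- conjugate transpose w.r.t. an involution σ -/
def ctr (σ : F →+* F) {m n : ℕ} (A : Matrix (Fin m) (Fin n) F) : Matrix (Fin n) (Fin m) F :=
  (A.map σ)ᵀ

/-- congruence: SᵀAS = B for a nonsingular S -/
def Congruent {n : ℕ} (A B : Mat F n) : Prop :=
  ∃ S : Mat F n, IsUnit S.det ∧ Sᵀ * A * S = B

/-- *congruence: S*AS = B for a nonsingular S -/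
def StarCongruent (σ : F →+* F) {n : ℕ} (A B : Mat F n) : Prop :=
  ∃ S : Mat F n, IsUnit S.det ∧ ctr σ S * A * S = B

/-- a square-matrix "summand" of unspecified size -/
abbrev Block (F : Type*) := Σ n : ℕ, Mat F n

def castMat {m n : ℕ} (h : m = n) (A : Mat F m) : Mat F n :=
  Matrix.reindex (finCongr h) (finCongr h) A

def BCong (X Y : Block F) : Prop :=
  ∃ h : X.1 = Y.1, Congruent (castMat h X.2) Y.2

def BStarCong (σ : F →+* F) (X Y : Block F) : Prop :=
  ∃ h : X.1 = Y.1, StarCongruent σ (castMat h X.2) Y.2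

/-- direct sum of a list of blocks -/
def bsum : List (Block F) → Block F
  | [] => ⟨0, 0⟩
  | X :: L => ⟨X.1 + (bsum L).1,
      Matrix.reindex finSumFinEquiv finSumFinEquiv (Matrix.fromBlocks X.2 0 0 (bsum L).2)⟩

/-- pairs of square matrices of the same size -/
abbrev PBlock (F : Type*) := Σ n : ℕ, Mat F n × Mat F n

def PCong (X Y : PBlock F) : Prop :=
  ∃ h : X.1 = Y.1, ∃ S : Mat F Y.1, IsUnit S.det ∧
    Sᵀ * castMat h X.2.1 * S = Y.2.1 ∧ Sᵀ * castMat h X.2.2 * S = Y.2.2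

def PStarCong (σ : F →+* F) (X Y : PBlock F) : Prop :=
  ∃ h : X.1 = Y.1, ∃ S : Mat F Y.1, IsUnit S.det ∧
    ctr σ S * castMat h X.2.1 * S = Y.2.1 ∧ ctr σ S * castMat h X.2.2 * S = Y.2.2

def psum : List (PBlock F) → PBlock F
  | [] => ⟨0, (0, 0)⟩
  | X :: L =>
      ⟨X.1 + (psum L).1,
        (Matrix.reindex finSumFinEquiv finSumFinEquiv (Matrix.fromBlocks X.2.1 0 0 (psum L).2.1),
         Matrix.reindex finSumFinEquiv finSumFinEquiv (Matrix.fromBlocks X.2.2 0 0 (psum L).2.2))⟩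

/-- lower-triangular Jordan block -/
def J (F : Type*) [Field F] (n : ℕ) (lam : F) : Mat F n :=
  Matrix.of fun i j => if i = j then lam else if (i : ℕ) = (j : ℕ) + 1 then 1 else 0

/-- the companion (Frobenius) matrix of a polynomial -/
def companion (F : Type*) [Field F] (f : Polynomial F) : Mat F f.natDegree :=
  Matrix.of fun i j => if (i : ℕ) = (j : ℕ) + 1 then 1
    else if (j : ℕ) + 1 = f.natDegree then -f.coeff i else 0

/-- f ↦ f^∨ (with respect to the involution σ) -/
def dualPoly (σ : F →+* F) (f : Polynomial F) : Polynomial F :=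
  Polynomial.C (σ (f.coeff 0))⁻¹ * (f.map σ).reverse

/-- the skew sum [A ⟍ B] = [[0, B], [A, 0]] -/
def skewSum {k l : ℕ} (A : Matrix (Fin k) (Fin l) F) (B : Matrix (Fin l) (Fin k) F) :
    Mat F (l + k) :=
  Matrix.reindex finSumFinEquiv finSumFinEquiv (Matrix.fromBlocks 0 B A 0)

/-- the matrix Γₙ -/
def Gamma (F : Type*) [Field F] (n : ℕ) : Mat F n :=
  Matrix.of fun i j =>
    if (i : ℕ) + (j : ℕ) + 1 = n ∨ (i : ℕ) + (j : ℕ) = n then (-1 : F) ^ (n - 1 - (i : ℕ)) else 0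

/-- Fₙ = [I | 0], an (n−1)×n matrix -/
def Fmat (F : Type*) [Field F] (n : ℕ) : Matrix (Fin (n - 1)) (Fin n) F :=
  Matrix.of fun i j => if (i : ℕ) = (j : ℕ) then 1 else 0

/-- Gₙ = [0 | I], an (n−1)×n matrix -/
def Gmat (F : Type*) [Field F] (n : ℕ) : Matrix (Fin (n - 1)) (Fin n) F :=
  Matrix.of fun i j => if (i : ℕ) + 1 = (j : ℕ) then 1 else 0

/-- the pair Bₙ of symmetric n×n matrices -/
def Bpair (F : Type*) [Field F] (n : ℕ) : Mat F n × Mat F n :=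
  (Matrix.of fun i j => if (i : ℕ) + (j : ℕ) + 2 = n then 1 else 0,
   Matrix.of fun i j => if (i : ℕ) + (j : ℕ) + 1 = n then 1 else 0)

/-- the pair Cₙ of a symmetric and a skew-symmetric n×n matrix -/
def Cpair (F : Type*) [Field F] (n : ℕ) : Mat F n × Mat F n :=
  if Odd n then
    (Matrix.of fun i j => if (i : ℕ) + (j : ℕ) + 1 = n then 1 else 0,
     Matrix.of fun i j =>
       if (i : ℕ) + (j : ℕ) + 2 = n ∧ i < j then 1
       else if (i : ℕ) + (j : ℕ) + 2 = n ∧ j < i then -1 else 0)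
  else
    (Matrix.of fun i j => if (i : ℕ) + (j : ℕ) + 2 = n then 1 else 0,
     Matrix.of fun i j =>
       if (i : ℕ) + (j : ℕ) + 1 = n ∧ i < j then 1
       else if (i : ℕ) + (j : ℕ) + 1 = n ∧ j < i then -1 else 0)

/-- at most one entry of the list satisfies P -/
def AtMostOne {α : Type*} (P : α → Prop) (L : List α) : Prop :=
  ¬ ∃ b₁ b₂ : α, List.Sublist [b₁, b₂] L ∧ P b₁ ∧ P b₂


section PadicCore

variable (p : ℕ) [Fact p.Prime]

/-- ν is the (unique) extension to K of the exponential valuation of ℚ_p -/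
def IsExpValuation (K : Type*) [Field K] [Algebra ℚ_[p] K] (ν : K → ℚ) : Prop :=
  (∀ a b : K, a ≠ 0 → b ≠ 0 → ν (a * b) = ν a + ν b) ∧
  (∀ a b : K, a ≠ 0 → b ≠ 0 → a + b ≠ 0 → min (ν a) (ν b) ≤ ν (a + b)) ∧
  (∀ x : ℚ_[p], x ≠ 0 → ν (algebraMap ℚ_[p] K x) = (x.valuation : ℚ))

variable {K : Type*} [CommRing K]

/-- a member of the ring of integers O(K) = {a : ν(a) ≥ 0} -/
def IsIntegerElem (ν : K → ℚ) (a : K) : Prop := a = 0 ∨ 0 ≤ ν a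

/-- a unit of the ring of integers: an element of valuation 0 -/
def IsUnitElem (ν : K → ℚ) (a : K) : Prop := a ≠ 0 ∧ ν a = 0

/-- a prime element: a generator of the maximal ideal of O(K), i.e. an element of the
smallest positive valuation -/
def IsPrimeElem (ν : K → ℚ) (π : K) : Prop :=
  π ≠ 0 ∧ 0 < ν π ∧ ∀ a : K, a ≠ 0 → 0 < ν a → ν π ≤ ν a

/-- congruence modulo the maximal ideal of O(K) -/
def ResEq (ν : K → ℚ) (a b : K) : Prop := a = b ∨ 0 < ν (a - b)

/-- the residue field O(K)/𝔪 has exactly q elements -/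
def ResidueCard (ν : K → ℚ) (q : ℕ) : Prop :=
  ∃ S : Finset K, S.card = q ∧ (∀ a ∈ S, IsIntegerElem ν a) ∧
    (∀ a ∈ S, ∀ b ∈ S, a ≠ b → ¬ ResEq ν a b) ∧
    (∀ a : K, IsIntegerElem ν a → ∃ b ∈ S, ResEq ν a b)

end PadicCore

open scoped NormedField Valued in
theorem finite_residueField (L : Type*) [NontriviallyNormedField L] [IsUltrametricDist L]
    [ProperSpace L] : Finite 𝓀[L] := by
  have hc : CompactSpace 𝒪[L] := by
    have h : ((𝒪[L] : Subring L) : Set L) = Metric.closedBall 0 1 := by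
      ext x
      simp [Valued.integer.mem_iff]
    exact isCompact_iff_compactSpace.mp (h ▸ isCompact_closedBall 0 1)
  let : (Valued.v : Valuation L NNReal).RankOne :=
    inferInstanceAs (NormedField.valuation (K := L)).RankOne
  exact (Valued.integer.compactSpace_iff_completeSpace_and_isDiscreteValuationRing_and_finite_residueField.mp
    hc).2.2

section
variable {L : Type*} [NontriviallyNormedField L] [IsUltrametricDist L] [ProperSpace L]

omit [ProperSpace L] in
theorem norm_eq_of_norm_sub_lt {x y : L} (h : ‖x - y‖ < ‖x‖) : ‖y‖ = ‖x‖ := by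
  have := IsUltrametricDist.norm_add_eq_max_of_norm_ne_norm (x := x) (y := -(x - y))
    (by rw [norm_neg]; exact h.ne')
  rw [norm_neg, max_eq_left h.le] at this
  rw [← this]
  congr 1
  ring

/-- Local square theorem: an approximate square root of a unit can be corrected to a square root
when `2` is a unit. -/
theorem isSquare_of_norm_sq_sub_lt_one (h2 : ‖(2 : L)‖ = 1) {z y₀ : L} (hz : ‖z‖ = 1)
    (hy₀ : ‖y₀‖ ≤ 1) (h : ‖y₀ ^ 2 - z‖ < 1) : IsSquare z := by
  obtain ⟨y, hy, hmin⟩ := (isCompact_closedBall (0 : L) 1).exists_isMinOn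
    ⟨y₀, by simpa using hy₀⟩ (f := fun y => ‖y ^ 2 - z‖) (by fun_prop)
  have hlt : ‖y ^ 2 - z‖ < 1 := (hmin (by simpa using hy₀ : y₀ ∈ Metric.closedBall (0 : L) 1)).trans_lt h
  have hy1 : ‖y‖ = 1 := by
    have h1 : ‖y ^ 2‖ = 1 := by
      rw [norm_eq_of_norm_sub_lt (x := z) (by rwa [norm_sub_rev, hz]), hz]
    rw [norm_pow] at h1
    exact (pow_eq_one_iff_of_nonneg (norm_nonneg _) two_ne_zero).mp h1
  have hy0 : y ≠ 0 := by rintro rfl; simp at hy1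
  have h20 : (2 : L) ≠ 0 := by intro h; simp [h] at h2
  set e := (y ^ 2 - z) / (2 * y) with he
  have hen : ‖e‖ = ‖y ^ 2 - z‖ := by simp [he, h2, hy1]
  have hnew : (y - e) ^ 2 - z = e ^ 2 := by
    have : 2 * y * e = y ^ 2 - z := by rw [he]; field_simp
    linear_combination -this
  have hle : ‖y ^ 2 - z‖ ≤ ‖(y - e) ^ 2 - z‖ := by
    refine hmin (?_ : y - e ∈ Metric.closedBall (0 : L) 1)
    have := IsUltrametricDist.norm_add_le_max y (-e)
    rw [norm_neg, ← sub_eq_add_neg] at this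
    simpa using this.trans (max_le hy1.le (hen ▸ hlt.le))
  rw [hnew, norm_pow, hen] at hle
  have h0 : ‖y ^ 2 - z‖ = 0 := by nlinarith [norm_nonneg (y ^ 2 - z)]
  exact ⟨y, by rw [norm_eq_zero] at h0; linear_combination -h0⟩

omit [ProperSpace L] in
open scoped NormedField Valued in
theorem card_residueField_odd [Fintype 𝓀[L]] (h2 : ‖(2 : L)‖ = 1) : Fintype.card 𝓀[L] % 2 = 1 := by
  apply FiniteField.odd_card_of_char_ne_two
  intro h
  have h0 : (2 : 𝓀[L]) = 0 := by
    have := ringChar.Nat.cast_ringChar (R := 𝓀[L])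
    rw [h] at this
    exact_mod_cast this
  have hu : IsUnit (2 : 𝒪[L]) := Valued.integer.isUnit_iff_norm_eq_one.mpr h2
  have := (hu.map (IsLocalRing.residue 𝒪[L])).ne_zero
  rw [map_ofNat] at this
  exact this h0

omit [ProperSpace L] in
open scoped NormedField Valued in
theorem residue_eq_iff_norm_sub_lt_one (a b : 𝒪[L]) :
    IsLocalRing.residue 𝒪[L] a = IsLocalRing.residue 𝒪[L] b ↔ ‖(a : L) - b‖ < 1 := by
  rw [← sub_eq_zero, ← map_sub, IsLocalRing.residue_eq_zero_iff, IsLocalRing.mem_maximalIdeal,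
    mem_nonunits_iff, Valued.integer.isUnit_iff_norm_eq_one]
  exact (Valued.integer.norm_le_one (a - b)).lt_iff_ne.symm

open scoped NormedField Valued in
theorem exists_mul_sq_add_mul_sq_eq (h2 : ‖(2 : L)‖ = 1) {a b c : L} (ha : ‖a‖ = 1)
    (hb : ‖b‖ = 1) (hc : ‖c‖ = 1) : ∃ x y : L, a * x ^ 2 + b * y ^ 2 = c := by
  have := finite_residueField L
  have := Fintype.ofFinite 𝓀[L]
  let r := IsLocalRing.residue 𝒪[L]
  let a' : 𝒪[L] := ⟨a, Valued.integer.mem_iff.mpr ha.le⟩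
  let b' : 𝒪[L] := ⟨b, Valued.integer.mem_iff.mpr hb.le⟩
  let c' : 𝒪[L] := ⟨c, Valued.integer.mem_iff.mpr hc.le⟩
  have ha0 : r a' ≠ 0 :=
    ((Valued.integer.isUnit_iff_norm_eq_one (u := a')).mpr ha |>.map r).ne_zero
  have hb0 : r b' ≠ 0 :=
    ((Valued.integer.isUnit_iff_norm_eq_one (u := b')).mpr hb |>.map r).ne_zero
  obtain ⟨x, y, hxy⟩ := FiniteField.exists_root_sum_quadratic
    (f := C (r a') * X ^ 2) (g := C (r b') * X ^ 2 - C (r c'))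
    (degree_C_mul_X_pow 2 ha0)
    (by rw [degree_sub_C (by rw [degree_C_mul_X_pow 2 hb0]; norm_num), degree_C_mul_X_pow 2 hb0]; rfl)
    (card_residueField_odd h2)
  obtain ⟨x, rfl⟩ := IsLocalRing.residue_surjective x
  obtain ⟨y, rfl⟩ := IsLocalRing.residue_surjective y
  have hres : r (a' * x ^ 2 + b' * y ^ 2) = r c' := by
    simp only [eval_mul, eval_C, eval_pow, eval_X, eval_sub] at hxy
    simp only [map_add, map_mul, map_pow]
    linear_combination hxy
  rw [residue_eq_iff_norm_sub_lt_one] at hres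
  replace hres : ‖a * (x : L) ^ 2 + b * (y : L) ^ 2 - c‖ < 1 := hres
  have key : ∀ {a b x y : L}, ‖a‖ = 1 → ‖b‖ = 1 → ‖x‖ = 1 → ‖y‖ ≤ 1 →
      ‖a * x ^ 2 + b * y ^ 2 - c‖ < 1 → ∃ x y : L, a * x ^ 2 + b * y ^ 2 = c := by
    intro a b x y ha hb hx hy h
    have ha0 : a ≠ 0 := by rintro rfl; simp at ha
    have hd : ‖x ^ 2 - (c - b * y ^ 2) / a‖ < 1 := by
      have : x ^ 2 - (c - b * y ^ 2) / a = (a * x ^ 2 + b * y ^ 2 - c) / a := by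
        field_simp; ring
      rwa [this, norm_div, ha, div_one]
    have hz : ‖(c - b * y ^ 2) / a‖ = 1 := by
      have h1 : ‖x ^ 2‖ = 1 := by simp [hx]
      rw [norm_eq_of_norm_sub_lt (x := x ^ 2) (by rwa [h1]), h1]
    obtain ⟨s, hs⟩ := isSquare_of_norm_sq_sub_lt_one h2 hz hx.le hd
    refine ⟨s, y, ?_⟩
    rw [pow_two s, ← hs]
    field_simp
    ring
  have hx := Valued.integer.norm_le_one x
  have hy := Valued.integer.norm_le_one y
  rcases hx.lt_or_eq with hx1 | hx1
  · rcases hy.lt_or_eq with hy1 | hy1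
    · exfalso
      have hsmall : ‖a * (x : L) ^ 2 + b * (y : L) ^ 2‖ < 1 := by
        refine (IsUltrametricDist.norm_add_le_max _ _).trans_lt (max_lt ?_ ?_)
        · simpa [ha] using pow_lt_one₀ (norm_nonneg _) hx1 two_ne_zero
        · simpa [hb] using pow_lt_one₀ (norm_nonneg _) hy1 two_ne_zero
      rw [norm_eq_of_norm_sub_lt (x := c) (by rwa [norm_sub_rev, hc]), hc] at hsmall
      exact hsmall.ne rfl
    · obtain ⟨y, x, h⟩ := key hb ha hy1 hx (by rwa [add_comm (b * _)])
      exact ⟨x, y, by rw [← h, add_comm]⟩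
  · exact key ha hb hx1 hy hres

open scoped NormedField Valued in
theorem isSquare_mul_of_not_isSquare (h2 : ‖(2 : L)‖ = 1) {a b : L} (ha : ‖a‖ = 1)
    (hb : ‖b‖ = 1) (hna : ¬ IsSquare a) (hnb : ¬ IsSquare b) : IsSquare (a * b) := by
  have := finite_residueField L
  have := Fintype.ofFinite 𝓀[L]
  let r := IsLocalRing.residue 𝒪[L]
  have lift : ∀ z : 𝒪[L], ‖(z : L)‖ = 1 → IsSquare (r z) → IsSquare (z : L) := by
    rintro z hz ⟨y, hy⟩
    obtain ⟨y, rfl⟩ := IsLocalRing.residue_surjective y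
    refine isSquare_of_norm_sq_sub_lt_one h2 hz (Valued.integer.norm_le_one y) ?_
    rw [← map_mul, eq_comm, residue_eq_iff_norm_sub_lt_one] at hy
    simpa [pow_two] using hy
  let a' : 𝒪[L] := ⟨a, Valued.integer.mem_iff.mpr ha.le⟩
  let b' : 𝒪[L] := ⟨b, Valued.integer.mem_iff.mpr hb.le⟩
  refine lift (a' * b') (by simp [a', b', ha, hb]) ?_
  rw [map_mul]
  have h1 : ¬ IsSquare (r a') := fun h => hna (lift a' ha h)
  have h2 : ¬ IsSquare (r b') := fun h => hnb (lift b' hb h)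
  classical
  rw [← quadraticChar_neg_one_iff_not_isSquare] at h1 h2
  by_contra h
  rw [← quadraticChar_neg_one_iff_not_isSquare, map_mul, h1, h2] at h
  norm_num at h
end

namespace IsExpValuation

section
variable {p : ℕ} [Fact p.Prime] {L : Type*} [Field L] [Algebra ℚ_[p] L] {ν : L → ℚ}

theorem map_one (hν : IsExpValuation p L ν) : ν 1 = 0 := by
  have := hν.1 1 1 one_ne_zero one_ne_zero
  rw [mul_one] at this
  linarith

theorem map_neg (hν : IsExpValuation p L ν) (a : L) : ν (-a) = ν a := by
  rcases eq_or_ne a 0 with rfl | ha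
  · simp
  have h1 := hν.1 (-1) (-1) (by simp) (by simp)
  rw [neg_one_mul, neg_neg, hν.map_one] at h1
  have h2 := hν.1 (-1) a (by simp) ha
  rw [neg_one_mul] at h2
  linarith

theorem map_pow (hν : IsExpValuation p L ν) {a : L} (ha : a ≠ 0) (n : ℕ) :
    ν (a ^ n) = n * ν a := by
  induction n with
  | zero => simp [hν.map_one]
  | succ n ih =>
    rw [pow_succ, hν.1 _ _ (pow_ne_zero _ ha) ha, ih]
    push_cast
    ring

theorem map_inv (hν : IsExpValuation p L ν) {a : L} (ha : a ≠ 0) : ν a⁻¹ = -ν a := by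
  have := hν.1 a a⁻¹ ha (inv_ne_zero ha)
  rw [mul_inv_cancel₀ ha, hν.map_one] at this
  linarith

theorem map_zpow (hν : IsExpValuation p L ν) {a : L} (ha : a ≠ 0) (n : ℤ) :
    ν (a ^ n) = n * ν a := by
  cases n with
  | ofNat n => simpa using hν.map_pow ha n
  | negSucc n =>
    rw [zpow_negSucc, hν.map_inv (pow_ne_zero _ ha), hν.map_pow ha]
    push_cast
    ring

theorem map_p (hν : IsExpValuation p L ν) : ν (p : L) = 1 := by
  have hp : (p : ℚ_[p]) ≠ 0 := by exact_mod_cast (Fact.out : p.Prime).ne_zero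
  have := hν.2.2 p hp
  simpa using this

end

section
variable {p : ℕ} [hp : Fact p.Prime] {L : Type*} [Field L] [Algebra ℚ_[p] L] {ν : L → ℚ}

open Classical in
/-- The absolute value `p ^ (-ν a)` attached to an exponential valuation. -/
@[reducible]
def toNormedField (hν : IsExpValuation p L ν) : NormedField L :=
  let f : L → ℝ := fun a => if a = 0 then 0 else (p : ℝ) ^ (-(ν a : ℝ))
  have hp0 : (0 : ℝ) < p := by exact_mod_cast hp.out.pos
  have hf0 : ∀ a, 0 ≤ f a := fun a => by
    by_cases ha : a = 0
    · simp [f, ha]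
    · simp only [f, ha, if_false]
      positivity
  have hadd : ∀ a b, f (a + b) ≤ max (f a) (f b) := fun a b => by
    rcases eq_or_ne a 0 with rfl | ha
    · simp
    rcases eq_or_ne b 0 with rfl | hb
    · simp
    rcases eq_or_ne (a + b) 0 with hab | hab
    · rw [hab]
      exact (by simp [f] : f 0 = 0).le.trans (le_max_of_le_left (hf0 a))
    have hp1 : (1 : ℝ) ≤ p := by exact_mod_cast hp.out.one_lt.le
    simp only [f, ha, hb, hab, if_false]
    rcases min_le_iff.mp (hν.2.1 a b ha hb hab) with h | h
    · exact le_max_of_le_left (Real.rpow_le_rpow_of_exponent_le hp1 (by exact_mod_cast neg_le_neg h))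
    · exact le_max_of_le_right (Real.rpow_le_rpow_of_exponent_le hp1 (by exact_mod_cast neg_le_neg h))
  have hneg : ∀ a, f (-a) = f a := fun a => by simp [f, hν.map_neg]
  { ‹Field L› with
    norm := f
    dist := fun x y => f (-x + y)
    dist_self := by simp [f]
    dist_comm := fun x y => by rw [← hneg]; congr 1; ring
    dist_triangle := fun x y z => by
      have := hadd (-x + y) (-y + z)
      rw [show -x + y + (-y + z) = -x + z by ring] at this
      exact this.trans (max_le_add_of_nonneg (hf0 _) (hf0 _))
    eq_of_dist_eq_zero := fun {x y} h => by
      by_contra hne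
      have h0 : -x + y ≠ 0 := fun h0 => hne (by linear_combination -h0)
      simp only [f, h0, if_false] at h
      exact (Real.rpow_pos_of_pos hp0 _).ne' h
    dist_eq := fun _ _ => rfl
    norm_mul := fun a b => by
      rcases eq_or_ne a 0 with rfl | ha
      · simp [f]
      rcases eq_or_ne b 0 with rfl | hb
      · simp [f]
      simp only [f, ha, hb, mul_eq_zero, or_self, if_false]
      rw [hν.1 a b ha hb, ← Real.rpow_add hp0]
      push_cast
      ring_nf }

theorem norm_eq (hν : IsExpValuation p L ν) {a : L} (ha : a ≠ 0) :
    hν.toNormedField.norm a = (p : ℝ) ^ (-(ν a : ℝ)) :=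
  if_neg ha

theorem norm_algebraMap (hν : IsExpValuation p L ν) (x : ℚ_[p]) :
    hν.toNormedField.norm (algebraMap ℚ_[p] L x) = ‖x‖ := by
  rcases eq_or_ne x 0 with rfl | hx
  · rw [_root_.map_zero, norm_zero]
    exact if_pos rfl
  rw [hν.norm_eq (by simpa using hx), hν.2.2 x hx, Padic.norm_eq_zpow_neg_valuation hx,
    ← Real.rpow_intCast]
  push_cast
  rfl

@[reducible]
def toNontriviallyNormedField (hν : IsExpValuation p L ν) : NontriviallyNormedField L :=
  { hν.toNormedField with
    non_trivial := by
      obtain ⟨x, hx⟩ := NormedField.exists_one_lt_norm ℚ_[p]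
      exact ⟨algebraMap ℚ_[p] L x, by rw [hν.norm_algebraMap]; exact hx⟩ }

theorem isUltrametricDist (hν : IsExpValuation p L ν) :
    @IsUltrametricDist L hν.toNormedField.toMetricSpace.toDist := by
  let := hν.toNormedField
  refine IsUltrametricDist.isUltrametricDist_of_isNonarchimedean_norm fun a b => ?_
  rcases eq_or_ne a 0 with rfl | ha
  · simp
  rcases eq_or_ne b 0 with rfl | hb
  · simp
  rcases eq_or_ne (a + b) 0 with hab | hab
  · rw [hab, norm_zero]
    exact le_max_of_le_left (norm_nonneg a)
  have hp1 : (1 : ℝ) ≤ p := by exact_mod_cast hp.out.one_lt.le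
  change hν.toNormedField.norm (a + b) ≤ max (hν.toNormedField.norm a) (hν.toNormedField.norm b)
  rw [hν.norm_eq ha, hν.norm_eq hb, hν.norm_eq hab]
  rcases min_le_iff.mp (hν.2.1 a b ha hb hab) with h | h
  · exact le_max_of_le_left (Real.rpow_le_rpow_of_exponent_le hp1 (by exact_mod_cast neg_le_neg h))
  · exact le_max_of_le_right (Real.rpow_le_rpow_of_exponent_le hp1 (by exact_mod_cast neg_le_neg h))

theorem properSpace (hν : IsExpValuation p L ν) [FiniteDimensional ℚ_[p] L] :
    @ProperSpace L hν.toNormedField.toMetricSpace.toPseudoMetricSpace := by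
  let := hν.toNormedField
  let : NormedSpace ℚ_[p] L :=
    { toModule := Algebra.toModule
      norm_smul_le := fun x a => by
        rw [Algebra.smul_def, norm_mul]
        exact (congrArg (· * ‖a‖) (hν.norm_algebraMap x)).le }
  exact FiniteDimensional.proper ℚ_[p] L

theorem norm_two (hν : IsExpValuation p L ν) (hp2 : p ≠ 2) : hν.toNormedField.norm 2 = 1 := by
  have h := hν.norm_algebraMap 2
  rw [map_ofNat] at h
  rw [h]
  have := (Padic.norm_natCast_eq_one_iff (p := p) (n := 2)).mpr
    ((Nat.coprime_primes hp.out Nat.prime_two).mpr hp2)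
  exact_mod_cast this

theorem norm_unit (hν : IsExpValuation p L ν) {a : L} (ha : a ≠ 0) (h : ν a = 0) :
    hν.toNormedField.norm a = 1 := by
  rw [hν.norm_eq ha, h]
  simp

variable [FiniteDimensional ℚ_[p] L]

theorem exists_mul_sq_add_mul_sq_eq (hν : IsExpValuation p L ν) (hp2 : p ≠ 2) {a b c : L}
    (ha : a ≠ 0) (hνa : ν a = 0) (hb : b ≠ 0) (hνb : ν b = 0) (hc : c ≠ 0) (hνc : ν c = 0) :
    ∃ x y : L, a * x ^ 2 + b * y ^ 2 = c := by
  let := hν.toNontriviallyNormedField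
  have := hν.isUltrametricDist
  have := hν.properSpace
  exact Can.exists_mul_sq_add_mul_sq_eq (hν.norm_two hp2) (hν.norm_unit ha hνa)
    (hν.norm_unit hb hνb) (hν.norm_unit hc hνc)

theorem isSquare_mul_of_not_isSquare (hν : IsExpValuation p L ν) (hp2 : p ≠ 2) {a b : L}
    (ha : a ≠ 0) (hνa : ν a = 0) (hb : b ≠ 0) (hνb : ν b = 0) (hna : ¬ IsSquare a)
    (hnb : ¬ IsSquare b) : IsSquare (a * b) := by
  let := hν.toNontriviallyNormedField
  have := hν.isUltrametricDist
  have := hν.properSpace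
  exact Can.isSquare_mul_of_not_isSquare (hν.norm_two hp2) (hν.norm_unit ha hνa)
    (hν.norm_unit hb hνb) hna hnb

end

/-- `ν` has a uniformizer `π` on the subfield fixed by `σ`, so its values there are multiples
of `ν π`. -/
theorem exists_zpow_mul {p : ℕ} [Fact p.Prime] {K : Type*} [Field K] [Algebra ℚ_[p] K]
    {ν : K → ℚ} (hν : IsExpValuation p K ν) (σ : K →+* K) {π : K}
    (hπ : σ π = π ∧ π ≠ 0 ∧ 0 < ν π ∧ ∀ a : K, σ a = a → a ≠ 0 → 0 < ν a → ν π ≤ ν a)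
    {c : K} (hc : σ c = c) (hc0 : c ≠ 0) :
    ∃ (k : ℤ) (e : K), σ e = e ∧ e ≠ 0 ∧ ν e = 0 ∧ c = π ^ k * e := by
  obtain ⟨hσπ, hπ0, hπpos, hπmin⟩ := hπ
  set k := ⌊ν c / ν π⌋
  have h1 : (k : ℚ) * ν π ≤ ν c := (le_div_iff₀ hπpos).mp (Int.floor_le _)
  have h2 : ν c < (k + 1) * ν π := (div_lt_iff₀ hπpos).mp (Int.lt_floor_add_one _)
  have he0 : c * (π ^ k)⁻¹ ≠ 0 := mul_ne_zero hc0 (inv_ne_zero (zpow_ne_zero _ hπ0))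
  have hσe : σ (c * (π ^ k)⁻¹) = c * (π ^ k)⁻¹ := by
    rw [map_mul, map_inv₀, map_zpow₀, hc, hσπ]
  have hνe : ν (c * (π ^ k)⁻¹) = ν c - k * ν π := by
    rw [hν.1 _ _ hc0 (inv_ne_zero (zpow_ne_zero _ hπ0)), hν.map_inv (zpow_ne_zero _ hπ0),
      hν.map_zpow hπ0, sub_eq_add_neg]
  refine ⟨k, c * (π ^ k)⁻¹, hσe, he0, ?_, by field_simp⟩
  by_contra hne
  have := hπmin _ hσe he0 (lt_of_le_of_ne (by rw [hνe]; linarith) (Ne.symm hne))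
  rw [hνe] at this
  linarith

end IsExpValuation

/-- A one-unit of `ℤ_[p]` has roots of all orders prime to `p`. -/
theorem _root_.PadicInt.exists_pow_eq_one_add_p_mul {p : ℕ} [Fact p.Prime] (z : ℤ_[p]) {n : ℕ}
    (hn : p.Coprime n) : ∃ y : ℤ_[p], y ^ n = 1 + p * z := by
  obtain ⟨y, hy, -⟩ := hensels_lemma (p := p) (R := ℤ_[p])
    (F := (Polynomial.X ^ n - Polynomial.C (1 + (p : ℤ_[p]) * z))) (a := 1) (by
      have h1 : ‖(n : ℤ_[p])‖ = 1 := by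
        rw [PadicInt.norm_def, PadicInt.coe_natCast]
        exact Padic.norm_natCast_eq_one_iff.mpr hn
      simp only [map_sub, Polynomial.aeval_X_pow, one_pow, Polynomial.aeval_C,
        Polynomial.derivative_X_pow, Polynomial.derivative_C, sub_zero, map_mul, mul_one, 
        Algebra.algebraMap_self, RingHom.id_apply, h1, map_natCast]
      rw [sub_add_cancel_left, norm_neg]
      exact (PadicInt.norm_lt_one_iff_dvd _).mpr (dvd_mul_right _ _))
  refine ⟨y, ?_⟩
  simpa [sub_eq_zero] using hy

theorem involution_algebraMap {p : ℕ} [hp : Fact p.Prime] {K : Type*} [Field K] [Algebra ℚ_[p] K]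
    {ν : K → ℚ} (hν : IsExpValuation p K ν) (σ : K →+* K) (hσ : ∀ a, σ (σ a) = a) {π : K}
    (hπ : σ π = π ∧ π ≠ 0 ∧ 0 < ν π ∧ ∀ a : K, σ a = a → a ≠ 0 → 0 < ν a → ν π ≤ ν a)
    (x : ℚ_[p]) : σ (algebraMap ℚ_[p] K x) = algebraMap ℚ_[p] K x := by
  have hp0 : (p : K) ≠ 0 := by
    have : (p : ℚ_[p]) ≠ 0 := by exact_mod_cast hp.out.ne_zero
    simpa using (algebraMap ℚ_[p] K).injective.ne this
  have hone : ∀ z : ℤ_[p], ν (σ (algebraMap ℚ_[p] K ((1 + p * z : ℤ_[p]) : ℚ_[p]))) = 0 := by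
    intro z
    set y : K := algebraMap ℚ_[p] K ((1 + p * z : ℤ_[p]) : ℚ_[p]) with hy
    have hnorm : ‖((1 + p * z : ℤ_[p]) : ℚ_[p])‖ = 1 := by
      rw [← PadicInt.norm_def]
      have hlt : ‖(p : ℤ_[p]) * z‖ < 1 :=
        (PadicInt.norm_lt_one_iff_dvd _).mpr (dvd_mul_right _ _)
      rw [PadicInt.norm_add_eq_max_of_ne (by rw [norm_one]; exact hlt.ne'), norm_one,
        max_eq_left hlt.le]
    have hq0 : ((1 + p * z : ℤ_[p]) : ℚ_[p]) ≠ 0 := by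
      intro h; rw [h, norm_zero] at hnorm; exact zero_ne_one hnorm
    have hy0 : y ≠ 0 := by simpa [hy] using (algebraMap ℚ_[p] K).injective.ne hq0
    have hνy : ν y = 0 := by
      rw [hy, hν.2.2 _ hq0]
      have h := Padic.norm_eq_zpow_neg_valuation hq0
      rw [hnorm, eq_comm, zpow_eq_one_iff_right₀ (by positivity)
        (by exact_mod_cast hp.out.one_lt.ne')] at h
      simpa using h
    have hσy0 : σ y ≠ 0 := (map_ne_zero σ).mpr hy0
    have hval : ν (y * σ y) = ν (σ y) := by rw [hν.1 _ _ hy0 hσy0, hνy, zero_add]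
    rw [← hval]
    have hdvd : ∀ n : ℕ, p.Coprime n → ∃ k : ℤ, ν (y * σ y) = n * (k * ν π) := by
      intro n hn
      obtain ⟨w, hw⟩ := PadicInt.exists_pow_eq_one_add_p_mul z hn
      set v : K := algebraMap ℚ_[p] K (w : ℚ_[p])
      have hvy : v ^ n = y := by
        rw [hy, ← hw, PadicInt.coe_pow, map_pow]
      have hn0 : n ≠ 0 := by
        rintro rfl
        exact hp.out.one_lt.ne' (by simpa using hn)
      have hv0 : v ≠ 0 := by rintro h; rw [h, zero_pow hn0] at hvy; exact hy0 hvy.symm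
      have hm0 : v * σ v ≠ 0 := mul_ne_zero hv0 ((map_ne_zero σ).mpr hv0)
      obtain ⟨k, e, -, he0, hνe, hk⟩ := hν.exists_zpow_mul σ hπ (c := v * σ v)
        (by rw [map_mul, hσ, mul_comm]) hm0
      refine ⟨k, ?_⟩
      rw [← hvy, map_pow, ← mul_pow, hν.map_pow hm0, hk,
        hν.1 _ _ (zpow_ne_zero _ hπ.2.1) he0, hν.map_zpow hπ.2.1, hνe, add_zero]
    obtain ⟨k, hk⟩ := hdvd 1 (Nat.coprime_one_right p)
    have hπ0 : ν π ≠ 0 := hπ.2.2.1.ne'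
    by_contra hne
    have hk0 : k ≠ 0 := by rintro rfl; simp at hk; exact hne hk
    obtain ⟨n, hn1, hn2⟩ : ∃ n : ℕ, k.natAbs < n ∧ p.Coprime n :=
      ⟨p * k.natAbs + 1, Nat.lt_succ_of_le (Nat.le_mul_of_pos_left _ hp.out.pos), by simp⟩
    obtain ⟨m, hm⟩ := hdvd n hn2
    rw [hk, Nat.cast_one, one_mul, ← mul_assoc] at hm
    have hkm : k = n * m := by exact_mod_cast mul_right_cancel₀ hπ0 hm
    have hd : n ∣ k.natAbs := Int.natCast_dvd.mp ⟨m, hkm⟩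
    exact absurd (Nat.le_of_dvd (Int.natAbs_pos.mpr hk0) hd) (by omega)
  have hbound : ∀ z : ℤ_[p], σ (algebraMap ℚ_[p] K z) ≠ 0 → -1 ≤ ν (σ (algebraMap ℚ_[p] K z)) := by
    intro z hz
    set t := σ (algebraMap ℚ_[p] K z)
    have h1 := hone z
    have hexp : σ (algebraMap ℚ_[p] K ((1 + p * z : ℤ_[p]) : ℚ_[p])) = 1 + p * t := by
      simp [t]
    rw [hexp] at h1
    have hpt : (p : K) * t ≠ 0 := mul_ne_zero hp0 hz
    have hne : (1 + p * t : K) ≠ 0 := by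
      rw [← hexp]
      intro h
      rw [map_eq_zero, map_eq_zero] at h
      have h3 : (1 + p * z : ℤ_[p]) = 0 := Subtype.coe_injective (h.trans PadicInt.coe_zero.symm)
      have h4 : (p : ℤ_[p]) * (-z) = 1 := by linear_combination -h3
      exact PadicInt.p_nonunit (p := p) (IsUnit.of_mul_eq_one _ h4)
    have h5 := hν.2.1 (1 + p * t) (-1) hne (by simp) (by simpa using hpt)
    rw [h1, hν.map_neg, hν.map_one, min_self, add_neg_cancel_comm, hν.1 _ _ hp0 hz, hν.map_p] at h5
    linarith
  have hintfix : ∀ z : ℤ_[p], σ (algebraMap ℚ_[p] K z) = algebraMap ℚ_[p] K z := by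
    intro z
    by_contra hne
    rw [← sub_eq_zero] at hne
    set d := σ (algebraMap ℚ_[p] K z) - algebraMap ℚ_[p] K z with hd
    have hbound : ∀ k : ℕ, (k : ℚ) - 1 ≤ ν d := by
      intro k
      obtain ⟨w, hw⟩ := Ideal.mem_span_singleton.mp (PadicInt.appr_spec k z)
      have hz : algebraMap ℚ_[p] K z = (z.appr k : K) + p ^ k * algebraMap ℚ_[p] K w := by
        have : z = (z.appr k : ℤ_[p]) + p ^ k * w := by linear_combination hw
        conv_lhs => rw [this]
        simp
      set s := algebraMap ℚ_[p] K w
      have hdw : d = p ^ k * (σ s - s) := by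
        rw [hd, hz]
        simp
        ring
      have hs : σ s - s ≠ 0 := fun h => hne (by rw [hdw, h, mul_zero])
      have hs0 : s ≠ 0 := by rintro h; simp [h] at hs
      have hw0 : (w : ℚ_[p]) ≠ 0 := by rintro h; exact hs0 (by simp [s, h])
      have h1 : 0 ≤ ν s := by
        rw [hν.2.2 _ hw0, PadicInt.valuation_coe]
        positivity
      have h2 := hbound w ((map_ne_zero σ).mpr hs0)
      have h3 := hν.2.1 (σ s) (-s) ((map_ne_zero σ).mpr hs0) (neg_ne_zero.mpr hs0)
        (by rwa [← sub_eq_add_neg])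
      rw [← sub_eq_add_neg, hν.map_neg] at h3
      have h4 : -1 ≤ ν (σ s - s) := (le_min h2 (by linarith)).trans h3
      rw [hdw, hν.1 _ _ (pow_ne_zero _ hp0) hs, hν.map_pow hp0, hν.map_p]
      linarith
    obtain ⟨k, hk⟩ := exists_nat_gt (ν d + 1)
    linarith [hbound k]
  obtain ⟨a, b, hb, rfl⟩ := IsFractionRing.div_surjective (A := ℤ_[p]) x
  rw [map_div₀, map_div₀]
  exact congrArg₂ (· / ·) (hintfix a) (hintfix b)

section Hermitian

variable {F : Type*} [Field F] {σ : F →+* F}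

theorem ctr_mul {l m n : ℕ} (A : Matrix (Fin l) (Fin m) F) (B : Matrix (Fin m) (Fin n) F) :
    ctr σ (A * B) = ctr σ B * ctr σ A := by
  simp [ctr, Matrix.map_mul, Matrix.transpose_mul]

theorem ctr_one (n : ℕ) : ctr σ (1 : Mat F n) = 1 := by
  simp [ctr, Matrix.map_one]

theorem ctr_ctr (hσ : ∀ a, σ (σ a) = a) {m n : ℕ} (A : Matrix (Fin m) (Fin n) F) :
    ctr σ (ctr σ A) = A := by
  ext i j
  simp [ctr, hσ]

theorem det_ctr {n : ℕ} (A : Mat F n) : (ctr σ A).det = σ A.det := by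
  rw [ctr, Matrix.det_transpose, RingHom.map_det]
  rfl

theorem ctr_congr (hσ : ∀ a, σ (σ a) = a) {n : ℕ} {H : Mat F n} (hH : ctr σ H = H) (S : Mat F n) :
    ctr σ (ctr σ S * H * S) = ctr σ S * H * S := by
  rw [ctr_mul, ctr_mul, ctr_ctr hσ, hH, Matrix.mul_assoc]

namespace StarCongruent

theorem trans {n : ℕ} {A B C : Mat F n} (h₁ : StarCongruent σ A B) (h₂ : StarCongruent σ B C) :
    StarCongruent σ A C := by
  obtain ⟨S, hS, rfl⟩ := h₁
  obtain ⟨T, hT, rfl⟩ := h₂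
  refine ⟨S * T, by rw [Matrix.det_mul]; exact hS.mul hT, ?_⟩
  simp only [ctr_mul, Matrix.mul_assoc]

theorem symm {n : ℕ} {A B : Mat F n} (h : StarCongruent σ A B) : StarCongruent σ B A := by
  obtain ⟨S, hS, rfl⟩ := h
  refine ⟨S⁻¹, Matrix.isUnit_nonsing_inv_det _ hS, ?_⟩
  have h1 : ctr σ S⁻¹ * ctr σ S = 1 := by rw [← ctr_mul, Matrix.mul_nonsing_inv _ hS, ctr_one]
  calc ctr σ S⁻¹ * (ctr σ S * A * S) * S⁻¹ = (ctr σ S⁻¹ * ctr σ S) * A * (S * S⁻¹) := by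
        simp only [Matrix.mul_assoc]
    _ = A := by rw [h1, Matrix.mul_nonsing_inv _ hS, Matrix.one_mul, Matrix.mul_one]

theorem exists_det_eq {n : ℕ} {A B : Mat F n} (h : StarCongruent σ A B) :
    ∃ c : F, c ≠ 0 ∧ B.det = c * σ c * A.det := by
  obtain ⟨S, hS, rfl⟩ := h
  refine ⟨S.det, hS.ne_zero, ?_⟩
  rw [Matrix.det_mul, Matrix.det_mul, det_ctr]
  ring

end StarCongruent

/-- The sesquilinear form with matrix `H`. -/
def herm (σ : F →+* F) {n : ℕ} (H : Mat F n) (v w : Fin n → F) : F :=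
  (fun i => σ (v i)) ⬝ᵥ (H *ᵥ w)

theorem ctr_mul_mul_apply {n : ℕ} (H S : Mat F n) (i j : Fin n) :
    (ctr σ S * H * S) i j = herm σ H (fun k => S k i) (fun k => S k j) := by
  rw [Matrix.mul_assoc]
  rfl

theorem herm_add_left {n : ℕ} (H : Mat F n) (x y z : Fin n → F) :
    herm σ H (x + y) z = herm σ H x z + herm σ H y z := by
  simp only [herm, ← add_dotProduct]
  congr 1
  ext i
  simp

theorem herm_add_right {n : ℕ} (H : Mat F n) (x y z : Fin n → F) :
    herm σ H x (y + z) = herm σ H x y + herm σ H x z := by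
  simp [herm, Matrix.mulVec_add]

theorem herm_smul_right {n : ℕ} (H : Mat F n) (c : F) (x y : Fin n → F) :
    herm σ H x (c • y) = c * herm σ H x y := by
  simp [herm, Matrix.mulVec_smul]

theorem herm_single {n : ℕ} (H : Mat F n) (i j : Fin n) :
    herm σ H (Pi.single i 1) (Pi.single j 1) = H i j := by
  have : (fun k => σ ((Pi.single i 1 : Fin n → F) k)) = Pi.single i 1 := by
    ext k
    rcases eq_or_ne k i with rfl | h <;> simp [*]
  simp [herm, this]

theorem map_herm (hσ : ∀ a, σ (σ a) = a) {n : ℕ} {H : Mat F n} (hH : ctr σ H = H)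
    (x y : Fin n → F) : σ (herm σ H x y) = herm σ H y x := by
  have hH' : ∀ i j, σ (H i j) = H j i := fun i j => congrFun (congrFun hH j) i
  simp only [herm, dotProduct, mulVec, map_sum, map_mul, hσ, hH', Finset.mul_sum]
  rw [Finset.sum_comm]
  exact Finset.sum_congr rfl fun i _ => Finset.sum_congr rfl fun j _ => by ring

/-- A nonzero Hermitian form represents a nonzero value. -/
theorem exists_herm_self_ne_zero (hσ : ∀ a, σ (σ a) = a) (h2 : (2 : F) ≠ 0) {w : F} (hw : w ≠ 0)
    (hσw : σ w = -w) {n : ℕ} {H : Mat F n} (hH : ctr σ H = H) (hne : H ≠ 0) :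
    ∃ v, herm σ H v v ≠ 0 := by
  by_contra! h
  apply hne
  have hadd : ∀ x y, herm σ H x y + σ (herm σ H x y) = 0 := by
    intro x y
    have := h (x + y)
    rw [herm_add_left, herm_add_right, herm_add_right, h x, h y, zero_add, add_zero] at this
    rwa [map_herm hσ hH]
  ext i j
  rw [← herm_single (σ := σ) H i j]
  have h1 := hadd (Pi.single i 1) (Pi.single j 1)
  have h3 := hadd (Pi.single i 1) (w • Pi.single j 1)
  rw [herm_smul_right, map_mul, hσw] at h3
  have h4 : 2 * w * herm σ H (Pi.single i 1) (Pi.single j 1) = 0 := by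
    linear_combination h3 + w * h1
  simpa [h2, hw] using h4

/-- The direct sum of a `1 × 1` block `a` and `A`. -/
def consBlock (a : F) {n : ℕ} (A : Mat F n) : Mat F (n + 1) :=
  Matrix.of (Fin.cons (Fin.cons a 0) fun i => Fin.cons 0 (A i))

section consBlock

variable (a b : F) {n : ℕ} (A B : Mat F n) (i j : Fin n)

@[simp] theorem consBlock_zero_zero : consBlock a A 0 0 = a := rfl
@[simp] theorem consBlock_zero_succ : consBlock a A 0 j.succ = 0 := rfl
@[simp] theorem consBlock_succ_zero : consBlock a A i.succ 0 = 0 := rfl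
@[simp] theorem consBlock_succ_succ : consBlock a A i.succ j.succ = A i j := rfl

theorem consBlock_mul : consBlock a A * consBlock b B = consBlock (a * b) (A * B) := by
  ext i j
  cases i using Fin.cases <;> cases j using Fin.cases <;>
    simp [Matrix.mul_apply, Fin.sum_univ_succ]

theorem ctr_consBlock : ctr σ (consBlock a A) = consBlock (σ a) (ctr σ A) := by
  ext i j
  cases i using Fin.cases <;> cases j using Fin.cases <;> simp [ctr]

theorem det_consBlock : (consBlock a A).det = a * A.det := by
  have : (consBlock a A).submatrix Fin.succ Fin.succ = A := by
    ext i j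
    simp
  rw [Matrix.det_succ_row_zero, Fin.sum_univ_succ]
  simp [this]

theorem consBlock_congr {A B : Mat F n} {c : F} (hc : c ≠ 0) (h : StarCongruent σ A B) :
    StarCongruent σ (consBlock a A) (consBlock (c * σ c * a) B) := by
  obtain ⟨S, hS, rfl⟩ := h
  refine ⟨consBlock c S, ?_, ?_⟩
  · rw [det_consBlock]
    exact hc.isUnit.mul hS
  · rw [ctr_consBlock, consBlock_mul, consBlock_mul]
    congr 1
    ring

theorem consBlock_congr_right {A B : Mat F n} (h : StarCongruent σ A B) :
    StarCongruent σ (consBlock a A) (consBlock a B) := by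
  simpa using consBlock_congr a one_ne_zero h

end consBlock

/-- A vector with nonzero value splits off as an orthogonal summand. -/
theorem exists_starCongruent_consBlock (hσ : ∀ a, σ (σ a) = a) {n : ℕ} {H : Mat F (n + 1)}
    (hH : ctr σ H = H) (hdet : H.det ≠ 0) {v : Fin (n + 1) → F} (hv : herm σ H v v ≠ 0) :
    ∃ H₁ : Mat F n, ctr σ H₁ = H₁ ∧ H₁.det ≠ 0 ∧
      StarCongruent σ H (consBlock (herm σ H v v) H₁) := by
  let f : (Fin (n + 1) → F) →ₗ[F] F :=
    { toFun := herm σ H v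
      map_add' := herm_add_right H v
      map_smul' := fun c x => herm_smul_right H c v x }
  have hf : f v ≠ 0 := hv
  have hker : Module.finrank F (LinearMap.ker f) = n := by
    have h1 := f.finrank_range_add_finrank_ker
    have h2 : LinearMap.range f = ⊤ :=
      LinearMap.range_eq_top.mpr (LinearMap.surjective (fun h => hf (by rw [h]; rfl)))
    rw [h2, finrank_top, Module.finrank_self, Module.finrank_fin_fun] at h1
    omega
  let b := Module.finBasisOfFinrankEq F (LinearMap.ker f) hker
  let e : Fin n → Fin (n + 1) → F := fun i => b i
  have he : ∀ i, herm σ H v (e i) = 0 := fun i => (b i).2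
  have hli : LinearIndependent F (Fin.cons v e : Fin (n + 1) → Fin (n + 1) → F) := by
    rw [linearIndependent_finCons]
    refine ⟨b.linearIndependent.map' (LinearMap.ker f).subtype (Submodule.ker_subtype _), ?_⟩
    intro hmem
    have : Submodule.span F (Set.range e) ≤ LinearMap.ker f :=
      Submodule.span_le.mpr (by rintro _ ⟨i, rfl⟩; exact (b i).2)
    exact hf (this hmem)
  let S : Mat F (n + 1) := (Matrix.of (Fin.cons v e))ᵀ
  have hS : IsUnit S.det := by
    rw [← Matrix.isUnit_iff_isUnit_det, ← Matrix.linearIndependent_cols_iff_isUnit]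
    exact hli
  set G := ctr σ S * H * S with hG
  have hGG : ctr σ G = G := ctr_congr hσ hH S
  have hrow : ∀ i : Fin n, G 0 i.succ = 0 := fun i => by
    rw [hG, ctr_mul_mul_apply]
    exact he i
  have hcol : ∀ i : Fin n, G i.succ 0 = 0 := fun i => by
    rw [← congrFun (congrFun hGG i.succ) 0]
    simp [ctr, hrow]
  have hGeq : G = consBlock (herm σ H v v) (G.submatrix Fin.succ Fin.succ) := by
    ext i j
    cases i using Fin.cases <;> cases j using Fin.cases
    · rw [hG, ctr_mul_mul_apply]
      rfl
    · simp [hrow]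
    · simp [hcol]
    · simp
  refine ⟨G.submatrix Fin.succ Fin.succ, ?_, ?_, S, hS, hGeq⟩
  · ext i j
    exact congrFun (congrFun hGG i.succ) j.succ
  · intro h0
    have h1 : G.det = 0 := by rw [hGeq, det_consBlock, h0, mul_zero]
    rw [hG, Matrix.det_mul, Matrix.det_mul, det_ctr] at h1
    have := hS.ne_zero
    simp [hdet, this] at h1

/-- The diagonal matrix with entries `1, …, 1, d`. -/
def lastDiag (d : F) : (n : ℕ) → Mat F (n + 1)
  | 0 => consBlock d 0
  | n + 1 => consBlock 1 (lastDiag d n)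

theorem det_lastDiag (d : F) (n : ℕ) : (lastDiag d n).det = d := by
  induction n with
  | zero => simp [lastDiag]
  | succ n ih => simp [lastDiag, det_consBlock, ih]

theorem lastDiag_congr (d : F) {c : F} (hc : c ≠ 0) (n : ℕ) :
    StarCongruent σ (lastDiag d n) (lastDiag (c * σ c * d) n) := by
  induction n with
  | zero => exact consBlock_congr d hc ⟨1, by simp, by simp⟩
  | succ n ih => exact consBlock_congr_right 1 ih

theorem exists_starCongruent_lastDiag (hσ : ∀ a, σ (σ a) = a) (h2 : (2 : F) ≠ 0) {w : F}
    (hw : w ≠ 0) (hσw : σ w = -w)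
    (hrep : ∀ a b : F, σ a = a → σ b = b → a ≠ 0 → b ≠ 0 →
      ∃ x y : F, a * (x * σ x) + b * (y * σ y) = 1)
    (n : ℕ) (H : Mat F (n + 1)) (hH : ctr σ H = H) (hdet : H.det ≠ 0) :
    ∃ d, StarCongruent σ H (lastDiag d n) := by
  have split : ∀ (m : ℕ) (A : Mat F (m + 1)), ctr σ A = A → A.det ≠ 0 →
      ∃ (a : F) (B : Mat F m), σ a = a ∧ a ≠ 0 ∧ ctr σ B = B ∧ B.det ≠ 0 ∧
        StarCongruent σ A (consBlock a B) := by
    intro m A hA hAdet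
    obtain ⟨v, hv⟩ := exists_herm_self_ne_zero hσ h2 hw hσw hA
      (by rintro rfl; exact hAdet Matrix.det_zero)
    obtain ⟨B, hB, hBdet, hAB⟩ := exists_starCongruent_consBlock hσ hA hAdet hv
    exact ⟨_, B, map_herm hσ hA v v, hv, hB, hBdet, hAB⟩
  induction n with
  | zero =>
    obtain ⟨a, B, -, -, -, -, hAB⟩ := split 0 H hH hdet
    refine ⟨a, ?_⟩
    rwa [Subsingleton.elim B 0] at hAB
  | succ n ih =>
    obtain ⟨a, B, hσa, ha, hB, hBdet, hHB⟩ := split _ H hH hdet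
    obtain ⟨b, C, hσb, hb, hC, hCdet, hBC⟩ := split _ B hB hBdet
    obtain ⟨x, y, hxy⟩ := hrep a b hσa hσb ha hb
    have hval : herm σ (consBlock a (consBlock b C)) (Fin.cons x (Fin.cons y 0))
        (Fin.cons x (Fin.cons y 0)) = 1 := by
      have h01 : consBlock a (consBlock b C) 0 1 = 0 := rfl
      have h11 : consBlock a (consBlock b C) 1 1 = b := rfl
      rw [← hxy]
      simp [herm, dotProduct, mulVec, Fin.sum_univ_succ, h01, h11]
      ring
    obtain ⟨D, hD, hDdet, hGD⟩ := exists_starCongruent_consBlock hσ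
      (H := consBlock a (consBlock b C)) (by rw [ctr_consBlock, ctr_consBlock, hσa, hσb, hC])
      (by rw [det_consBlock, det_consBlock]; exact mul_ne_zero ha (mul_ne_zero hb hCdet))
      (v := Fin.cons x (Fin.cons y 0)) (by rw [hval]; exact one_ne_zero)
    rw [hval] at hGD
    obtain ⟨d, hd⟩ := ih D hD hDdet
    exact ⟨d, (hHB.trans (consBlock_congr_right a hBC)).trans
      (hGD.trans (consBlock_congr_right 1 hd))⟩

/-- If binary Hermitian forms represent `1`, regular Hermitian forms are classified by their
dimension and determinant. -/
theorem starCongruent_iff_det (hσ : ∀ a, σ (σ a) = a) (h2 : (2 : F) ≠ 0) {w : F}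
    (hw : w ≠ 0) (hσw : σ w = -w)
    (hrep : ∀ a b : F, σ a = a → σ b = b → a ≠ 0 → b ≠ 0 →
      ∃ x y : F, a * (x * σ x) + b * (y * σ y) = 1)
    {n : ℕ} {H H' : Mat F n} (hH : ctr σ H = H) (hdet : H.det ≠ 0) (hH' : ctr σ H' = H')
    (hdet' : H'.det ≠ 0) :
    StarCongruent σ H H' ↔ ∃ c : F, c ≠ 0 ∧ H'.det = c * σ c * H.det := by
  refine ⟨StarCongruent.exists_det_eq, ?_⟩
  rintro ⟨c, hc, hcdet⟩
  cases n with
  | zero => exact ⟨1, by simp, Subsingleton.elim _ _⟩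
  | succ n =>
    obtain ⟨d, hd⟩ := exists_starCongruent_lastDiag hσ h2 hw hσw hrep n H hH hdet
    obtain ⟨d', hd'⟩ := exists_starCongruent_lastDiag hσ h2 hw hσw hrep n H' hH' hdet'
    obtain ⟨s, hs, hsd⟩ := hd.exists_det_eq
    obtain ⟨s', hs', hsd'⟩ := hd'.exists_det_eq
    rw [det_lastDiag] at hsd hsd'
    have hσs : σ s ≠ 0 := (map_ne_zero σ).mpr hs
    have hdd : d' = (s' * c * s⁻¹) * σ (s' * c * s⁻¹) * d := by
      rw [hsd', hcdet, hsd]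
      simp only [map_mul, map_inv₀]
      field_simp
    refine hd.trans (StarCongruent.trans ?_ hd'.symm)
    rw [hdd]
    exact lastDiag_congr d (mul_ne_zero (mul_ne_zero hs' hc) (inv_ne_zero hs)) n

/-- `t` represents the nontrivial norm class, if there is one. -/
def NormClasses (σ : F →+* F) (t : F) : Prop :=
  ∀ c : F, σ c = c → c ≠ 0 → ∃ x : F, x ≠ 0 ∧ (c = x * σ x ∨ c = t * (x * σ x))

theorem NormClasses.represents_one {t : F} (h : NormClasses σ t) (hσt : σ t = t) (ht : t ≠ 0)
    (hsum : ∃ x y : F, x * σ x + y * σ y = t) (a b : F) (hσa : σ a = a) (hσb : σ b = b)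
    (ha : a ≠ 0) (hb : b ≠ 0) : ∃ x y : F, a * (x * σ x) + b * (y * σ y) = 1 := by
  obtain ⟨x, hx, hax⟩ := h a hσa ha
  obtain ⟨y, hy, hby⟩ := h b hσb hb
  have hσx : σ x ≠ 0 := (map_ne_zero σ).mpr hx
  have hσy : σ y ≠ 0 := (map_ne_zero σ).mpr hy
  rcases hax with rfl | rfl
  · refine ⟨x⁻¹, 0, ?_⟩
    rw [map_inv₀]
    field_simp
    simp
  rcases hby with rfl | rfl
  · refine ⟨0, y⁻¹, ?_⟩
    rw [map_inv₀]
    field_simp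
    simp
  obtain ⟨x₀, y₀, h₀⟩ := hsum
  refine ⟨x₀ * (t * x)⁻¹, y₀ * (t * y)⁻¹, ?_⟩
  simp only [map_mul, map_inv₀, hσt]
  field_simp
  exact h₀

theorem NormClasses.starCongruent_or {t : F} (h : NormClasses σ t) (hσt : σ t = t) (ht : t ≠ 0)
    (hsum : ∃ x y : F, x * σ x + y * σ y = t) (hσ : ∀ a, σ (σ a) = a) (h2 : (2 : F) ≠ 0) {w : F}
    (hw : w ≠ 0) (hσw : σ w = -w) {n : ℕ} {H : Mat F n} (hH : ctr σ H = H) (hdet : H.det ≠ 0) :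
    StarCongruent σ H (1 : Mat F n) ∨
      StarCongruent σ H (Matrix.diagonal fun i : Fin n => if (i : ℕ) = 0 then t else 1) := by
  have hcl {H' : Mat F n} := starCongruent_iff_det hσ h2 hw hσw
    (h.represents_one hσt ht hsum) hH hdet (H' := H')
  cases n with
  | zero => exact Or.inl ⟨1, by simp, Subsingleton.elim _ _⟩
  | succ n =>
    have hdetT : (Matrix.diagonal fun i : Fin (n + 1) => if (i : ℕ) = 0 then t else 1).det = t := by
      simp
    have hσdet : σ H.det = H.det := by rw [← det_ctr, hH]
    obtain ⟨x, hx, hx' | hx'⟩ := h _ hσdet hdet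
    · left
      rw [hcl (ctr_one _) (by simp)]
      refine ⟨x⁻¹, inv_ne_zero hx, ?_⟩
      have hσx : σ x ≠ 0 := (map_ne_zero σ).mpr hx
      rw [hx', Matrix.det_one, map_inv₀]
      field_simp
    · right
      rw [hcl ?_ (by rwa [hdetT])]
      · refine ⟨x⁻¹, inv_ne_zero hx, ?_⟩
        have hσx : σ x ≠ 0 := (map_ne_zero σ).mpr hx
        rw [hx', hdetT, map_inv₀]
        field_simp
      · rw [ctr, Matrix.diagonal_map (map_zero σ), Matrix.diagonal_transpose]
        congr 1
        ext i
        split_ifs <;> simp [hσt]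

end Hermitian

section FixedField

variable {p : ℕ} [Fact p.Prime] {K : Type*} [Field K] [Algebra ℚ_[p] K]

/-- The fixed field of an endomorphism that is trivial on `ℚ_[p]`. -/
def fixedField (σ : K →+* K) (h : ∀ x : ℚ_[p], σ (algebraMap ℚ_[p] K x) = algebraMap ℚ_[p] K x) :
    IntermediateField ℚ_[p] K where
  carrier := {x | σ x = x}
  mul_mem' {a b} ha hb := by
    change σ (a * b) = a * b
    rw [map_mul, show σ a = a from ha, show σ b = b from hb]
  add_mem' {a b} ha hb := by
    change σ (a + b) = a + b
    rw [map_add, show σ a = a from ha, show σ b = b from hb]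
  algebraMap_mem' := h
  inv_mem' a ha := by
    change σ a⁻¹ = a⁻¹
    rw [map_inv₀, show σ a = a from ha]

theorem IsExpValuation.intermediateField {ν : K → ℚ} (hν : IsExpValuation p K ν)
    (E : IntermediateField ℚ_[p] K) : IsExpValuation p E fun x => ν x := by
  refine ⟨fun a b ha hb => hν.1 a b ?_ ?_, fun a b ha hb hab => hν.2.1 a b ?_ ?_ ?_,
    fun x hx => hν.2.2 x hx⟩
  · simpa using ha
  · simpa using hb
  · simpa using ha
  · simpa using hb
  · exact_mod_cast hab

variable [FiniteDimensional ℚ_[p] K] {ν : K → ℚ} {σ : K →+* K}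

theorem exists_fixed_mul_sq_add_mul_sq_eq (hν : IsExpValuation p K ν) (hp2 : p ≠ 2)
    (hσ : ∀ x : ℚ_[p], σ (algebraMap ℚ_[p] K x) = algebraMap ℚ_[p] K x) {a b c : K}
    (ha : σ a = a ∧ IsUnitElem ν a) (hb : σ b = b ∧ IsUnitElem ν b)
    (hc : σ c = c ∧ IsUnitElem ν c) :
    ∃ x y : K, σ x = x ∧ σ y = y ∧ a * x ^ 2 + b * y ^ 2 = c := by
  have hE := hν.intermediateField (fixedField σ hσ)
  obtain ⟨x, y, hxy⟩ := hE.exists_mul_sq_add_mul_sq_eq hp2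
    (a := ⟨a, ha.1⟩) (b := ⟨b, hb.1⟩) (c := ⟨c, hc.1⟩)
    (fun h => ha.2.1 (congrArg Subtype.val h)) ha.2.2
    (fun h => hb.2.1 (congrArg Subtype.val h)) hb.2.2
    (fun h => hc.2.1 (congrArg Subtype.val h)) hc.2.2
  exact ⟨x, y, x.2, y.2, congrArg Subtype.val hxy⟩

/-- The squares have index two in the units of the fixed field. -/
theorem exists_fixed_sq_eq_or (hν : IsExpValuation p K ν) (hp2 : p ≠ 2)
    (hσ : ∀ x : ℚ_[p], σ (algebraMap ℚ_[p] K x) = algebraMap ℚ_[p] K x) {u e : K}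
    (hu : σ u = u ∧ IsUnitElem ν u ∧ ¬ ∃ w : K, σ w = w ∧ w ^ 2 = u)
    (he : σ e = e ∧ IsUnitElem ν e) :
    ∃ s : K, σ s = s ∧ s ≠ 0 ∧ (e = s ^ 2 ∨ e = u * s ^ 2) := by
  have hE := hν.intermediateField (fixedField σ hσ)
  have hu0 := hu.2.1.1
  have he0 := he.2.1
  by_cases hsq : IsSquare (⟨e, he.1⟩ : fixedField σ hσ)
  · obtain ⟨s, hs⟩ := hsq
    have hs' : e = s * s := congrArg Subtype.val hs
    refine ⟨s, s.2, ?_, Or.inl (by rw [hs', sq])⟩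
    intro h0
    rw [h0, mul_zero] at hs'
    exact he0 hs'
  · obtain ⟨s, hs⟩ := hE.isSquare_mul_of_not_isSquare hp2 (a := ⟨u, hu.1⟩) (b := ⟨e, he.1⟩)
      (fun h => hu0 (congrArg Subtype.val h)) hu.2.1.2
      (fun h => he0 (congrArg Subtype.val h)) he.2.2
      (by
        rintro ⟨w, hw⟩
        exact hu.2.2 ⟨w, w.2, by rw [sq]; exact (congrArg Subtype.val hw).symm⟩) hsq
    have hs' : u * e = s * s := congrArg Subtype.val hs
    have hs0 : (s : K) ≠ 0 := by
      intro h0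
      rw [h0, mul_zero] at hs'
      exact mul_ne_zero hu0 he0 hs'
    have hσs : σ s = s := s.2
    refine ⟨s / u, by rw [map_div₀, hσs, hu.1], div_ne_zero hs0 hu0, Or.inr ?_⟩
    field_simp
    linear_combination hs'

end FixedField

section Involution

theorem map_eq_neg_of_sq_fixed {F : Type*} [Field F] {σ : F →+* F} {w : F}
    (h : σ (w ^ 2) = w ^ 2) (hw : σ w ≠ w) : σ w = -w := by
  rw [map_pow, sq_eq_sq_iff_eq_or_eq_neg] at h
  exact h.resolve_left hw

variable {p : ℕ} [Fact p.Prime] {K : Type*} [Field K] [Algebra ℚ_[p] K] {ν : K → ℚ} {σ : K →+* K}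

theorem two_ne_zero_of_padicAlgebra (p : ℕ) [Fact p.Prime] (K : Type*) [Field K]
    [Algebra ℚ_[p] K] : (2 : K) ≠ 0 := by
  rw [← map_ofNat (algebraMap ℚ_[p] K) 2, _root_.map_ne_zero]
  exact two_ne_zero

theorem ramified_map_eq_neg (hν : IsExpValuation p K ν) {π : K}
    (hπ : σ π = π ∧ π ≠ 0 ∧ 0 < ν π ∧ ∀ a : K, σ a = a → a ≠ 0 → 0 < ν a → ν π ≤ ν a) {w : K}
    (hw : w ^ 2 = π) : σ w = -w := by
  refine map_eq_neg_of_sq_fixed (by rw [hw, hπ.1]) fun hσw => ?_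
  have hw0 : w ≠ 0 := by
    rintro rfl
    exact hπ.2.1 (by rw [← hw]; simp)
  have h1 := hν.map_pow hw0 2
  rw [hw] at h1
  push_cast at h1
  have h2 := hπ.2.2.1
  have h3 := hπ.2.2.2 w hσw hw0 (by linarith)
  linarith

theorem isPrime_unit_mul (hν : IsExpValuation p K ν) {u : K} (hu : σ u = u ∧ IsUnitElem ν u)
    {π : K}
    (hπ : σ π = π ∧ π ≠ 0 ∧ 0 < ν π ∧ ∀ a : K, σ a = a → a ≠ 0 → 0 < ν a → ν π ≤ ν a) :
    σ (u * π) = u * π ∧ u * π ≠ 0 ∧ 0 < ν (u * π) ∧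
      ∀ a : K, σ a = a → a ≠ 0 → 0 < ν a → ν (u * π) ≤ ν a := by
  rw [hν.1 u π hu.2.1 hπ.2.1, hu.2.2, zero_add, map_mul, hu.1, hπ.1]
  exact ⟨rfl, mul_ne_zero hu.2.1 hπ.2.1, hπ.2.2⟩

end Involution

section Classification

variable {p : ℕ} [Fact p.Prime] {K : Type*} [Field K] [Algebra ℚ_[p] K]
  [FiniteDimensional ℚ_[p] K] {ν : K → ℚ} {σ : K →+* K}

/-- The three ramification types of `K` over the fixed field. -/
theorem exists_sq_eq_unit_or_prime (hp2 : p ≠ 2) (hσ : ∀ a, σ (σ a) = a)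
    (hσ1 : σ ≠ RingHom.id K) (hν : IsExpValuation p K ν) {u : K}
    (hu : σ u = u ∧ IsUnitElem ν u ∧ ¬ ∃ w : K, σ w = w ∧ w ^ 2 = u) {π : K}
    (hπ : σ π = π ∧ π ≠ 0 ∧ 0 < ν π ∧ ∀ a : K, σ a = a → a ≠ 0 → 0 < ν a → ν π ≤ ν a) :
    ∃ w : K, w ^ 2 = u ∨ w ^ 2 = π ∨ w ^ 2 = u * π := by
  have hσp := involution_algebraMap hν σ hσ hπ
  obtain ⟨a, ha⟩ : ∃ a, σ a ≠ a := by
    by_contra! h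
    exact hσ1 (RingHom.ext h)
  set w := a - σ a with hw
  have hw0 : w ≠ 0 := sub_ne_zero.mpr ha.symm
  have hσw : σ w = -w := by rw [hw, map_sub, hσ]; ring
  obtain ⟨k, e, hσe, he0, hνe, hk⟩ := hν.exists_zpow_mul σ hπ (c := w ^ 2)
    (by rw [map_pow, hσw, neg_sq]) (pow_ne_zero 2 hw0)
  obtain ⟨s, hσs, hs0, hs⟩ := exists_fixed_sq_eq_or hν hp2 hσp hu ⟨hσe, he0, hνe⟩
  have hπ0 := hπ.2.1
  obtain ⟨m, rfl | rfl⟩ := Int.even_or_odd' k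
  · set q := π ^ m with hq
    have hq0 : q ≠ 0 := zpow_ne_zero m hπ0
    have hσq : σ q = q := by rw [hq, map_zpow₀, hπ.1]
    rw [two_mul, zpow_add₀ hπ0, ← hq] at hk
    rcases hs with rfl | rfl
    · exfalso
      have h1 : w ^ 2 = (q * s) ^ 2 := by rw [hk]; ring
      have h2 : σ w = w := by
        rcases sq_eq_sq_iff_eq_or_eq_neg.mp h1 with h | h <;> rw [h] <;> simp [hσq, hσs]
      rw [hσw] at h2
      have h3 : 2 * w = 0 := by linear_combination -h2
      exact (mul_ne_zero (two_ne_zero_of_padicAlgebra p K) hw0) h3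
    · refine ⟨w / (q * s), Or.inl ?_⟩
      rw [div_pow, hk]
      field_simp
  · set q := π ^ m with hq
    have hq0 : q ≠ 0 := zpow_ne_zero m hπ0
    rw [two_mul, zpow_add₀ hπ0, zpow_add₀ hπ0, zpow_one, ← hq] at hk
    rcases hs with rfl | rfl
    · refine ⟨w / (q * s), Or.inr (Or.inl ?_)⟩
      rw [div_pow, hk]
      field_simp
    · refine ⟨w / (q * s), Or.inr (Or.inr ?_)⟩
      rw [div_pow, hk]
      field_simp

theorem unramified_norm (hp2 : p ≠ 2) (hσp : ∀ x : ℚ_[p], σ (algebraMap ℚ_[p] K x) =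
    algebraMap ℚ_[p] K x) (hν : IsExpValuation p K ν) {u w : K} (hu : σ u = u ∧ IsUnitElem ν u)
    (hw : w ^ 2 = u) (hσw : σ w = -w) {e : K} (he : σ e = e ∧ IsUnitElem ν e) :
    ∃ z : K, z * σ z = e := by
  obtain ⟨x, y, hx, hy, hxy⟩ := exists_fixed_mul_sq_add_mul_sq_eq hν hp2 hσp (a := 1) (b := -u)
    ⟨map_one σ, one_ne_zero, hν.map_one⟩
    ⟨by rw [map_neg, hu.1], neg_ne_zero.mpr hu.2.1, by rw [hν.map_neg, hu.2.2]⟩ he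
  refine ⟨x + y * w, ?_⟩
  rw [map_add, map_mul, hx, hy, hσw, ← hxy, ← hw]
  ring

theorem unramified_normClasses (hp2 : p ≠ 2) (hσp : ∀ x : ℚ_[p], σ (algebraMap ℚ_[p] K x) =
    algebraMap ℚ_[p] K x) (hν : IsExpValuation p K ν) {u w : K} (hu : σ u = u ∧ IsUnitElem ν u)
    (hw : w ^ 2 = u) (hσw : σ w = -w) {π : K}
    (hπ : σ π = π ∧ π ≠ 0 ∧ 0 < ν π ∧ ∀ a : K, σ a = a → a ≠ 0 → 0 < ν a → ν π ≤ ν a) :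
    NormClasses σ π := by
  intro c hc hc0
  obtain ⟨k, e, hσe, he0, hνe, rfl⟩ := hν.exists_zpow_mul σ hπ hc hc0
  obtain ⟨z, rfl⟩ := unramified_norm hp2 hσp hν hu hw hσw ⟨hσe, he0, hνe⟩
  have hπ0 := hπ.2.1
  obtain ⟨m, rfl | rfl⟩ := Int.even_or_odd' k
  · refine ⟨π ^ m * z, mul_ne_zero (zpow_ne_zero m hπ0) (left_ne_zero_of_mul he0), Or.inl ?_⟩
    rw [map_mul, map_zpow₀, hπ.1, two_mul, zpow_add₀ hπ0]
    ring
  · refine ⟨π ^ m * z, mul_ne_zero (zpow_ne_zero m hπ0) (left_ne_zero_of_mul he0), Or.inr ?_⟩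
    rw [map_mul, map_zpow₀, hπ.1, two_mul, zpow_add₀ hπ0, zpow_add₀ hπ0, zpow_one]
    ring

theorem unramified_exists_add_norm_eq (hp2 : p ≠ 2)
    (hσp : ∀ x : ℚ_[p], σ (algebraMap ℚ_[p] K x) = algebraMap ℚ_[p] K x)
    (hν : IsExpValuation p K ν) {u w : K} (hu : σ u = u ∧ IsUnitElem ν u)
    (hw : w ^ 2 = u) (hσw : σ w = -w) {t : K} (ht : σ t = t) :
    ∃ x y : K, x * σ x + y * σ y = t := by
  obtain ⟨z, hz⟩ := unramified_norm hp2 hσp hν hu hw hσw (e := -1)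
    ⟨by simp, by simp, by rw [hν.map_neg, hν.map_one]⟩
  have h2 : (2 : K) ≠ 0 := two_ne_zero_of_padicAlgebra p K
  refine ⟨(t + 1) / 2, z * ((t - 1) / 2), ?_⟩
  simp only [map_div₀, map_mul, map_add, map_sub, map_one, map_ofNat, ht]
  field_simp
  linear_combination (t - 1) ^ 2 * hz

theorem ramified_normClasses (hp2 : p ≠ 2) (hσp : ∀ x : ℚ_[p], σ (algebraMap ℚ_[p] K x) =
    algebraMap ℚ_[p] K x) (hν : IsExpValuation p K ν) {u : K}
    (hu : σ u = u ∧ IsUnitElem ν u ∧ ¬ ∃ w : K, σ w = w ∧ w ^ 2 = u) {π : K}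
    (hπ : σ π = π ∧ π ≠ 0 ∧ 0 < ν π ∧ ∀ a : K, σ a = a → a ≠ 0 → 0 < ν a → ν π ≤ ν a) {w : K}
    (hw : w ^ 2 = π) (hσw : σ w = -w) : NormClasses σ u := by
  intro c hc hc0
  obtain ⟨k, e, hσe, he0, hνe, rfl⟩ := hν.exists_zpow_mul σ hπ hc hc0
  have hw0 : w ≠ 0 := by
    rintro rfl
    exact hπ.2.1 (by rw [← hw]; simp)
  have hnorm : (w * σ w) ^ k * (-1) ^ k = π ^ k := by
    rw [← mul_zpow, hσw, ← hw]
    congr 1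
    ring
  have hneg : ν ((-1) ^ k) = 0 := by
    rw [hν.map_zpow (by simp), hν.map_neg, hν.map_one, mul_zero]
  have hneg0 : ((-1) ^ k : K) ≠ 0 := zpow_ne_zero k (by simp)
  obtain ⟨s, hσs, hs0, hs⟩ := exists_fixed_sq_eq_or hν hp2 hσp hu (e := (-1) ^ k * e)
    ⟨by rw [map_mul, map_zpow₀, map_neg, map_one, hσe], mul_ne_zero hneg0 he0,
      by rw [hν.1 _ _ hneg0 he0, hneg, hνe, add_zero]⟩
  refine ⟨w ^ k * s, mul_ne_zero (zpow_ne_zero k hw0) hs0, hs.imp ?_ ?_⟩ <;> intro h <;>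
    rw [← hnorm, mul_assoc, h, mul_zpow, map_mul, map_zpow₀, hσs] <;> ring

end Classification

section Stmt11

theorem stmt11 (p : ℕ) [Fact p.Prime] (hp : p ≠ 2)
    (K : Type*) [Field K] [Algebra ℚ_[p] K] [FiniteDimensional ℚ_[p] K]
    (σ : K →+* K) (hσinv : ∀ a, σ (σ a) = a) (hσ : σ ≠ RingHom.id K)
    (ν : K → ℚ) (hν : IsExpValuation p K ν)
    -- u : a unit of the ring of integers of the fixed field K∘ that is not a square in K∘
    (u : K) (hu : σ u = u ∧ IsUnitElem ν u ∧ ¬ ∃ w : K, σ w = w ∧ w ^ 2 = u)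
    -- π : a prime element of K∘
    (π : K) (hπ : σ π = π ∧ π ≠ 0 ∧ 0 < ν π ∧
      ∀ a : K, σ a = a → a ≠ 0 → 0 < ν a → ν π ≤ ν a)
    (n : ℕ) (H : Mat K n) (hH : ctr σ H = H) (hHreg : H.det ≠ 0) :
    -- classification by dimension and determinant
    (∀ H' : Mat K n, ctr σ H' = H' → H'.det ≠ 0 →
      (StarCongruent σ H H' ↔ ∃ c : K, c ≠ 0 ∧ H'.det = c * σ c * H.det)) ∧
    -- the canonical representatives
    (((∃ w : K, w ^ 2 = u) →
        (StarCongruent σ H (1 : Mat K n) ∨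
         StarCongruent σ H (Matrix.diagonal fun i : Fin n => if (i : ℕ) = 0 then π else 1))) ∧
     (((∃ w : K, w ^ 2 = π) ∨ (∃ w : K, w ^ 2 = u * π)) →
        (StarCongruent σ H (1 : Mat K n) ∨
         StarCongruent σ H (Matrix.diagonal fun i : Fin n => if (i : ℕ) = 0 then u else 1)))) := by
  have hσp := involution_algebraMap hν σ hσinv hπ
  have h2 : (2 : K) ≠ 0 := two_ne_zero_of_padicAlgebra p K
  have hu' : σ u = u ∧ IsUnitElem ν u := ⟨hu.1, hu.2.1⟩
  have hnz {w c : K} (hw : w ^ 2 = c) (hc : c ≠ 0) : w ≠ 0 := by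
    rintro rfl
    exact hc (by rw [← hw]; simp)
  have hram : ((∃ w : K, w ^ 2 = π) ∨ (∃ w : K, w ^ 2 = u * π)) →
      (∃ w : K, w ≠ 0 ∧ σ w = -w) ∧ NormClasses σ u := by
    rintro (⟨w, hw⟩ | ⟨w, hw⟩)
    · have hσw := ramified_map_eq_neg hν hπ hw
      exact ⟨⟨w, hnz hw hπ.2.1, hσw⟩, ramified_normClasses hp hσp hν hu hπ hw hσw⟩
    · have hπ' := isPrime_unit_mul hν hu' hπ
      have hσw := ramified_map_eq_neg hν hπ' hw
      exact ⟨⟨w, hnz hw hπ'.2.1, hσw⟩, ramified_normClasses hp hσp hν hu hπ' hw hσw⟩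
  have hsumu : ∃ x y : K, x * σ x + y * σ y = u := by
    obtain ⟨x, y, hx, hy, hxy⟩ := exists_fixed_mul_sq_add_mul_sq_eq hν hp hσp (a := 1) (b := 1)
      ⟨map_one σ, one_ne_zero, hν.map_one⟩ ⟨map_one σ, one_ne_zero, hν.map_one⟩ hu'
    exact ⟨x, y, by rw [hx, hy, ← hxy]; ring⟩
  have hunr : (∃ w : K, w ^ 2 = u) → (∃ w : K, w ≠ 0 ∧ σ w = -w) ∧ NormClasses σ π ∧
      ∃ x y : K, x * σ x + y * σ y = π := by
    rintro ⟨w, hw⟩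
    have hσw : σ w = -w :=
      map_eq_neg_of_sq_fixed (by rw [hw, hu.1]) fun h => hu.2.2 ⟨w, h, hw⟩
    exact ⟨⟨w, hnz hw hu.2.1.1, hσw⟩, unramified_normClasses hp hσp hν hu' hw hσw hπ,
      unramified_exists_add_norm_eq hp hσp hν hu' hw hσw hπ.1⟩
  refine ⟨fun H' hH' hH'reg => ?_, fun h => ?_, fun h => ?_⟩
  · obtain ⟨w, hw⟩ := exists_sq_eq_unit_or_prime hp hσinv hσ hν hu hπ
    have hw' : (∃ w : K, w ^ 2 = u) ∨ (∃ w : K, w ^ 2 = π) ∨ (∃ w : K, w ^ 2 = u * π) :=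
      hw.imp (⟨w, ·⟩) (Or.imp (⟨w, ·⟩) (⟨w, ·⟩))
    rcases hw' with h | h
    · obtain ⟨⟨v, hv, hσv⟩, hN, hsum⟩ := hunr h
      exact starCongruent_iff_det hσinv h2 hv hσv (hN.represents_one hπ.1 hπ.2.1 hsum)
        hH hHreg hH' hH'reg
    · obtain ⟨⟨v, hv, hσv⟩, hN⟩ := hram h
      exact starCongruent_iff_det hσinv h2 hv hσv (hN.represents_one hu.1 hu.2.1.1 hsumu)
        hH hHreg hH' hH'reg
  · obtain ⟨⟨v, hv, hσv⟩, hN, hsum⟩ := hunr h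
    exact hN.starCongruent_or hπ.1 hπ.2.1 hsum hσinv h2 hv hσv hH hHreg
  · obtain ⟨⟨v, hv, hσv⟩, hN⟩ := hram h
    exact hN.starCongruent_or hu.1 hu.2.1.1 hsumu hσinv h2 hv hσv hH hHreg

end Stmt11
end
end Can
end

section
/- Over any field of characteristic not 2, each pair of skew-symmetric matrices of the same size is congruent to a direct sum, uniquely determined up to permutation of summands, of pairs of the following form: (i) ([F_n ⟍ −F_nᵀ], [G_n ⟍ −G_nᵀ]); (ii) ([I_n ⟍ −I_n], [Φ ⟍ −Φᵀ]), where Φ is an n×n Frobenius block; (iii) ([J_n(0) ⟍ −J_n(0)ᵀ], [I_n ⟍ −I_n]). -/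
open Polynomial Matrix

namespace Can

noncomputable section

variable {F : Type*} [Field F]

section Stmt12
variable {F : Type*} [Field F]

/-- type (i): ([Fₙ ⟍ −Fₙᵀ], [Gₙ ⟍ −Gₙᵀ]) -/
def T12i (b : PBlock F) : Prop :=
  ∃ n : ℕ, 0 < n ∧
    b = ⟨n + (n - 1), (skewSum (Fmat F n) (-(Fmat F n)ᵀ), skewSum (Gmat F n) (-(Gmat F n)ᵀ))⟩

/-- type (ii): ([Iₙ ⟍ −Iₙ], [Φ ⟍ −Φᵀ]) with Φ an n×n Frobenius block -/
def T12ii (b : PBlock F) : Prop :=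
  ∃ (pp : Polynomial F) (l : ℕ), pp.Monic ∧ Irreducible pp ∧ 0 < l ∧
    b = ⟨(pp ^ l).natDegree + (pp ^ l).natDegree,
      (skewSum (1 : Mat F (pp ^ l).natDegree) (-1),
       skewSum (companion F (pp ^ l)) (-(companion F (pp ^ l))ᵀ))⟩

/-- type (iii): ([Jₙ(0) ⟍ −Jₙ(0)ᵀ], [Iₙ ⟍ −Iₙ]) -/
def T12iii (b : PBlock F) : Prop :=
  ∃ n : ℕ, 0 < n ∧
    b = ⟨n + n, (skewSum (J F n 0) (-(J F n 0)ᵀ), skewSum (1 : Mat F n) (-1))⟩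

section PairsOfForms

variable {V : Type*} [AddCommGroup V] [Module F V]

/-- `X` is the pair of Gram matrices of `(a, b)` in some basis. -/
def Realizes (a b : V →ₗ[F] V →ₗ[F] F) (X : PBlock F) : Prop :=
  ∃ e : Module.Basis (Fin X.1) F V,
    (∀ i j, a (e i) (e j) = X.2.1 i j) ∧ ∀ i j, b (e i) (e j) = X.2.2 i j

/-- There is a family of vectors with Gram matrices `M`, `N`, and a dual family of functionals
through which both forms factor. -/
def DualSystem {κ : Type*} [Fintype κ] [DecidableEq κ] (a b : V →ₗ[F] V →ₗ[F] F)
    (M N : Matrix κ κ F) : Prop :=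
  ∃ (t : κ → V) (f : κ → V →ₗ[F] F), (∀ k l, f k (t l) = if k = l then 1 else 0) ∧
    (∀ k v, a (t k) v = ∑ l, M k l * f l v) ∧ (∀ k v, b (t k) v = ∑ l, N k l * f l v)

theorem DualSystem.swap {κ : Type*} [Fintype κ] [DecidableEq κ] {a b : V →ₗ[F] V →ₗ[F] F}
    {M N : Matrix κ κ F} (h : DualSystem a b M N) : DualSystem b a N M := by
  obtain ⟨t, f, h1, h2, h3⟩ := h
  exact ⟨t, f, h1, h3, h2⟩

theorem DualSystem.exists_complement [FiniteDimensional F V] {κ : Type*} [Fintype κ]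
    [DecidableEq κ] {a b : V →ₗ[F] V →ₗ[F] F}
    {M N : Matrix κ κ F} (h : DualSystem a b M N) (ha : ∀ x y, a x y = -a y x)
    (hb : ∀ x y, b x y = -b y x) {d : ℕ} (σ : κ ≃ Fin d) :
    ∃ U : Submodule F V, Module.finrank F U + d = Module.finrank F V ∧
      ∀ L : List (PBlock F), Realizes (a.domRestrict₁₂ U U) (b.domRestrict₁₂ U U) (psum L) →
        Realizes a b
          (psum (⟨d, (Matrix.reindex σ σ M, Matrix.reindex σ σ N)⟩ :: L)) := by
  obtain ⟨t, f, hft, hat, hbt⟩ := h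
  let p : V →ₗ[F] (κ → F) := LinearMap.pi f
  let U : Submodule F V := LinearMap.ker p
  have hU : ∀ u : U, ∀ k, f k u = 0 := fun u k => congrFun (LinearMap.mem_ker.1 u.2) k
  let q : (κ → F) →ₗ[F] V := Fintype.linearCombination F t
  have hpq : ∀ c, p (q c) = c := by
    intro c
    ext k
    simp [p, q, Fintype.linearCombination_apply, hft]
  let E : ((κ → F) × U) ≃ₗ[F] V :=
    { toFun := fun x => q x.1 + x.2
      map_add' := by
        intro x y
        simp only [Prod.fst_add, Prod.snd_add, map_add, Submodule.coe_add]
        abel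
      map_smul' := by
        intro c x
        simp
      invFun := fun v => (p v, ⟨v - q (p v), by
        simp only [U, LinearMap.mem_ker, map_sub, hpq, sub_self]⟩)
      left_inv := by
        rintro ⟨c, u⟩
        have hu : p u = 0 := u.2
        ext
        · simp [hpq, hu]
        · simp [hpq, hu]
      right_inv := by
        intro v
        simp }
  have hE1 : ∀ k, E (Pi.single k 1, 0) = t k := by
    intro k
    simp [E, q, Fintype.linearCombination_apply_single]
  have hE2 : ∀ u : U, E (0, u) = u := by
    intro u
    simp [E]
  refine ⟨U, ?_, ?_⟩
  · have := E.finrank_eq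
    rw [Module.finrank_prod, Module.finrank_pi, Fintype.card_congr σ, Fintype.card_fin] at this
    omega
  · rintro L ⟨e, hea, heb⟩
    let B₀ : Module.Basis (Fin d ⊕ Fin (psum L).1) F V :=
      (((Pi.basisFun F κ).reindex σ).prod e).map E
    have hB1 : ∀ i, B₀ (Sum.inl i) = t (σ.symm i) := by
      intro i
      rw [← hE1]
      simp [B₀, Module.Basis.prod_apply]
    have hB2 : ∀ i, B₀ (Sum.inr i) = e i := by
      intro i
      rw [← hE2]
      simp [B₀, Module.Basis.prod_apply]
    have key : ∀ (c : V →ₗ[F] V →ₗ[F] F) (K : Matrix κ κ F) (D : Mat F (psum L).1),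
        (∀ x y, c x y = -c y x) → (∀ k v, c (t k) v = ∑ l, K k l * f l v) →
        (∀ i j, c.domRestrict₁₂ U U (e i) (e j) = D i j) →
        ∀ i j, c (B₀ i) (B₀ j) = Matrix.fromBlocks (Matrix.reindex σ σ K) 0 0 D i j := by
      intro c K D hc hct hce i j
      have h0 : ∀ k (u : U), c (t k) u = 0 := by
        intro k u
        rw [hct]
        simp [hU]
      rcases i with i | i <;> rcases j with j | j
      · rw [hB1, hB1, hct]
        simp [hft]
      · rw [hB1, hB2, h0]
        simp
      · rw [hB1, hB2, hc, h0]
        simp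
      · rw [hB2, hB2]
        exact hce i j
    let B : Module.Basis (Fin (d + (psum L).1)) F V := B₀.reindex finSumFinEquiv
    have hB : ∀ i, B i = B₀ (finSumFinEquiv.symm i) := fun i => by simp [B]
    refine ⟨B, fun i j => ?_, fun i j => ?_⟩
    · exact ((congrArg₂ (fun x y => a x y) (hB i) (hB j)).trans (key a M _ ha hat hea _ _))
    · exact ((congrArg₂ (fun x y => b x y) (hB i) (hB j)).trans (key b N _ hb hbt heb _ _))

/-- A sequence of vectors whose Gram matrix is both Hankel and alternating is totally isotropic. -/
theorem hankel_eq_zero (h2 : (2 : F) ≠ 0) (H : ℕ → ℕ → F) (N : ℕ)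
    (hs : ∀ i j, H i j = -H j i)
    (hh : ∀ i j, i < N → j < N → H (i + 1) j = H i (j + 1)) :
    ∀ i j, i ≤ N → j ≤ N → H i j = 0 := by
  have self : ∀ x : F, x = -x → x = 0 := by
    intro x hx
    have : (2 : F) * x = 0 := by linear_combination hx
    exact (mul_eq_zero.1 this).resolve_left h2
  have main : ∀ d i, i + d ≤ N → H i (i + d) = 0 := by
    intro d
    induction d using Nat.strong_induction_on with
    | _ d ih =>
      intro i hi
      match d, ih, hi with
      | 0, _, _ => exact self _ (hs i i)
      | 1, _, hi =>
        have h1 := hs i (i + 1)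
        rw [hh i i (by omega) (by omega)] at h1
        exact self _ h1
      | d + 2, ih, hi =>
        have := hh i (i + d + 1) (by omega) (by omega)
        rw [show i + (d + 2) = i + d + 1 + 1 by ring, ← this]
        have := ih d (by omega) (i + 1) (by omega)
        rwa [show i + 1 + d = i + d + 1 by ring] at this
  intro i j hi hj
  rcases le_total i j with h | h
  · obtain ⟨d, rfl⟩ := Nat.exists_eq_add_of_le h
    exact main d i hj
  · obtain ⟨d, rfl⟩ := Nat.exists_eq_add_of_le h
    rw [hs, main d j hi, neg_zero]

/-- Two isotropic families in duality on which `b` acts through `a` by the matrix `Φ`. -/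
theorem dualSystem_of_pairing {a b : V →ₗ[F] V →ₗ[F] F} (ha : ∀ x y, a x y = -a y x)
    (hb : ∀ x y, b x y = -b y x) {d : ℕ} (Φ : Mat F d) (e y : Fin d → V)
    (hee : ∀ i j, a (e i) (e j) = 0) (hyy : ∀ i j, a (y i) (y j) = 0)
    (hG : IsUnit (Matrix.of fun j i => a (y j) (e i)).det)
    (hbe : ∀ i v, b (e i) v = ∑ k, Φ k i * a (e k) v)
    (hby : ∀ i v, b (y i) v = ∑ k, Φ k i * a (y k) v) :
    DualSystem a b (Matrix.fromBlocks 0 (-1) 1 0 : Matrix (Fin d ⊕ Fin d) (Fin d ⊕ Fin d) F)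
      (Matrix.fromBlocks 0 (-Φᵀ) Φ 0) := by
  set G : Mat F d := Matrix.of fun j i => a (y j) (e i) with hGdef
  let z : Fin d → V := fun j => ∑ k, G⁻¹ j k • y k
  have hze : ∀ j i, a (z j) (e i) = if j = i then 1 else 0 := by
    intro j i
    have : (G⁻¹ * G) j i = (1 : Mat F d) j i := by rw [Matrix.nonsing_inv_mul G hG]
    rw [Matrix.mul_apply, Matrix.one_apply] at this
    rw [← this]
    simp [z, hGdef]
  have hyz : ∀ k, y k = ∑ l, G k l • z l := by
    intro k
    simp only [z, Finset.smul_sum, smul_smul]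
    rw [Finset.sum_comm]
    simp_rw [← Finset.sum_smul, ← Matrix.mul_apply, Matrix.mul_nonsing_inv G hG, Matrix.one_apply]
    simp
  have hzz : ∀ i j, a (z i) (z j) = 0 := by
    intro i j
    simp [z, hyy]
  have hbz : ∀ j, ∃ c : Fin d → F, ∀ v, b (z j) v = ∑ k, c k * a (z k) v := by
    intro j
    refine ⟨fun m => ∑ k, ∑ l, G⁻¹ j k * (Φ l k * G l m), fun v => ?_⟩
    have h1 : b (z j) v = ∑ k, G⁻¹ j k * ∑ l, Φ l k * ∑ m, G l m * a (z m) v := by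
      simp only [z, map_sum, map_smul, LinearMap.sum_apply, LinearMap.smul_apply, smul_eq_mul, hby]
      refine Finset.sum_congr rfl fun k _ => ?_
      congr 1
      refine Finset.sum_congr rfl fun l _ => ?_
      congr 1
      conv_lhs => rw [hyz l]
      simp [z]
    rw [h1]
    simp only [Finset.mul_sum, Finset.sum_mul]
    conv_rhs => rw [Finset.sum_comm]
    refine Finset.sum_congr rfl fun k _ => ?_
    conv_rhs => rw [Finset.sum_comm]
    refine Finset.sum_congr rfl fun l _ => Finset.sum_congr rfl fun m _ => ?_
    ring
  refine ⟨Sum.elim e z, Sum.elim (fun i => a (z i)) (fun j => -a (e j)), ?_, ?_, ?_⟩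
  · rintro (k | k) (l | l)
    · simp [hze]
    · simp [hzz]
    · simp [hee]
    · simp [ha (e k), hze, eq_comm]
  · rintro (k | k) v
    · simp [Matrix.one_apply]
    · simp [Matrix.one_apply]
  · rintro (k | k) v
    · simp [hbe]
    · obtain ⟨c, hc⟩ := hbz k
      have : ∀ i, c i = Φ k i := by
        intro i
        have h1 := hc (e i)
        rw [hb, hbe] at h1
        simp only [ha (e _) (z _), hze] at h1
        simpa using h1.symm
      simp [hc, this]

end PairsOfForms

section Chains

variable {V : Type*} [AddCommGroup V] [Module F V]

theorem exists_eq_of_vanishes_on_ker [FiniteDimensional F V] {W : Type*} [AddCommGroup W]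
    [Module F W] (g : V →ₗ[F] W) (φ : V →ₗ[F] F) (h : ∀ x, g x = 0 → φ x = 0) :
    ∃ θ : W →ₗ[F] F, ∀ x, φ x = θ (g x) := by
  have h1 : φ ∈ LinearMap.range g.dualMap := by
    rw [LinearMap.range_dualMap_eq_dualAnnihilator_ker, Submodule.mem_dualAnnihilator]
    exact fun x hx => h x hx
  obtain ⟨θ, hθ⟩ := h1
  exact ⟨θ, fun x => by rw [← hθ]; rfl⟩

theorem exists_eval_eq [FiniteDimensional F V] (θ : (V →ₗ[F] F) →ₗ[F] F) :
    ∃ y : V, ∀ φ, θ φ = φ y := by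
  refine ⟨(Module.evalEquiv F V).symm θ, fun φ => ?_⟩
  have := LinearMap.congr_fun ((Module.evalEquiv F V).apply_symm_apply θ) φ
  rw [← this]
  simp

theorem exists_apply_eq_of_skew [FiniteDimensional F V] {a : V →ₗ[F] V →ₗ[F] F}
    (ha : ∀ x y, a x y = -a y x) (φ : V →ₗ[F] F) (h : ∀ x, a x = 0 → φ x = 0) :
    ∃ y, a y = φ := by
  obtain ⟨θ, hθ⟩ := exists_eq_of_vanishes_on_ker a φ h
  obtain ⟨y, hy⟩ := exists_eval_eq θ
  refine ⟨-y, LinearMap.ext fun x => ?_⟩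
  rw [hθ, hy, map_neg, LinearMap.neg_apply, ← ha]

/-- A Jordan chain of the pencil starting in the kernel of `a`. -/
def Chain (a b : V →ₗ[F] V →ₗ[F] F) (k : ℕ) (v : ℕ → V) : Prop :=
  a (v 0) = 0 ∧ ∀ i < k, a (v (i + 1)) = b (v i)

theorem sum_J_mul {d : ℕ} (i : Fin d) (g : Fin d → F) :
    ∑ k, J F d 0 k i * g k = if h : (i : ℕ) + 1 < d then g ⟨i + 1, h⟩ else 0 := by
  split_ifs with h
  · rw [Finset.sum_eq_single ⟨i + 1, h⟩]
    · simp [J, Fin.ext_iff]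
    · intro k _ hk
      have : (k : ℕ) ≠ i + 1 := fun h => hk (Fin.ext h)
      simp [J, this]
    · simp
  · refine Finset.sum_eq_zero fun k _ => ?_
    have : (k : ℕ) ≠ i + 1 := by omega
    simp [J, this]

theorem exists_dualSystem_nilpotent [FiniteDimensional F V] (h2 : (2 : F) ≠ 0)
    {a b : V →ₗ[F] V →ₗ[F] F} (ha : ∀ x y, a x y = -a y x) (hb : ∀ x y, b x y = -b y x)
    (h : ∃ k v, Chain a b k v ∧ ∀ y, a y ≠ b (v k)) :
    ∃ d, 0 < d ∧ DualSystem a b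
      (Matrix.fromBlocks 0 (-(J F d 0)ᵀ) (J F d 0) 0 : Matrix (Fin d ⊕ Fin d) (Fin d ⊕ Fin d) F)
      (Matrix.fromBlocks 0 (-1) 1 0) := by
  classical
  let k := Nat.find h
  obtain ⟨v, hv, hvk⟩ : ∃ v, Chain a b k v ∧ ∀ y, a y ≠ b (v k) := Nat.find_spec h
  have hmin : ∀ j < k, ∀ w, Chain a b j w → ∃ y, a y = b (w j) := by
    intro j hj w hw
    by_contra! hc
    exact Nat.find_min h hj ⟨w, hw, hc⟩
  obtain ⟨w₀, hw₀, hvw⟩ : ∃ w₀, a w₀ = 0 ∧ b (v k) w₀ ≠ 0 := by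
    by_contra! hc
    obtain ⟨y, hy⟩ := exists_apply_eq_of_skew ha (b (v k)) hc
    exact hvk y hy
  have hext : ∀ j ≤ k, ∃ w, Chain a b j w ∧ w 0 = w₀ := by
    intro j
    induction j with
    | zero => exact fun _ => ⟨fun _ => w₀, ⟨hw₀, by simp⟩, rfl⟩
    | succ j ih =>
      intro hj
      obtain ⟨w, hw, hw0⟩ := ih (by omega)
      obtain ⟨y, hy⟩ := hmin j (by omega) w hw
      refine ⟨Function.update w (j + 1) y, ⟨?_, ?_⟩, ?_⟩
      · rw [Function.update_of_ne (by omega)]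
        exact hw.1
      · intro i hi
        rw [Function.update_of_ne (a := i) (by omega)]
        rcases Nat.lt_succ_iff_lt_or_eq.1 hi with h | rfl
        · rw [Function.update_of_ne (by omega)]
          exact hw.2 i h
        · rw [Function.update_self]
          exact hy
      · rw [Function.update_of_ne (by omega), hw0]
  obtain ⟨w, hw, rfl⟩ := hext k le_rfl
  have cross : ∀ x y, Chain a b k x → Chain a b k y → ∀ i j, i < k → j < k →
      b (x (i + 1)) (y j) = b (x i) (y (j + 1)) := by
    intro x y hx hy i j hi hj
    rw [← hx.2 i hi, hb, ← hy.2 j hj, ha, neg_neg]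
  have iso : ∀ x, Chain a b k x → ∀ i j, i ≤ k → j ≤ k → b (x i) (x j) = 0 := by
    intro x hx
    exact hankel_eq_zero h2 (fun i j => b (x i) (x j)) k (fun i j => hb _ _)
      (fun i j hi hj => cross x x hx hx i j hi hj)
  have slide : ∀ j i, i + j ≤ k → b (v i) (w j) = b (v (i + j)) (w 0) := by
    intro j
    induction j with
    | zero => simp
    | succ j ih =>
      intro i hi
      rw [← cross v w hv hw i j (by omega) (by omega), ih _ (by omega)]
      congr 3
      ring
  have hsmall : ∀ i j, i + j < k → b (v i) (w j) = 0 := by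
    intro i j hij
    rw [slide j i hij.le, ← hv.2 _ hij, ha, hw.1]
    simp
  have step : ∀ x, Chain a b k x → ∀ (i : Fin (k + 1)) (u : V),
      a (x (k - i)) u = ∑ l : Fin (k + 1), J F (k + 1) 0 l i * b (x (k - l)) u := by
    intro x hx i u
    rw [sum_J_mul i (fun l => b (x (k - l)) u)]
    split_ifs with h
    · rw [show k - (i : ℕ) = k - (i + 1) + 1 by omega, hx.2 _ (by omega)]
    · rw [show k - (i : ℕ) = 0 by omega, hx.1]
      simp
  refine ⟨k + 1, by omega, DualSystem.swap ?_⟩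
  refine dualSystem_of_pairing hb ha (J F (k + 1) 0) (fun i => v (k - i)) (fun i => w (k - i))
    (fun i j => iso v hv _ _ (by omega) (by omega)) (fun i j => iso w hw _ _ (by omega) (by omega))
    ?_ (step v hv) (step w hw)
  set G : Mat F (k + 1) := Matrix.of fun j i => b (w (k - j)) (v (k - i)) with hG
  have hdet : (G.submatrix Fin.revPerm id).det ≠ 0 := by
    rw [Matrix.det_of_isLowerTriangular]
    · refine Finset.prod_ne_zero_iff.2 fun i _ => ?_
      simp only [hG, Matrix.submatrix_apply, Fin.revPerm_apply, id, Matrix.of_apply, Fin.val_rev]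
      rw [hb, slide _ _ (by omega), show k - (i : ℕ) + (k - (k + 1 - (i + 1))) = k by omega]
      exact neg_ne_zero.2 hvw
    · intro i j hij
      have hij : (i : ℕ) < j := hij
      simp only [hG, Matrix.submatrix_apply, Fin.revPerm_apply, id, Matrix.of_apply, Fin.val_rev]
      rw [hb, hsmall _ _ (by omega), neg_zero]
  rw [Matrix.det_permute] at hdet
  exact isUnit_iff_ne_zero.2 (right_ne_zero_of_mul hdet)

/-- A polynomial null vector of the pencil, of degree at most `k`, with its leading
coefficient nonzero. -/
def NullVector (a b : V →ₗ[F] V →ₗ[F] F) (k : ℕ) (v : ℕ → V) : Prop :=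
  b (v 0) = 0 ∧ (∀ i < k, b (v (i + 1)) = a (v i)) ∧ a (v k) = 0 ∧ v k ≠ 0

theorem exists_nullVector [FiniteDimensional F V] {a b : V →ₗ[F] V →ₗ[F] F}
    {x : V} (hx : x ≠ 0) (hax : a x = 0)
    (h : ∀ k v, Chain a b k v → ∃ y, a y = b (v k)) : ∃ k v, NullVector a b k v := by
  classical
  let P : V → Prop := fun z => ∃ k v, Chain a b k v ∧ v k = z
  have hP : ∀ z : {z // P z}, ∃ z' : {z // P z}, a z' = b z := by
    rintro ⟨_, k, v, hv, rfl⟩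
    obtain ⟨y, hy⟩ := h k v hv
    refine ⟨⟨y, k + 1, Function.update v (k + 1) y, ⟨?_, ?_⟩, by simp⟩, hy⟩
    · rw [Function.update_of_ne (by omega)]
      exact hv.1
    · intro i hi
      rw [Function.update_of_ne (a := i) (by omega)]
      rcases Nat.lt_succ_iff_lt_or_eq.1 hi with h | rfl
      · rw [Function.update_of_ne (by omega)]
        exact hv.2 i h
      · rw [Function.update_self]
        exact hy
  choose g hg using hP
  let s : ℕ → {z // P z} := fun n => Nat.rec ⟨x, 0, fun _ => x, ⟨hax, by simp⟩, rfl⟩ (fun _ z => g z) n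
  let v : ℕ → V := fun n => (s n).1
  have hv0 : v 0 = x := rfl
  have hv : ∀ i, a (v (i + 1)) = b (v i) := fun i => hg (s i)
  have hdep : ¬ LinearIndependent F v := fun hli => by
    have := hli.finite
    exact not_finite ℕ
  rw [linearIndependent_iff] at hdep
  push Not at hdep
  obtain ⟨l, hl, hl0⟩ := hdep
  have hne : l.support.Nonempty := Finsupp.support_nonempty_iff.2 hl0
  set m := l.support.max' hne with hm
  have hlm : l m ≠ 0 := Finsupp.mem_support_iff.1 (Finset.max'_mem _ hne)
  have hsum : ∑ i ∈ Finset.range (m + 1), l i • v i = 0 := by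
    rw [← hl, Finsupp.linearCombination_apply]
    refine (Finsupp.sum_of_support_subset l ?_ (fun i c => c • v i)
      (fun i _ => zero_smul F (v i))).symm
    intro i hi
    have := Finset.le_max' _ i hi
    exact Finset.mem_range.2 (by omega)
  let u : ℕ → V := fun i => ∑ r ∈ Finset.range (i + 1), (if r ≤ m then l (m - r) else 0) • v (i - r)
  have hu0 : u 0 = l m • x := by simp [u, hv0]
  have hum : u m = 0 := by
    rw [← hsum, ← Finset.sum_range_reflect]
    refine Finset.sum_congr rfl fun r hr => ?_
    have := Finset.mem_range.1 hr
    rw [if_pos (by omega)]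
    congr 2
  have hu : ∀ i, a (u (i + 1)) = b (u i) := by
    intro i
    simp only [u, map_sum, map_smul]
    rw [Finset.sum_range_succ, Nat.sub_self, hv0, hax, smul_zero, add_zero]
    refine Finset.sum_congr rfl fun r hr => ?_
    have := Finset.mem_range.1 hr
    rw [show i + 1 - r = i - r + 1 by omega, hv]
  have hu0' : u 0 ≠ 0 := by
    rw [hu0]
    exact smul_ne_zero hlm hx
  have hm0 : m ≠ 0 := by
    intro h0
    rw [h0] at hum
    exact hu0' hum
  obtain ⟨k, hk⟩ := Nat.exists_eq_succ_of_ne_zero hm0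
  refine ⟨k, fun i => u (k - i), ?_, ?_, ?_, ?_⟩
  · simp only [Nat.sub_zero]
    rw [← hu, ← Nat.succ_eq_add_one, ← hk, hum, map_zero]
  · intro i hi
    simp only
    rw [← hu, show k - (i + 1) + 1 = k - i by omega]
  · simp only [Nat.sub_self]
    rw [hu0, map_smul, hax, smul_zero]
  · simpa using hu0'

end Chains

section Singular

variable {V : Type*} [AddCommGroup V] [Module F V]

theorem toeplitz_eq (T : ℕ → ℕ → F) (m : ℕ) (c : F)
    (hs : ∀ j i, j < m → i < m + 1 → T (j + 1) (i + 1) = T j i)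
    (hl : ∀ j < m, T (j + 1) 0 = 0) (hr : ∀ j ≤ m, T j (m + 1) = 0) (hc : T m m = c) :
    ∀ j i, j ≤ m → i ≤ m + 1 → T j i = if j = i then c else 0 := by
  have low : ∀ i j, i < j → j ≤ m → i ≤ m + 1 → T j i = 0 := by
    intro i
    induction i with
    | zero =>
      intro j hj hjm _
      obtain ⟨j, rfl⟩ := Nat.exists_eq_succ_of_ne_zero hj.ne'
      exact hl j (by omega)
    | succ i ih =>
      intro j hj hjm hi
      obtain ⟨j, rfl⟩ := Nat.exists_eq_succ_of_ne_zero (show j ≠ 0 by omega)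
      rw [Nat.succ_eq_add_one, hs j i (by omega) (by omega)]
      exact ih j (by omega) (by omega) (by omega)
  have up : ∀ s j i, i + s = m + 1 → j < i → T j i = 0 := by
    intro s
    induction s with
    | zero =>
      intro j i hi hj
      obtain rfl : i = m + 1 := by omega
      exact hr j (by omega)
    | succ s ih =>
      intro j i hi hj
      rw [← hs j i (by omega) (by omega)]
      exact ih _ _ (by omega) (by omega)
  have diag : ∀ s j, j + s = m → T j j = c := by
    intro s
    induction s with
    | zero =>
      rintro j rfl
      exact hc
    | succ s ih =>
      intro j hj
      rw [← hs j j (by omega) (by omega)]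
      exact ih _ (by omega)
  intro j i hj hi
  split_ifs with h
  · subst h
    exact diag (m - j) j (by omega)
  · rcases lt_or_gt_of_ne h with h | h
    · exact up (m + 1 - i) j i (by omega) h
    · exact low i j h hj hi

theorem NullVector.isotropic (h2 : (2 : F) ≠ 0) {a b : V →ₗ[F] V →ₗ[F] F}
    (ha : ∀ x y, a x y = -a y x) (hb : ∀ x y, b x y = -b y x) {k : ℕ} {v : ℕ → V}
    (hv : NullVector a b k v) : ∀ i j, i ≤ k → j ≤ k → a (v i) (v j) = 0 := by
  have hH := hankel_eq_zero h2 (fun i j => b (v i) (v j)) k (fun i j => hb _ _)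
    (fun i j hi hj => by
      rw [hv.2.1 i hi, hb, hv.2.1 j hj, ← ha])
  intro i j hi hj
  rcases Nat.lt_or_eq_of_le hi with h | rfl
  · rw [← hv.2.1 i h]
    exact hH _ _ (by omega) hj
  · rw [hv.2.2.1]
    simp

/-- Against a null vector of minimal degree there is a dual chain. -/
theorem NullVector.exists_dual_chain [FiniteDimensional F V] {a b : V →ₗ[F] V →ₗ[F] F}
    (ha : ∀ x y, a x y = -a y x) (hb : ∀ x y, b x y = -b y x) {m : ℕ} {v : ℕ → V}
    (hv : NullVector a b (m + 1) v) (hmin : ∀ u, ¬ NullVector a b m u) :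
    ∃ w : Fin (m + 1) → V, (∀ j : Fin m, b (w j.castSucc) = a (w j.succ)) ∧
      b (v (m + 1)) (w (Fin.last m)) ≠ 0 := by
  by_contra! hcon
  let Λ : (Fin (m + 1) → V) →ₗ[F] (Fin m → V →ₗ[F] F) :=
    LinearMap.pi fun j => b ∘ₗ LinearMap.proj j.castSucc - a ∘ₗ LinearMap.proj j.succ
  let ψ : (Fin (m + 1) → V) →ₗ[F] F := b (v (m + 1)) ∘ₗ LinearMap.proj (Fin.last m)
  obtain ⟨θ, hθ⟩ := exists_eq_of_vanishes_on_ker Λ ψ (by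
    intro w hw
    refine hcon w fun j => ?_
    have := congrFun hw j
    exact sub_eq_zero.1 this)
  have hy : ∀ j : Fin m, ∃ y : V, ∀ φ, θ (Pi.single j φ) = φ y := fun j =>
    exists_eval_eq (θ ∘ₗ LinearMap.single F (fun _ : Fin m => V →ₗ[F] F) j)
  choose y hy using hy
  let u : ℕ → V := fun i => if h : i < m then y ⟨i, h⟩ else v (m + 1)
  have hu : ∀ j : Fin m, u j = y j := fun j => by simp [u]
  have hum : u m = v (m + 1) := by simp [u]
  have key : ∀ w : Fin (m + 1) → V,
      b (u 0) (w 0) + ∑ j : Fin m, (b (u (j + 1)) - a (u j)) (w j.succ) = 0 := by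
    intro w
    have h1 : ψ w = ∑ j : Fin m, (Λ w j) (y j) := by
      rw [hθ]
      conv_lhs => rw [← Finset.univ_sum_single (Λ w), map_sum]
      exact Finset.sum_congr rfl fun j _ => hy j _
    have h2 : ∑ i : Fin (m + 1), b (u i) (w i) = ∑ j : Fin m, a (u j) (w j.succ) := by
      rw [Fin.sum_univ_castSucc]
      have h3 : b (u (Fin.last m)) (w (Fin.last m)) = ψ w := by
        simp [ψ, hum]
      rw [h3, h1, ← Finset.sum_add_distrib]
      refine Finset.sum_congr rfl fun j _ => ?_
      simp only [Λ, LinearMap.pi_apply, LinearMap.sub_apply, LinearMap.comp_apply,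
        LinearMap.proj_apply, Fin.val_castSucc, hu]
      rw [hb (w _), ha (w _)]
      ring
    rw [Fin.sum_univ_succ] at h2
    simp only [LinearMap.sub_apply, Finset.sum_sub_distrib]
    simp only [Fin.val_zero, Fin.val_succ] at h2
    rw [← h2]
    ring
  refine hmin u ⟨?_, ?_, ?_, ?_⟩
  · ext x
    have := key (Fin.cons x 0)
    simpa using this
  · intro i hi
    ext x
    have := key (Fin.cons 0 (Pi.single ⟨i, hi⟩ x))
    simp only [Fin.cons_zero, map_zero, Fin.cons_succ, zero_add] at this
    rw [Finset.sum_eq_single ⟨i, hi⟩] at this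
    · simpa [sub_eq_zero] using this
    · intro j _ hj
      rw [Pi.single_eq_of_ne hj, map_zero]
    · simp
  · rw [hum, hv.2.2.1]
  · rw [hum]
    exact hv.2.2.2

theorem sum_Fmat_mul {n : ℕ} (j : Fin (n - 1)) (g : Fin n → F) :
    ∑ i, Fmat F n j i * g i = g ⟨j, by omega⟩ := by
  rw [Finset.sum_eq_single ⟨j, by omega⟩]
  · simp [Fmat]
  · intro i _ hi
    have : (j : ℕ) ≠ i := fun h => hi (Fin.ext h.symm)
    simp [Fmat, this]
  · simp

theorem sum_Gmat_mul {n : ℕ} (j : Fin (n - 1)) (g : Fin n → F) :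
    ∑ i, Gmat F n j i * g i = g ⟨j + 1, by omega⟩ := by
  rw [Finset.sum_eq_single ⟨j + 1, by omega⟩]
  · simp [Gmat]
  · intro i _ hi
    have : (j : ℕ) + 1 ≠ i := fun h => hi (Fin.ext h.symm)
    simp [Gmat, this]
  · simp

theorem sum_Fmat_mul' {n : ℕ} (i : Fin n) (g : Fin (n - 1) → F) :
    ∑ j, Fmat F n j i * g j = if h : (i : ℕ) < n - 1 then g ⟨i, h⟩ else 0 := by
  split_ifs with h
  · rw [Finset.sum_eq_single ⟨i, h⟩]
    · simp [Fmat]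
    · intro j _ hj
      have : (j : ℕ) ≠ i := fun h => hj (Fin.ext h)
      simp [Fmat, this]
    · simp
  · refine Finset.sum_eq_zero fun j _ => ?_
    have : (j : ℕ) ≠ i := by omega
    simp [Fmat, this]

theorem sum_Gmat_mul' {n : ℕ} (i : Fin n) (g : Fin (n - 1) → F) :
    ∑ j, Gmat F n j i * g j = if h : 0 < (i : ℕ) then g ⟨i - 1, by omega⟩ else 0 := by
  split_ifs with h
  · rw [Finset.sum_eq_single ⟨i - 1, by omega⟩]
    · have : (i : ℕ) - 1 + 1 = i := by omega
      simp [Gmat, this]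
    · intro j _ hj
      have : (j : ℕ) + 1 ≠ i := fun h => hj (Fin.ext (by simp only; omega))
      simp [Gmat, this]
    · simp
  · refine Finset.sum_eq_zero fun j _ => ?_
    have : (j : ℕ) + 1 ≠ i := by omega
    simp [Gmat, this]

theorem exists_dualSystem_singular [FiniteDimensional F V] (h2 : (2 : F) ≠ 0)
    {a b : V →ₗ[F] V →ₗ[F] F} (ha : ∀ x y, a x y = -a y x) (hb : ∀ x y, b x y = -b y x)
    (h : ∃ k v, NullVector a b k v) :
    ∃ n, 0 < n ∧ DualSystem a b
      (Matrix.fromBlocks 0 (-(Fmat F n)ᵀ) (Fmat F n) 0 :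
        Matrix (Fin n ⊕ Fin (n - 1)) (Fin n ⊕ Fin (n - 1)) F)
      (Matrix.fromBlocks 0 (-(Gmat F n)ᵀ) (Gmat F n) 0) := by
  classical
  obtain ⟨k, ⟨v, hv⟩, hmin⟩ : ∃ k, (∃ v, NullVector a b k v) ∧
      ∀ j < k, ∀ u, ¬ NullVector a b j u :=
    ⟨Nat.find h, Nat.find_spec h, fun j hj u hu => Nat.find_min h hj ⟨u, hu⟩⟩
  have hvv := hv.isotropic h2 ha hb
  refine ⟨k + 1, by omega, ?_⟩
  rcases k with _ | m
  · obtain ⟨φ, hφ⟩ : ∃ φ : V →ₗ[F] F, φ (v 0) ≠ 0 := by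
      by_contra! hc
      exact hv.2.2.2 ((Module.forall_dual_apply_eq_zero_iff F _).1 hc)
    refine ⟨fun _ => v 0, fun _ => (φ (v 0))⁻¹ • φ, ?_, ?_, ?_⟩
    · rintro (k | k) (l | l)
      · simp [hφ, Fin.ext_iff]
      · exact l.elim0
      · exact k.elim0
      · exact k.elim0
    · rintro (k | k) u
      · rw [hv.2.2.1]
        simp
      · exact k.elim0
    · rintro (k | k) u
      · rw [hv.1]
        simp
      · exact k.elim0
  · obtain ⟨w₀, hw₀, hne⟩ := hv.exists_dual_chain ha hb (hmin m (by omega))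
    set c := b (v (m + 1)) (w₀ (Fin.last m)) with hc
    obtain ⟨w, hw_def⟩ : ∃ w : ℕ → V, ∀ j (h : j < m + 1), w j = -(c⁻¹ • w₀ ⟨j, h⟩) :=
      ⟨fun j => if h : j < m + 1 then -(c⁻¹ • w₀ ⟨j, h⟩) else 0, fun j h => dif_pos h⟩
    have hw : ∀ j < m, b (w j) = a (w (j + 1)) := by
      intro j hj
      have := hw₀ ⟨j, hj⟩
      simp only [Fin.castSucc_mk, Fin.succ_mk] at this
      rw [hw_def j (by omega), hw_def (j + 1) (by omega)]
      simp [this]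
    have hlast : b (w m) (v (m + 1)) = 1 := by
      have : w₀ ⟨m, by omega⟩ = w₀ (Fin.last m) := rfl
      rw [hb, hw_def m (by omega), this]
      simp [← hc, hne]
    have hbw : ∀ j i, i ≤ m → b (w j) (v (i + 1)) = a (w j) (v i) := by
      intro j i hi
      rw [hb, hv.2.1 i (by omega), ← ha]
    have hbw0 : ∀ j, b (w j) (v 0) = 0 := by
      intro j
      rw [hb, hv.1]
      simp
    have hT : ∀ j i, j ≤ m → i ≤ m + 1 → a (w j) (v i) = if j = i then 1 else 0 := by
      refine toeplitz_eq (fun j i => a (w j) (v i)) m 1 ?_ ?_ ?_ ?_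
      · intro j i hj hi
        rw [← hw j hj, hbw j i (by omega)]
      · intro j hj
        rw [← hw j hj, hbw0]
      · intro j hj
        rw [ha, hv.2.2.1]
        simp
      · rw [← hbw m m le_rfl, hlast]
    have hww : ∀ i j, i ≤ m → j ≤ m → b (w i) (w j) = 0 :=
      hankel_eq_zero h2 (fun i j => b (w i) (w j)) m (fun i j => hb _ _) (by
        intro i j hi hj
        rw [hw i hi, hb, hw j hj, ← ha])
    have haww : ∀ i j, i ≤ m → j ≤ m → a (w i) (w j) = 0 :=
      hankel_eq_zero h2 (fun i j => a (w i) (w j)) m (fun i j => ha _ _) (by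
        intro i j hi hj
        rw [← hw i hi, ha (w i), ← hw j hj, ← hb])
    let f : Fin (m + 1 + 1) → V →ₗ[F] F :=
      fun i => if (i : ℕ) < m + 1 then a (w i) else b (w m)
    refine ⟨Sum.elim (fun i : Fin (m + 1 + 1) => v i) (fun j : Fin (m + 1) => w j),
      Sum.elim f (fun j : Fin (m + 1) => -a (v j)), ?_, ?_, ?_⟩
    · rintro (k | k) (l | l)
      · simp only [Sum.elim_inl, f, Sum.inl.injEq]
        split_ifs with h1 h3 h3
        · rw [hT _ _ (by omega) (by omega), if_pos (by rw [h3])]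
        · rw [hT _ _ (by omega) (by omega), if_neg (fun h => h3 (Fin.ext h))]
        · rw [← h3, show (k : ℕ) = m + 1 by omega, hlast]
        · have : (k : ℕ) ≠ l := fun h => h3 (Fin.ext h)
          rcases Nat.eq_zero_or_pos (l : ℕ) with h0 | h0
          · rw [h0, hbw0]
          · rw [show (l : ℕ) = l - 1 + 1 by omega, hbw _ _ (by omega), hT _ _ le_rfl (by omega),
              if_neg (by omega)]
      · simp only [Sum.elim_inl, Sum.elim_inr, f, reduceCtorEq, if_false]
        split_ifs with h1
        · exact haww _ _ (by omega) (by omega)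
        · exact hww _ _ (by omega) (by omega)
      · simp [hvv k l (by omega) (by omega)]
      · simp only [Sum.elim_inr, LinearMap.neg_apply, Sum.inr.injEq]
        rw [← ha, hT _ _ (by omega) (by omega)]
        simp [Fin.ext_iff, eq_comm]
    · rintro (k | k) u
      · simp only [Sum.elim_inl, Fintype.sum_sum_type, Matrix.fromBlocks_apply₁₁,
          Matrix.fromBlocks_apply₁₂, Sum.elim_inr, Matrix.zero_apply, zero_mul,
          Finset.sum_const_zero, zero_add, Matrix.neg_apply, Matrix.transpose_apply,
          LinearMap.neg_apply, neg_mul_neg]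
        rw [sum_Fmat_mul' k (fun j => a (v j) u)]
        split_ifs with h
        · rfl
        · rw [show (k : ℕ) = m + 1 by omega, hv.2.2.1]
          simp
      · simp only [Sum.elim_inl, Fintype.sum_sum_type, Matrix.fromBlocks_apply₂₁,
          Matrix.fromBlocks_apply₂₂, Sum.elim_inr, Matrix.zero_apply, zero_mul,
          Finset.sum_const_zero, add_zero]
        rw [sum_Fmat_mul k (fun i => f i u)]
        simp only [f]
        rw [if_pos (show (k : ℕ) < m + 1 from k.2)]
    · rintro (k | k) u
      · simp only [Sum.elim_inl, Fintype.sum_sum_type, Matrix.fromBlocks_apply₁₁,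
          Matrix.fromBlocks_apply₁₂, Sum.elim_inr, Matrix.zero_apply, zero_mul,
          Finset.sum_const_zero, zero_add, Matrix.neg_apply, Matrix.transpose_apply,
          LinearMap.neg_apply, neg_mul_neg]
        rw [sum_Gmat_mul' k (fun j => a (v j) u)]
        split_ifs with h
        · simp only
          rw [← hv.2.1 _ (by omega), show (k : ℕ) - 1 + 1 = k by omega]
        · rw [show (k : ℕ) = 0 by omega, hv.1]
          simp
      · simp only [Sum.elim_inl, Fintype.sum_sum_type, Matrix.fromBlocks_apply₂₁,
          Matrix.fromBlocks_apply₂₂, Sum.elim_inr, Matrix.zero_apply, zero_mul,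
          Finset.sum_const_zero, add_zero]
        rw [sum_Gmat_mul k (fun i => f i u)]
        simp only [f]
        split_ifs with h
        · rw [hw _ (by omega)]
        · rw [show (k : ℕ) = m by omega]

end Singular

section Regular

variable {V : Type*} [AddCommGroup V] [Module F V]

theorem aeval_selfAdjoint {a : V →ₗ[F] V →ₗ[F] F} {C : Module.End F V}
    (hC : ∀ x y, a (C x) y = a x (C y)) (g : F[X]) :
    ∀ x y, a (aeval C g x) y = a x (aeval C g y) := by
  induction g using Polynomial.induction_on' with
  | add p q hp hq =>
    intro x y
    simp [hp, hq]
  | monomial n c =>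
    have hpow : ∀ x y, a ((C ^ n) x) y = a x ((C ^ n) y) := by
      induction n with
      | zero => simp
      | succ n ih =>
        intro x y
        rw [pow_succ, Module.End.mul_apply, ih, hC, ← Module.End.mul_apply, ← pow_succ', pow_succ]
    intro x y
    simp [aeval_monomial, hpow]

/-- `N` is the Frobenius matrix of the monic polynomial `f`. -/
structure IsCompanion {d : ℕ} (N : Mat F d) (f : F[X]) : Prop where
  monic : f.Monic
  natDegree_eq : f.natDegree = d
  apply_eq : ∀ i j, N i j = if (i : ℕ) = (j : ℕ) + 1 then 1
    else if (j : ℕ) + 1 = d then -f.coeff i else 0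

theorem isCompanion_companion {f : F[X]} (hf : f.Monic) : IsCompanion (companion F f) f :=
  ⟨hf, rfl, fun _ _ => rfl⟩

theorem isCompanion_J (n : ℕ) : IsCompanion (J F n 0) (X ^ n) := by
  refine ⟨monic_X_pow n, natDegree_X_pow n, fun i j => ?_⟩
  have hi : (i : ℕ) ≠ n := i.2.ne
  by_cases h : i = j
  · subst h
    simp [J, coeff_X_pow, hi]
  · simp [J, h, coeff_X_pow, hi]

theorem IsCompanion.sum_smul_of_lt {d : ℕ} {N : Mat F d} {f : F[X]} (hN : IsCompanion N f)
    (v : Fin d → V) {j : Fin d} (h : (j : ℕ) + 1 < d) :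
    ∑ k, N k j • v k = v ⟨j + 1, h⟩ := by
  rw [Finset.sum_eq_single ⟨j + 1, h⟩]
  · simp [hN.apply_eq]
  · intro k _ hk
    have : (k : ℕ) ≠ j + 1 := fun h => hk (Fin.ext h)
    simp [hN.apply_eq, this, h.ne]
  · simp

theorem IsCompanion.sum_smul_of_eq {d : ℕ} {N : Mat F d} {f : F[X]} (hN : IsCompanion N f)
    (v : Fin d → V) {j : Fin d} (h : (j : ℕ) + 1 = d) :
    ∑ k, N k j • v k = -∑ k : Fin d, f.coeff k • v k := by
  rw [← Finset.sum_neg_distrib]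
  refine Finset.sum_congr rfl fun k _ => ?_
  have : (k : ℕ) ≠ j + 1 := by omega
  rw [hN.apply_eq, if_neg this, if_pos h, neg_smul]

theorem IsCompanion.aeval_apply {d : ℕ} {N : Mat F d} {f : F[X]} (hN : IsCompanion N f)
    (C : Module.End F V) (x : V) :
    aeval C f x = (∑ k : Fin d, f.coeff k • (C ^ (k : ℕ)) x) + (C ^ d) x := by
  have h := hN.monic.coeff_natDegree
  rw [aeval_eq_sum_range, Finset.sum_range_succ, h, hN.natDegree_eq, one_smul,
    LinearMap.add_apply, LinearMap.sum_apply, Finset.sum_range]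
  rfl

theorem IsCompanion.pow_succ_apply {d : ℕ} {N : Mat F d} {f : F[X]} (hN : IsCompanion N f)
    {C : Module.End F V} {x : V} (hx : aeval C f x = 0) (i : Fin d) :
    (C ^ ((i : ℕ) + 1)) x = ∑ k, N k i • (C ^ (k : ℕ)) x := by
  rcases lt_or_eq_of_le (show (i : ℕ) + 1 ≤ d from i.2) with h | h
  · rw [hN.sum_smul_of_lt _ h]
  · rw [hN.sum_smul_of_eq _ h, h]
    rw [hN.aeval_apply] at hx
    exact (neg_eq_of_add_eq_zero_right hx).symm

theorem exists_dualSystem_regular [FiniteDimensional F V] [Nontrivial V] (h2 : (2 : F) ≠ 0)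
    {a b : V →ₗ[F] V →ₗ[F] F} (ha : ∀ x y, a x y = -a y x) (hb : ∀ x y, b x y = -b y x)
    (hker : ∀ x, a x = 0 → x = 0) :
    ∃ (p : F[X]) (l : ℕ), p.Monic ∧ Irreducible p ∧ 0 < l ∧ DualSystem a b
      (Matrix.fromBlocks 0 (-1) 1 0 :
        Matrix (Fin (p ^ l).natDegree ⊕ Fin (p ^ l).natDegree)
          (Fin (p ^ l).natDegree ⊕ Fin (p ^ l).natDegree) F)
      (Matrix.fromBlocks 0 (-(companion F (p ^ l))ᵀ) (companion F (p ^ l)) 0) := by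
  classical
  have hinj : Function.Injective a := (injective_iff_map_eq_zero a).2 hker
  let E : V ≃ₗ[F] (V →ₗ[F] F) :=
    a.linearEquivOfInjective hinj (Subspace.dual_finrank_eq (K := F) (V := V)).symm
  let C : Module.End F V := E.symm.toLinearMap ∘ₗ b
  have hCb : ∀ x, a (C x) = b x := fun x => E.apply_symm_apply (b x)
  have hC : ∀ x y, a (C x) y = a x (C y) := by
    intro x y
    rw [hCb, hb, ← hCb, ← ha]
  have hadj := fun g => aeval_selfAdjoint hC g
  have hint : IsIntegral F C := Algebra.IsIntegral.isIntegral C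
  have hμ0 : minpoly F C ≠ 0 := minpoly.ne_zero hint
  obtain ⟨p, hpm, hp, hpμ⟩ := exists_monic_irreducible_factor _ (minpoly.not_isUnit F C)
  have hfin : FiniteMultiplicity p (minpoly F C) :=
    FiniteMultiplicity.of_not_isUnit hp.not_isUnit hμ0
  obtain ⟨q, hq, hpq⟩ := hfin.exists_eq_pow_mul_and_not_dvd
  set l := multiplicity p (minpoly F C) with hl
  have hl0 : 0 < l := by
    rcases Nat.eq_zero_or_pos l with h | h
    · rw [h, pow_zero, one_mul] at hq
      exact absurd (hq ▸ hpμ) hpq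
    · exact h
  obtain ⟨u, r, hur⟩ : IsCoprime q p := (hp.coprime_iff_not_dvd.2 hpq).symm
  have hμ : ∀ z, aeval C (p ^ l) (aeval C q z) = 0 := by
    intro z
    rw [← Module.End.mul_apply, ← map_mul, ← hq, minpoly.aeval, LinearMap.zero_apply]
  obtain ⟨x', hx'⟩ : ∃ x', aeval C (p ^ (l - 1)) (aeval C q x') ≠ 0 := by
    by_contra! hc
    have h0 : aeval C (p ^ (l - 1) * q) = 0 := by
      ext z
      rw [map_mul, Module.End.mul_apply, hc, LinearMap.zero_apply]
    have hdvd := minpoly.dvd F C h0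
    rw [hq, mul_dvd_mul_iff_right (fun h => hpq (by rw [h]; exact dvd_zero p)),
      pow_dvd_pow_iff hp.ne_zero hp.not_isUnit] at hdvd
    omega
  set x := aeval C q x' with hx
  have hxl : aeval C (p ^ l) x = 0 := hμ x'
  set z := aeval C (p ^ (l - 1)) x with hz
  have hpz : aeval C p z = 0 := by
    rw [hz, ← Module.End.mul_apply, ← map_mul, ← pow_succ', Nat.sub_add_cancel hl0, hxl]
  obtain ⟨y', hy'⟩ : ∃ y', a y' z ≠ 0 := by
    by_contra! hc
    refine hx' (hker _ (LinearMap.ext fun y => ?_))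
    rw [ha, hc]
    simp
  set y := aeval C q (aeval C u y') with hy
  have hyl : aeval C (p ^ l) y = 0 := hμ _
  have hyz : a y z ≠ 0 := by
    have h1 : z = aeval C u (aeval C q z) := by
      have h2 : aeval C (u * q + r * p) z = z := by
        rw [hur]
        simp
      rw [map_add, map_mul, map_mul, LinearMap.add_apply, Module.End.mul_apply,
        Module.End.mul_apply, hpz, map_zero, add_zero] at h2
      exact h2.symm
    rw [hy, hadj, hadj, ← h1]
    exact hy'
  have hfm : (p ^ l).Monic := hpm.pow l
  have hpow : ∀ w : V, ∀ i j, a ((C ^ i) w) ((C ^ j) w) = 0 := by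
    intro w i j
    refine hankel_eq_zero h2 (fun i j => a ((C ^ i) w) ((C ^ j) w)) (i + j)
      (fun i j => ha _ _) (fun i j _ _ => ?_) i j (by omega) (by omega)
    rw [pow_succ', Module.End.mul_apply, hC, ← Module.End.mul_apply, ← pow_succ']
  have hact : ∀ w : V, aeval C (p ^ l) w = 0 → ∀ (i : Fin (p ^ l).natDegree) (v : V),
      b ((C ^ (i : ℕ)) w) v
        = ∑ k, companion F (p ^ l) k i * a ((C ^ (k : ℕ)) w) v := by
    intro w hw i v
    rw [← hCb, ← Module.End.mul_apply, ← pow_succ', (isCompanion_companion hfm).pow_succ_apply hw i]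
    simp
  refine ⟨p, l, hpm, hp, hl0, dualSystem_of_pairing ha hb _ (fun i => (C ^ (i : ℕ)) x)
    (fun i => (C ^ (i : ℕ)) y) (fun i j => hpow x i j) (fun i j => hpow y i j) ?_
    (hact x hxl) (hact y hyl)⟩
  rw [isUnit_iff_ne_zero]
  intro hdet
  obtain ⟨c, hc0, hc⟩ := Matrix.exists_mulVec_eq_zero_iff.2 hdet
  let h : F[X] := ∑ i : Fin (p ^ l).natDegree, monomial (i : ℕ) (c i)
  have hhx : aeval C h x = ∑ i : Fin (p ^ l).natDegree, c i • (C ^ (i : ℕ)) x := by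
    simp [h, aeval_monomial]
  have hhdeg : h.degree < (p ^ l).degree := by
    rw [degree_eq_natDegree hfm.ne_zero]
    refine (degree_sum_le _ _).trans_lt ((Finset.sup_lt_iff (WithBot.bot_lt_coe _)).2 ?_)
    intro i _
    exact (degree_monomial_le _ _).trans_lt (by exact_mod_cast i.2)
  have hh0 : h ≠ 0 := by
    intro h0
    apply hc0
    ext i
    have : h.coeff i = 0 := by rw [h0, coeff_zero]
    simpa [h, finsetSum_coeff, coeff_monomial, ← Fin.ext_iff] using this
  have hlow : ∀ j < (p ^ l).natDegree, a ((C ^ j) y) (aeval C h x) = 0 := by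
    intro j hj
    have := congrFun hc ⟨j, hj⟩
    simp only [Matrix.mulVec, dotProduct, Matrix.of_apply, Pi.zero_apply] at this
    rw [hhx, map_sum, ← this]
    refine Finset.sum_congr rfl fun i _ => ?_
    rw [map_smul, smul_eq_mul, mul_comm]
  have hall : ∀ g : F[X], a (aeval C g y) (aeval C h x) = 0 := by
    intro g
    have hmod : aeval C g y = aeval C (g %ₘ (p ^ l)) y := by
      conv_lhs => rw [← modByMonic_add_div g (p ^ l), mul_comm]
      rw [map_add, LinearMap.add_apply, map_mul, Module.End.mul_apply, hyl, map_zero, add_zero]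
    rw [hmod, aeval_eq_sum_range]
    simp only [LinearMap.sum_apply, LinearMap.smul_apply, map_sum, map_smul]
    refine Finset.sum_eq_zero fun j hj => ?_
    rw [hlow, smul_zero]
    have h1 := Finset.mem_range.1 hj
    have h2 := natDegree_modByMonic_lt g hfm (by
      intro h1
      rw [h1, degree_one] at hhdeg
      have := Nat.WithBot.lt_zero_iff.1 hhdeg
      exact hh0 (degree_eq_bot.1 this))
    omega
  have hgcd : EuclideanDomain.gcd h (p ^ l) ∣ p ^ (l - 1) := by
    obtain ⟨i, hi, hassoc⟩ := (dvd_prime_pow hp.prime l).1 (EuclideanDomain.gcd_dvd_right h (p ^ l))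
    refine hassoc.dvd.trans (pow_dvd_pow p ?_)
    by_contra hcon
    obtain rfl : i = l := by omega
    have := hassoc.symm.dvd.trans (EuclideanDomain.gcd_dvd_left h _)
    exact hh0 (eq_zero_of_dvd_of_degree_lt this hhdeg)
  obtain ⟨k, hk⟩ := hgcd
  rw [EuclideanDomain.gcd_eq_gcd_ab] at hk
  set α := EuclideanDomain.gcdA h (p ^ l)
  set β := EuclideanDomain.gcdB h (p ^ l)
  apply hyz
  have hk' : p ^ (l - 1) = (α * k) * h + (β * k) * p ^ l := by
    rw [hk]
    ring
  rw [hz, hk', map_add, LinearMap.add_apply, map_mul, map_mul (aeval C) (β * k),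
    Module.End.mul_apply, Module.End.mul_apply, hxl, map_zero, add_zero, ← hadj]
  exact hall _

end Regular

section Existence

theorem exists_realizes_psum (h2 : (2 : F) ≠ 0) (m : ℕ) :
    ∀ {V : Type*} [AddCommGroup V] [Module F V] [FiniteDimensional F V]
      {a b : V →ₗ[F] V →ₗ[F] F}, (∀ x y, a x y = -a y x) → (∀ x y, b x y = -b y x) →
      Module.finrank F V = m →
      ∃ L : List (PBlock F), (∀ X ∈ L, T12i X ∨ T12ii X ∨ T12iii X) ∧
        Realizes a b (psum L) := by
  induction m using Nat.strong_induction_on with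
  | _ m ih =>
  intro V _ _ _ a b ha hb hm
  have step : ∀ {κ : Type} [Fintype κ] [DecidableEq κ] {M N : Matrix κ κ F} {d : ℕ}
      (σ : κ ≃ Fin d) (X : PBlock F), DualSystem a b M N → 0 < d →
      X = ⟨d, (Matrix.reindex σ σ M, Matrix.reindex σ σ N)⟩ → (T12i X ∨ T12ii X ∨ T12iii X) →
      ∃ L : List (PBlock F), (∀ X ∈ L, T12i X ∨ T12ii X ∨ T12iii X) ∧
        Realizes a b (psum L) := by
    intro κ _ _ M N d σ X hD hd hX hT
    obtain ⟨U, hUd, hU⟩ := hD.exists_complement ha hb σ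
    obtain ⟨L, hL, hR⟩ := ih (Module.finrank F U) (by omega)
      (a := a.domRestrict₁₂ U U) (b := b.domRestrict₁₂ U U)
      (fun x y => ha x y) (fun x y => hb x y) rfl
    refine ⟨X :: L, ?_, hX ▸ hU L hR⟩
    simpa only [List.forall_mem_cons] using ⟨hT, hL⟩
  rcases Nat.eq_zero_or_pos m with rfl | hm0
  · have : Subsingleton V := Module.finrank_zero_iff.1 hm
    have : IsEmpty (Fin (psum ([] : List (PBlock F))).1) := Fin.isEmpty
    exact ⟨[], by simp, Module.Basis.empty V, fun i => isEmptyElim i, fun i => isEmptyElim i⟩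
  · have : Nontrivial V := Module.nontrivial_of_finrank_pos (R := F) (hm ▸ hm0)
    by_cases hker : ∀ x, a x = 0 → x = 0
    · obtain ⟨p, l, hpm, hp, hl, hD⟩ := exists_dualSystem_regular h2 ha hb hker
      have hdeg : 0 < (p ^ l).natDegree := by
        rw [natDegree_pow]
        exact Nat.mul_pos hl hp.natDegree_pos
      exact step finSumFinEquiv _ hD (by omega) rfl (Or.inr (Or.inl ⟨p, l, hpm, hp, hl, rfl⟩))
    · push Not at hker
      obtain ⟨x, hax, hx⟩ := hker
      by_cases hch : ∃ k v, Chain a b k v ∧ ∀ y, a y ≠ b (v k)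
      · obtain ⟨d, hd, hD⟩ := exists_dualSystem_nilpotent h2 ha hb hch
        exact step finSumFinEquiv _ hD (by omega) rfl (Or.inr (Or.inr ⟨d, hd, rfl⟩))
      · push Not at hch
        obtain ⟨d, hd, hD⟩ := exists_dualSystem_singular h2 ha hb (exists_nullVector hx hax hch)
        exact step finSumFinEquiv _ hD (by omega) rfl (Or.inl ⟨d, hd, rfl⟩)

theorem Realizes.pCong {n : ℕ} {A B : Mat F n} {Y : PBlock F}
    (h : Realizes (Matrix.toLinearMap₂' F A) (Matrix.toLinearMap₂' F B) Y) :
    PCong ⟨n, (A, B)⟩ Y := by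
  obtain ⟨e, hA, hB⟩ := h
  obtain ⟨m, A', B'⟩ := Y
  have hnm : n = m := by
    have := Module.finrank_eq_card_basis e
    simpa using this
  subst hnm
  refine ⟨rfl, (Pi.basisFun F (Fin n)).toMatrix e, ?_, ?_, ?_⟩
  · have := (Pi.basisFun F (Fin n)).invertibleToMatrix e
    exact Matrix.isUnit_det_of_invertible _
  · ext i j
    rw [← hA i j, Matrix.toLinearMap₂'_apply']
    rw [Matrix.mul_assoc]
    simp [castMat, Matrix.mul_apply, dotProduct, Matrix.mulVec, Module.Basis.toMatrix_apply]
  · ext i j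
    rw [← hB i j, Matrix.toLinearMap₂'_apply']
    rw [Matrix.mul_assoc]
    simp [castMat, Matrix.mul_apply, dotProduct, Matrix.mulVec, Module.Basis.toMatrix_apply]

theorem toLinearMap₂'_skew {n : ℕ} {A : Mat F n} (hA : Aᵀ = -A) (x y : Fin n → F) :
    Matrix.toLinearMap₂' F A x y = -Matrix.toLinearMap₂' F A y x := by
  rw [Matrix.toLinearMap₂'_apply', Matrix.toLinearMap₂'_apply', ← dotProduct_neg,
    ← Matrix.neg_mulVec, ← hA, Matrix.mulVec_transpose, Matrix.dotProduct_mulVec, dotProduct_comm]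

end Existence

section Intertwiners

variable {m n m' n' d e : Type*} [Fintype n] [Fintype n'] [Fintype d]

/-- The matrices `Z` with `A Z P = B Z Q`. -/
def intertwiners (A B : Matrix m n F) (P Q : Matrix d e F) : Submodule F (Matrix n d F) where
  carrier := {Z | A * Z * P = B * Z * Q}
  add_mem' := by
    intro Y Z hY hZ
    simp only [Set.mem_ofPred_eq, Matrix.mul_add, Matrix.add_mul] at *
    rw [hY, hZ]
  zero_mem' := by simp
  smul_mem' := by
    intro c Z hZ
    simp only [Set.mem_ofPred_eq, Matrix.mul_smul, Matrix.smul_mul] at *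
    rw [hZ]

/-- The dimension of the space of intertwiners. -/
def intertwinerDim (A B : Matrix m n F) (P Q : Matrix d e F) : ℕ :=
  Module.finrank F (intertwiners A B P Q)

theorem mem_intertwiners {A B : Matrix m n F} {P Q : Matrix d e F} {Z : Matrix n d F} :
    Z ∈ intertwiners A B P Q ↔ A * Z * P = B * Z * Q := Iff.rfl

theorem finrank_eq_of_mem_iff {V W : Type*} [AddCommGroup V] [Module F V] [AddCommGroup W]
    [Module F W] (E : V ≃ₗ[F] W) {p : Submodule F V} {q : Submodule F W}
    (h : ∀ x, E x ∈ q ↔ x ∈ p) : Module.finrank F p = Module.finrank F q := by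
  refine (E.ofSubmodules p q (Submodule.ext fun y => ?_)).finrank_eq
  rw [Submodule.mem_map]
  constructor
  · rintro ⟨x, hx, rfl⟩
    exact (h x).2 hx
  · intro hy
    exact ⟨E.symm y, (h _).1 (by simpa using hy), by simp⟩

theorem intertwinerDim_neg (A B : Matrix m n F) (P Q : Matrix d e F) :
    intertwinerDim (-A) (-B) P Q = intertwinerDim A B P Q :=
  finrank_eq_of_mem_iff (LinearEquiv.refl F _) fun Z => by
    simp [mem_intertwiners]

theorem intertwinerDim_congr [DecidableEq n] {S : Matrix n n F} (hS : IsUnit S.det)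
    (A B : Matrix n n F) (P Q : Matrix d e F) :
    intertwinerDim (Sᵀ * A * S) (Sᵀ * B * S) P Q = intertwinerDim A B P Q := by
  have h1 : S * S⁻¹ = 1 := Matrix.mul_nonsing_inv S hS
  have h2 : S⁻¹ * S = 1 := Matrix.nonsing_inv_mul S hS
  have hT : IsUnit Sᵀ.det := by rwa [Matrix.det_transpose]
  let E : Matrix n d F ≃ₗ[F] Matrix n d F :=
    { toFun := fun Z => S * Z
      map_add' := fun _ _ => Matrix.mul_add _ _ _
      map_smul' := fun _ _ => Matrix.mul_smul _ _ _
      invFun := fun Z => S⁻¹ * Z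
      left_inv := fun Z => (Matrix.mul_assoc _ _ _).symm.trans (by rw [h2, Matrix.one_mul])
      right_inv := fun Z => (Matrix.mul_assoc _ _ _).symm.trans (by rw [h1, Matrix.one_mul]) }
  refine finrank_eq_of_mem_iff E fun Z => ?_
  simp only [mem_intertwiners, E, LinearEquiv.coe_mk, LinearMap.coe_mk, AddHom.coe_mk,
    Matrix.mul_assoc]
  constructor
  · intro h
    rw [h]
  · intro h
    have := congrArg (fun Y => (Sᵀ)⁻¹ * Y) h
    simpa only [Matrix.nonsing_inv_mul_cancel_left _ _ hT] using this

theorem intertwinerDim_reindex (σ : m ≃ m') (τ : n ≃ n') (A B : Matrix m n F) (P Q : Matrix d e F) :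
    intertwinerDim (Matrix.reindex σ τ A) (Matrix.reindex σ τ B) P Q = intertwinerDim A B P Q := by
  refine (finrank_eq_of_mem_iff (Matrix.reindexLinearEquiv F F τ (Equiv.refl d)) fun Z => ?_).symm
  have key : ∀ (A : Matrix m n F) (P : Matrix d e F), Matrix.reindex σ τ A *
      Matrix.reindexLinearEquiv F F τ (Equiv.refl d) Z * P
      = Matrix.reindex σ (Equiv.refl e) (A * Z * P) := by
    intro A P
    ext i j
    simp [Matrix.mul_apply]
  rw [mem_intertwiners, mem_intertwiners, key, key]
  exact (Matrix.reindex σ (Equiv.refl e)).injective.eq_iff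

/-- Splitting the rows of a matrix. -/
def rowsEquiv : Matrix (n ⊕ n') d F ≃ₗ[F] Matrix n d F × Matrix n' d F where
  toFun Z := (Z.toRows₁, Z.toRows₂)
  map_add' _ _ := rfl
  map_smul' _ _ := rfl
  invFun Z := Matrix.fromRows Z.1 Z.2
  left_inv Z := Matrix.fromRows_toRows Z
  right_inv _ := rfl

theorem rowsEquiv_symm_apply {n n' d : Type*} (Z : Matrix n d F × Matrix n' d F) :
    (rowsEquiv (F := F)).symm Z = Matrix.fromRows Z.1 Z.2 := rfl

theorem finrank_prod_submodule {V W : Type*} [AddCommGroup V] [Module F V] [AddCommGroup W]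
    [Module F W] [FiniteDimensional F V] [FiniteDimensional F W]
    (p : Submodule F V) (q : Submodule F W) :
    Module.finrank F (p.prod q) = Module.finrank F p + Module.finrank F q := by
  rw [← Module.finrank_prod]
  exact LinearEquiv.finrank_eq
    { toFun := fun x => (⟨x.1.1, x.2.1⟩, ⟨x.1.2, x.2.2⟩)
      map_add' := fun _ _ => rfl
      map_smul' := fun _ _ => rfl
      invFun := fun x => ⟨(x.1.1, x.2.1), x.1.2, x.2.2⟩
      left_inv := fun _ => rfl
      right_inv := fun _ => rfl }

theorem intertwinerDim_fromBlocks_diag (A B : Matrix m n F) (A' B' : Matrix m' n' F)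
    (P Q : Matrix d e F) :
    intertwinerDim (Matrix.fromBlocks A 0 0 A') (Matrix.fromBlocks B 0 0 B') P Q
      = intertwinerDim A B P Q + intertwinerDim A' B' P Q := by
  unfold intertwinerDim
  rw [← finrank_prod_submodule]
  refine finrank_eq_of_mem_iff rowsEquiv fun Z => ?_
  rw [Submodule.mem_prod]
  obtain ⟨⟨Y, Y'⟩, rfl⟩ := (rowsEquiv (F := F)).symm.surjective Z
  rw [LinearEquiv.apply_symm_apply, rowsEquiv_symm_apply]
  simp [mem_intertwiners, Matrix.fromBlocks_mul_fromRows, Matrix.fromRows_mul,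
    Matrix.fromRows_inj.eq_iff]

theorem intertwinerDim_fromBlocks_skew (A B : Matrix m n F) (A' B' : Matrix m' n' F)
    (P Q : Matrix d e F) :
    intertwinerDim (Matrix.fromBlocks 0 A' A 0) (Matrix.fromBlocks 0 B' B 0) P Q
      = intertwinerDim A B P Q + intertwinerDim A' B' P Q := by
  unfold intertwinerDim
  rw [← finrank_prod_submodule]
  refine finrank_eq_of_mem_iff rowsEquiv fun Z => ?_
  rw [Submodule.mem_prod]
  obtain ⟨⟨Y, Y'⟩, rfl⟩ := (rowsEquiv (F := F)).symm.surjective Z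
  rw [LinearEquiv.apply_symm_apply, rowsEquiv_symm_apply]
  simp [mem_intertwiners, Matrix.fromBlocks_mul_fromRows, Matrix.fromRows_mul,
    Matrix.fromRows_inj.eq_iff, and_comm]

end Intertwiners

/-- The dimension of the space of intertwiners from the pencil `(P, Q)` to a pair of square
matrices. -/
def testDim {d e : ℕ} (P Q : Matrix (Fin d) (Fin e) F) (X : PBlock F) : ℕ :=
  intertwinerDim X.2.1 X.2.2 P Q

theorem testDim_eq_of_pCong {d e : ℕ} (P Q : Matrix (Fin d) (Fin e) F) {X Y : PBlock F}
    (h : PCong X Y) : testDim P Q X = testDim P Q Y := by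
  obtain ⟨m, A, B⟩ := X
  obtain ⟨n, A', B'⟩ := Y
  obtain ⟨h, S, hS, h1, h2⟩ := h
  obtain rfl : m = n := h
  have hc : ∀ A : Mat F m, castMat rfl A = A := fun A => rfl
  simp only [hc] at h1 h2
  rw [testDim, testDim, ← h1, ← h2, intertwinerDim_congr hS]

theorem testDim_psum {d e : ℕ} (P Q : Matrix (Fin d) (Fin e) F) (L : List (PBlock F)) :
    testDim P Q (psum L) = (L.map (testDim P Q)).sum := by
  induction L with
  | nil =>
    have : Subsingleton (Matrix (Fin (psum ([] : List (PBlock F))).1) (Fin d) F) :=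
      inferInstanceAs (Subsingleton (Matrix (Fin 0) (Fin d) F))
    exact Module.finrank_zero_of_subsingleton
  | cons X L ih =>
    rw [List.map_cons, List.sum_cons, ← ih]
    exact (intertwinerDim_reindex _ _ _ _ P Q).trans (intertwinerDim_fromBlocks_diag _ _ _ _ P Q)

theorem testDim_skewSum {d e k l : ℕ} (P Q : Matrix (Fin d) (Fin e) F)
    (A B : Matrix (Fin k) (Fin l) F) (A' B' : Matrix (Fin l) (Fin k) F) :
    testDim P Q ⟨l + k, (skewSum A (-A'), skewSum B (-B'))⟩
      = intertwinerDim A B P Q + intertwinerDim A' B' P Q := by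
  rw [← intertwinerDim_neg A' B']
  exact (intertwinerDim_reindex _ _ _ _ P Q).trans (intertwinerDim_fromBlocks_skew _ _ _ _ P Q)

section Frobenius

variable {n : Type*} [Fintype n] [DecidableEq n]

theorem IsCompanion.mulVec_col {d : ℕ} {N : Mat F d} {f : F[X]} (hN : IsCompanion N f)
    {M : Matrix n n F} {Z : Matrix n (Fin d) F} (hZ : M * Z = Z * N) (hd : 0 < d) :
    (∀ j : Fin d, Z.col j = (Matrix.toLin' M ^ (j : ℕ)) (Z.col ⟨0, hd⟩)) ∧
      aeval (Matrix.toLin' M) f (Z.col ⟨0, hd⟩) = 0 := by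
  have hcol : ∀ j, Matrix.toLin' M (Z.col j) = ∑ k, N k j • Z.col k := by
    intro j
    ext i
    have := congrFun (congrFun hZ i) j
    simpa [Matrix.mul_apply, Matrix.mulVec, dotProduct, mul_comm] using this
  have hpow : ∀ (j : ℕ) (hj : j < d),
      Z.col ⟨j, hj⟩ = (Matrix.toLin' M ^ j) (Z.col ⟨0, hd⟩) := by
    intro j
    induction j with
    | zero => simp
    | succ j ih =>
      intro hj
      rw [pow_succ', Module.End.mul_apply, ← ih (by omega), hcol,
        hN.sum_smul_of_lt _ (j := ⟨j, by omega⟩) hj]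
  refine ⟨fun j => hpow j j.2, ?_⟩
  have hlast : d - 1 + 1 = d := by omega
  have := hcol ⟨d - 1, by omega⟩
  rw [hN.sum_smul_of_eq _ (by exact hlast), hpow, ← Module.End.mul_apply, ← pow_succ', hlast] at this
  rw [hN.aeval_apply, this]
  simp only [fun k : Fin d => (hpow k k.2).symm, Fin.eta, add_neg_cancel]

theorem IsCompanion.finrank_intertwiners {d : ℕ} {N : Mat F d} {f : F[X]} (hN : IsCompanion N f)
    (M : Matrix n n F) {p : Submodule F (Matrix n (Fin d) F)}
    (hp : ∀ Z, Z ∈ p ↔ M * Z = Z * N) :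
    Module.finrank F p = Module.finrank F (LinearMap.ker (aeval (Matrix.toLin' M) f)) := by
  rcases Nat.eq_zero_or_pos d with rfl | hd
  · have hf : f = 1 := eq_one_of_monic_natDegree_zero hN.monic hN.natDegree_eq
    rw [hf, map_one, Module.End.one_eq_id, LinearMap.ker_id, finrank_bot]
    have : Subsingleton (Matrix n (Fin 0) F) := inferInstance
    exact Module.finrank_zero_of_subsingleton
  · refine LinearEquiv.finrank_eq
      { toFun := fun Z => ⟨Z.1.col ⟨0, hd⟩, (hN.mulVec_col ((hp _).1 Z.2) hd).2⟩
        map_add' := fun _ _ => rfl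
        map_smul' := fun _ _ => rfl
        invFun := fun x =>
          ⟨Matrix.of fun i (j : Fin d) => (Matrix.toLin' M ^ (j : ℕ)) x.1 i, (hp _).2 ?_⟩
        left_inv := ?_
        right_inv := ?_ }
    · ext i j
      have h1 := congrFun (hN.pow_succ_apply x.2 j) i
      rw [pow_succ', Module.End.mul_apply, Matrix.toLin'_apply] at h1
      simpa [Matrix.mul_apply, Matrix.mulVec, dotProduct, mul_comm] using h1
    · intro Z
      ext i j
      exact (congrFun ((hN.mulVec_col ((hp _).1 Z.2) hd).1 j) i).symm
    · intro x
      ext i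
      simp

theorem aeval_transpose (M : Matrix n n F) (u : F[X]) : aeval Mᵀ u = (aeval M u)ᵀ := by
  simp [aeval_eq_sum_range, Matrix.transpose_sum, Matrix.transpose_smul, Matrix.transpose_pow]

theorem aeval_toLin' (M : Matrix n n F) (u : F[X]) :
    aeval (Matrix.toLin' M) u = Matrix.toLin' (aeval M u) :=
  aeval_algHom_apply (Matrix.toLinAlgEquiv' (R := F) (n := n)) M u

theorem IsCompanion.aeval_eq_zero_iff {d : ℕ} {N : Mat F d} {f : F[X]} (hN : IsCompanion N f)
    (hd : 0 < d) (u : F[X]) : aeval N u = 0 ↔ f ∣ u := by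
  have h1 : N * (1 : Mat F d) = 1 * N := by simp
  obtain ⟨hpow, hzero⟩ := hN.mulVec_col h1 hd
  have hcol : ∀ j, (1 : Mat F d).col j = Pi.single j 1 := by
    intro j
    ext i
    simp [Matrix.one_apply, Pi.single_apply]
  have h0 : aeval N f = 0 := by
    apply (Matrix.toLin' (R := F)).injective
    rw [← aeval_toLin', map_zero]
    refine LinearMap.pi_ext' fun j => LinearMap.ext_ring ?_
    rw [LinearMap.comp_apply, LinearMap.coe_single, ← hcol, hpow, ← Module.End.mul_apply]
    have hcomm : aeval (Matrix.toLin' N) f * Matrix.toLin' N ^ (j : ℕ)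
        = Matrix.toLin' N ^ (j : ℕ) * aeval (Matrix.toLin' N) f := by
      rw [← aeval_X (R := F) (Matrix.toLin' N), ← map_pow, aeval_X, ← map_mul, mul_comm, map_mul]
    rw [hcomm, Module.End.mul_apply, hzero, map_zero]
    rfl
  have hmin : f = minpoly F N := by
    refine minpoly.unique' F N hN.monic h0 fun u hu => or_iff_not_imp_right.2 fun h => ?_
    rw [not_not] at h
    have hdeg : u.degree < d := by
      rwa [degree_eq_natDegree hN.monic.ne_zero, hN.natDegree_eq] at hu
    have hnat : u.natDegree < d := by
      by_cases hu0 : u = 0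
      · simpa [hu0] using hd
      · exact (natDegree_lt_iff_degree_lt hu0).2 hdeg
    ext i
    rw [coeff_zero]
    by_cases hi : i < d
    · have h1 : aeval (Matrix.toLin' N) u ((1 : Mat F d).col ⟨0, hd⟩) = 0 := by
        rw [aeval_toLin', h, map_zero, LinearMap.zero_apply]
      rw [aeval_eq_sum_range' hnat, LinearMap.sum_apply,
        Finset.sum_range] at h1
      simp only [LinearMap.smul_apply, ← hpow] at h1
      simp only [hcol] at h1
      have := congrFun h1 ⟨i, hi⟩
      rw [Finset.sum_apply, Finset.sum_eq_single ⟨i, hi⟩] at this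
      · simpa using this
      · intro j _ hj
        simp [hj.symm]
      · simp
    · exact coeff_eq_zero_of_degree_lt (hdeg.trans_le (by exact_mod_cast not_lt.1 hi))
  rw [hmin, minpoly.dvd_iff]

section Kernels

variable {p q : F[X]} {l m : ℕ} {M : Matrix n n F}

theorem ker_aeval_mono {n : Type*} {u v : F[X]} (h : u ∣ v) (C : Module.End F (n → F)) :
    LinearMap.ker (aeval C u) ≤ LinearMap.ker (aeval C v) := by
  obtain ⟨w, rfl⟩ := h
  rw [mul_comm, map_mul]
  exact LinearMap.ker_le_ker_comp _ _

theorem ker_aeval_eq_top {u v : F[X]} (hM : aeval M u = 0) (h : u ∣ v) :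
    LinearMap.ker (aeval (Matrix.toLin' M) v) = ⊤ := by
  have := ker_aeval_mono h (Matrix.toLin' M)
  rwa [aeval_toLin' M u, hM, map_zero, LinearMap.ker_zero, top_le_iff] at this

theorem ker_aeval_eq_bot {u v : F[X]} (hM : aeval M u = 0) (h : IsCoprime u v) :
    LinearMap.ker (aeval (Matrix.toLin' M) v) = ⊥ := by
  obtain ⟨r, s, hrs⟩ := h
  have h1 : aeval (Matrix.toLin' M) (s * v) = 1 := by
    have h2 := congrArg (aeval (Matrix.toLin' M)) hrs
    rwa [map_add, map_mul (aeval (Matrix.toLin' M)) r u, aeval_toLin' M u, hM, map_zero, mul_zero,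
      zero_add, map_one] at h2
  have := ker_aeval_mono (dvd_mul_left v s) (Matrix.toLin' M)
  rwa [h1, Module.End.one_eq_id, LinearMap.ker_id, le_bot_iff] at this

theorem finrank_ker_aeval_pow_lt (hp : Irreducible p) (hl : 0 < l)
    (hM : ∀ u : F[X], aeval M u = 0 ↔ p ^ l ∣ u) :
    Module.finrank F (LinearMap.ker (aeval (Matrix.toLin' M) (p ^ (l - 1))))
      < Module.finrank F (LinearMap.ker (aeval (Matrix.toLin' M) (p ^ l))) := by
  rw [ker_aeval_eq_top ((hM _).2 dvd_rfl) dvd_rfl, finrank_top]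
  refine Submodule.finrank_lt fun h => ?_
  rw [LinearMap.ker_eq_top, aeval_toLin', LinearEquiv.map_eq_zero_iff, hM,
    pow_dvd_pow_iff hp.ne_zero hp.not_isUnit] at h
  omega

theorem finrank_ker_aeval_pow_eq (hpm : p.Monic) (hp : Irreducible p) (hqm : q.Monic)
    (hq : Irreducible q) (hM : aeval M (q ^ m) = 0) (h : q = p → m < l) :
    Module.finrank F (LinearMap.ker (aeval (Matrix.toLin' M) (p ^ (l - 1))))
      = Module.finrank F (LinearMap.ker (aeval (Matrix.toLin' M) (p ^ l))) := by
  by_cases hqp : q = p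
  · have := h hqp
    subst hqp
    rw [ker_aeval_eq_top hM (pow_dvd_pow q (by omega)), ker_aeval_eq_top hM (pow_dvd_pow q this.le)]
  · have hco : IsCoprime q p := by
      rw [hq.coprime_iff_not_dvd]
      intro hdvd
      exact hqp (eq_of_monic_of_associated hqm hpm (hq.associated_of_dvd hp hdvd))
    rw [ker_aeval_eq_bot hM hco.pow, ker_aeval_eq_bot hM hco.pow]

end Kernels

end Frobenius

section SingularPencil

variable {m n d e : Type*} [Fintype m] [Fintype n] [Fintype d] [Fintype e]
  [DecidableEq n] [DecidableEq d]

theorem intertwinerDim_swap {m n d e : Type*} [Fintype n] [Fintype d] (A B : Matrix m n F) (P Q : Matrix d e F) :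
    intertwinerDim A B P Q = intertwinerDim B A Q P :=
  finrank_eq_of_mem_iff (LinearEquiv.refl F _) fun Z => by
    rw [mem_intertwiners, mem_intertwiners, LinearEquiv.refl_apply, eq_comm]

theorem intertwinerDim_eq_zero {A B : Matrix m n F} {P Q : Matrix d e F} {L : Matrix n m F}
    {R : Matrix e d F} (hL : L * A = 1) (hR : P * R = 1) (hQ : IsNilpotent (Q * R)) :
    intertwinerDim A B P Q = 0 := by
  obtain ⟨k, hk⟩ := hQ
  have : intertwiners A B P Q = ⊥ := by
    refine (Submodule.eq_bot_iff _).2 fun Z hZ => ?_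
    have h1 : Z = (L * B) * Z * (Q * R) := by
      have := congrArg (fun Y => L * Y * R) (mem_intertwiners.1 hZ)
      simpa only [Matrix.mul_assoc, hR, Matrix.mul_one, ← Matrix.mul_assoc L A, hL,
        Matrix.one_mul] using this
    have h2 : ∀ j, Z = (L * B) ^ j * Z * (Q * R) ^ j := by
      intro j
      induction j with
      | zero => simp
      | succ j ih =>
        conv_lhs => rw [ih, h1]
        rw [pow_succ, pow_succ']
        simp only [Matrix.mul_assoc]
    rw [h2 k, hk, Matrix.mul_zero]
  rw [intertwinerDim, this, finrank_bot]

end SingularPencil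

theorem isNilpotent_J (n : ℕ) : IsNilpotent (J F n 0) := by
  rcases Nat.eq_zero_or_pos n with rfl | hn
  · exact ⟨0, Subsingleton.elim _ _⟩
  · refine ⟨n, ?_⟩
    have := ((isCompanion_J (F := F) n).aeval_eq_zero_iff hn (X ^ n)).2 dvd_rfl
    simpa using this

theorem Fmat_mul_transpose (n : ℕ) : Fmat F n * (Fmat F n)ᵀ = 1 := by
  ext i j
  simp only [Matrix.mul_apply, sum_Fmat_mul i]
  simp [Fmat, Matrix.one_apply, Fin.ext_iff, eq_comm]

theorem Gmat_mul_transpose (n : ℕ) : Gmat F n * (Gmat F n)ᵀ = 1 := by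
  ext i j
  simp only [Matrix.mul_apply, sum_Gmat_mul i]
  simp [Gmat, Matrix.one_apply, Fin.ext_iff, eq_comm]

theorem Fmat_mul_Gmat_transpose (n : ℕ) : Fmat F n * (Gmat F n)ᵀ = J F (n - 1) 0 := by
  ext i j
  simp only [Matrix.mul_apply, sum_Fmat_mul i]
  by_cases h : i = j <;> simp [Gmat, J, h, eq_comm]

theorem isNilpotent_Gmat_mul_Fmat_transpose (n : ℕ) :
    IsNilpotent (Gmat F n * (Fmat F n)ᵀ) := by
  obtain ⟨k, hk⟩ := isNilpotent_J (F := F) (n - 1)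
  refine ⟨k, ?_⟩
  have : Gmat F n * (Fmat F n)ᵀ = (J F (n - 1) 0)ᵀ := by
    rw [← Fmat_mul_Gmat_transpose, Matrix.transpose_mul, Matrix.transpose_transpose]
  rw [this, ← Matrix.transpose_pow, hk, Matrix.transpose_zero]

theorem mem_intertwiners_Fmat_Gmat {m n k : ℕ} {A B : Matrix (Fin m) (Fin n) F}
    {Z : Matrix (Fin n) (Fin (k - 1)) F} :
    Z ∈ intertwiners A B (Fmat F k) (Gmat F k) ↔ ∀ (i : Fin m) (j : Fin k),
      (if h : (j : ℕ) < k - 1 then (A * Z) i ⟨j, h⟩ else 0)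
        = if h : 0 < (j : ℕ) then (B * Z) i ⟨j - 1, by omega⟩ else 0 := by
  rw [mem_intertwiners, ← Matrix.ext_iff]
  refine forall_congr' fun i => forall_congr' fun j => ?_
  rw [Matrix.mul_apply (M := A * Z), Matrix.mul_apply (M := B * Z)]
  simp only [mul_comm _ (Fmat F k _ _), mul_comm _ (Gmat F k _ _)]
  rw [sum_Fmat_mul', sum_Gmat_mul']

theorem intertwinerDim_Fmat_Gmat_eq_zero {n k : ℕ} (hk : k ≤ n) :
    intertwinerDim (Fmat F n) (Gmat F n) (Fmat F k) (Gmat F k) = 0 := by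
  have : intertwiners (Fmat F n) (Gmat F n) (Fmat F k) (Gmat F k) = ⊥ := by
    refine (Submodule.eq_bot_iff _).2 fun Z hZ => ?_
    rw [mem_intertwiners_Fmat_Gmat] at hZ
    simp only [Matrix.mul_apply, sum_Fmat_mul, sum_Gmat_mul] at hZ
    let W : ℕ → ℕ → F := fun i j => if h : i < n ∧ j < k - 1 then Z ⟨i, h.1⟩ ⟨j, h.2⟩ else 0
    have hW0 : ∀ i < n - 1, W i 0 = 0 := by
      intro i hi
      by_cases h : 0 < k - 1
      · have := hZ ⟨i, hi⟩ ⟨0, by omega⟩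
        simp only [lt_irrefl, dif_pos h, dite_false] at this
        simp only [W]
        rw [dif_pos ⟨by omega, h⟩, this]
      · simp only [W]
        rw [dif_neg (fun h' => h h'.2)]
    have hW : ∀ i < n - 1, ∀ j < k - 1, W i (j + 1) = W (i + 1) j := by
      intro i hi j hj
      have := hZ ⟨i, hi⟩ ⟨j + 1, by omega⟩
      simp only [Nat.add_sub_cancel, Nat.succ_pos, dite_true] at this
      simp only [W]
      rw [dif_pos (show i + 1 < n ∧ j < k - 1 from ⟨by omega, hj⟩), ← this]
      by_cases h : j + 1 < k - 1
      · rw [dif_pos ⟨by omega, h⟩, dif_pos h]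
      · rw [dif_neg (fun h' => h h'.2), dif_neg h]
    have h1 : ∀ j < k, ∀ i, i + j < n - 1 → W i j = 0 := by
      intro j
      induction j with
      | zero => exact fun _ i hi => hW0 i hi
      | succ j ih =>
        intro hj i hi
        rw [hW i (by omega) j (by omega)]
        exact ih (by omega) (i + 1) (by omega)
    have h2 : ∀ s j i, j + s = k - 1 → s ≤ i → i < n → W i j = 0 := by
      intro s
      induction s with
      | zero =>
        intro j i hj _ _
        simp only [W]
        rw [dif_neg (by omega)]
      | succ s ih =>
        intro j i hj hs hi
        obtain ⟨i, rfl⟩ : ∃ i', i = i' + 1 := ⟨i - 1, by omega⟩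
        rw [← hW i (by omega) j (by omega)]
        exact ih (j + 1) i (by omega) (by omega) (by omega)
    ext i j
    have hij : Z i j = W i j := by
      simp only [W]
      rw [dif_pos ⟨i.2, j.2⟩]
    rw [hij, Matrix.zero_apply]
    rcases lt_or_ge ((i : ℕ) + j) (n - 1) with h | h
    · exact h1 j (by omega) i h
    · exact h2 (k - 1 - j) j i (by omega) (by omega) i.2
  rw [intertwinerDim, this, finrank_bot]

theorem intertwinerDim_Fmat_Gmat_pos {n : ℕ} (hn : 0 < n) :
    0 < intertwinerDim (Fmat F n) (Gmat F n) (Fmat F (n + 1)) (Gmat F (n + 1)) := by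
  let Z : Matrix (Fin n) (Fin (n + 1 - 1)) F :=
    Matrix.of fun i j => if (i : ℕ) + (j : ℕ) + 1 = n then 1 else 0
  have hZ : Z ∈ intertwiners (Fmat F n) (Gmat F n) (Fmat F (n + 1)) (Gmat F (n + 1)) := by
    rw [mem_intertwiners_Fmat_Gmat]
    intro i j
    simp only [Matrix.mul_apply, sum_Fmat_mul, sum_Gmat_mul, Z, Matrix.of_apply]
    split_ifs <;> first | rfl | (exfalso; omega)
  have h0 : Z ≠ 0 := by
    intro h
    have := congrFun (congrFun h ⟨0, hn⟩) ⟨n - 1, by omega⟩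
    simp only [Z, Matrix.of_apply, Matrix.zero_apply] at this
    rw [if_pos (by omega)] at this
    exact one_ne_zero this
  refine Module.finrank_pos_iff_exists_ne_zero.2 ⟨⟨Z, hZ⟩, fun h => h0 (congrArg Subtype.val h)⟩

section Uniqueness

/-- The block of type (i). -/
def singularBlock (F : Type*) [Field F] (n : ℕ) : PBlock F :=
  ⟨n + (n - 1), (skewSum (Fmat F n) (-(Fmat F n)ᵀ), skewSum (Gmat F n) (-(Gmat F n)ᵀ))⟩

/-- The block of type (ii) with Frobenius matrix of characteristic polynomial `f`. -/
def regularBlock (f : F[X]) : PBlock F :=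
  ⟨f.natDegree + f.natDegree,
    (skewSum (1 : Mat F f.natDegree) (-1), skewSum (companion F f) (-(companion F f)ᵀ))⟩

/-- The block of type (iii). -/
def nilpotentBlock (F : Type*) [Field F] (n : ℕ) : PBlock F :=
  ⟨n + n, (skewSum (J F n 0) (-(J F n 0)ᵀ), skewSum (1 : Mat F n) (-1))⟩

/-- The sum of the nullities of `u(M)` and of `u(Mᵀ)`. -/
def nullityDim {d : ℕ} (M : Mat F d) (u : F[X]) : ℕ :=
  Module.finrank F (LinearMap.ker (aeval (Matrix.toLin' M) u))
    + Module.finrank F (LinearMap.ker (aeval (Matrix.toLin' Mᵀ) u))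

theorem nullityDim_mono {d : ℕ} (M : Mat F d) {u v : F[X]} (h : u ∣ v) :
    nullityDim M u ≤ nullityDim M v :=
  add_le_add (Submodule.finrank_mono (ker_aeval_mono h _))
    (Submodule.finrank_mono (ker_aeval_mono h _))

theorem aeval_transpose_eq_zero_iff {d : ℕ} {M : Mat F d} {u : F[X]} :
    aeval Mᵀ u = 0 ↔ aeval M u = 0 := by
  rw [aeval_transpose, Matrix.transpose_eq_zero]

theorem IsCompanion.nullityDim_lt {d l : ℕ} {M : Mat F d} {p : F[X]} (hM : IsCompanion M (p ^ l))
    (hd : 0 < d) (hp : Irreducible p) (hl : 0 < l) :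
    nullityDim M (p ^ (l - 1)) < nullityDim M (p ^ l) :=
  add_lt_add (finrank_ker_aeval_pow_lt hp hl fun u => hM.aeval_eq_zero_iff hd u)
    (finrank_ker_aeval_pow_lt hp hl fun u =>
      aeval_transpose_eq_zero_iff.trans (hM.aeval_eq_zero_iff hd u))

theorem IsCompanion.nullityDim_eq {d l m : ℕ} {M : Mat F d} {p q : F[X]}
    (hM : IsCompanion M (q ^ m)) (hd : 0 < d) (hpm : p.Monic) (hp : Irreducible p)
    (hqm : q.Monic) (hq : Irreducible q) (h : q = p → m < l) :
    nullityDim M (p ^ (l - 1)) = nullityDim M (p ^ l) := by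
  have h0 : aeval M (q ^ m) = 0 := (hM.aeval_eq_zero_iff hd _).2 dvd_rfl
  exact congrArg₂ (· + ·) (finrank_ker_aeval_pow_eq hpm hp hqm hq h0 h)
    (finrank_ker_aeval_pow_eq hpm hp hqm hq (aeval_transpose_eq_zero_iff.2 h0) h)

theorem testDim_nilpotentBlock (k m : ℕ) :
    testDim 1 (J F k 0) (nilpotentBlock F m) = nullityDim (J F m 0) (X ^ k) := by
  rw [nilpotentBlock, testDim_skewSum]
  refine congrArg₂ (· + ·) ((isCompanion_J k).finrank_intertwiners _ fun Z => ?_)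
    ((isCompanion_J k).finrank_intertwiners _ fun Z => ?_) <;>
  rw [mem_intertwiners, Matrix.mul_one, Matrix.one_mul]

theorem testDim_regularBlock {f : F[X]} (hf : f.Monic) (g : F[X]) :
    testDim (companion F f) 1 (regularBlock g) = nullityDim (companion F g) f := by
  rw [regularBlock, testDim_skewSum]
  refine congrArg₂ (· + ·) ((isCompanion_companion hf).finrank_intertwiners _ fun Z => ?_)
    ((isCompanion_companion hf).finrank_intertwiners _ fun Z => ?_) <;>
  rw [mem_intertwiners, Matrix.mul_one, Matrix.one_mul, eq_comm]

theorem testDim_J_regularBlock (k : ℕ) (g : F[X]) :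
    testDim 1 (J F k 0) (regularBlock g) = 0 := by
  have h : IsNilpotent (J F k 0 * 1) := by simpa using isNilpotent_J k
  rw [regularBlock, testDim_skewSum,
    intertwinerDim_eq_zero (L := 1) (R := 1) (Matrix.mul_one _) (Matrix.mul_one _) h,
    intertwinerDim_eq_zero (L := 1) (R := 1) (Matrix.mul_one _) (Matrix.mul_one _) h]

theorem testDim_Fmat_Gmat_regularBlock (k : ℕ) (g : F[X]) :
    testDim (Fmat F k) (Gmat F k) (regularBlock g) = 0 := by
  have h := isNilpotent_Gmat_mul_Fmat_transpose (F := F) k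
  rw [regularBlock, testDim_skewSum,
    intertwinerDim_eq_zero (L := 1) (Matrix.mul_one _) (Fmat_mul_transpose k) h,
    intertwinerDim_eq_zero (L := 1) (Matrix.mul_one _) (Fmat_mul_transpose k) h]

theorem testDim_Fmat_Gmat_nilpotentBlock (k m : ℕ) :
    testDim (Fmat F k) (Gmat F k) (nilpotentBlock F m) = 0 := by
  have h : IsNilpotent (Fmat F k * (Gmat F k)ᵀ) := by
    rw [Fmat_mul_Gmat_transpose]
    exact isNilpotent_J _
  rw [nilpotentBlock, testDim_skewSum, intertwinerDim_swap, intertwinerDim_swap (J F m 0)ᵀ,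
    intertwinerDim_eq_zero (L := 1) (Matrix.mul_one _) (Gmat_mul_transpose k) h,
    intertwinerDim_eq_zero (L := 1) (Matrix.mul_one _) (Gmat_mul_transpose k) h]

theorem testDim_Fmat_Gmat_singularBlock (k n : ℕ) :
    testDim (Fmat F k) (Gmat F k) (singularBlock F n)
      = intertwinerDim (Fmat F n) (Gmat F n) (Fmat F k) (Gmat F k) := by
  rw [singularBlock, testDim_skewSum, intertwinerDim_eq_zero (A := (Fmat F n)ᵀ)
    (Fmat_mul_transpose n) (Fmat_mul_transpose k) (isNilpotent_Gmat_mul_Fmat_transpose k), add_zero]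

theorem testDim_eq_zero_of_isEmpty (P Q : Matrix (Fin 0) (Fin 0) F) (X : PBlock F) :
    testDim P Q X = 0 := by
  have : Subsingleton (Matrix (Fin X.1) (Fin 0) F) := inferInstance
  exact Module.finrank_zero_of_subsingleton

/-- `h` is one of the additive congruence invariants `testDim P Q`. -/
def IsTest (h : PBlock F → ℕ) : Prop :=
  ∃ (d e : ℕ) (P Q : Matrix (Fin d) (Fin e) F), h = testDim P Q

/-- The difference of two test invariants is nonnegative on `L` and detects exactly the summand
`b`. -/
def Detects (L : List (PBlock F)) (b : PBlock F) : Prop :=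
  ∃ h h' : PBlock F → ℕ, IsTest h ∧ IsTest h' ∧ (∀ Y ∈ L, h' Y ≤ h Y) ∧ h' b < h b ∧
    ∀ Y ∈ L, h' Y ≠ h Y → Y = b

theorem exists_mem_minimal {α : Type*} (L : List α) (T : α → Prop) (f : α → ℤ)
    (h : ∃ b ∈ L, T b) : ∃ b ∈ L, T b ∧ ∀ Y ∈ L, T Y → f b ≤ f Y := by
  classical
  obtain ⟨b, hb, hTb⟩ := h
  obtain ⟨c, hc, hmin⟩ := Finset.exists_min_image (L.toFinset.filter T) f ⟨b, by simp [hb, hTb]⟩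
  rw [Finset.mem_filter, List.mem_toFinset] at hc
  exact ⟨c, hc.1, hc.2, fun Y hY hT => hmin Y (by simp [hY, hT])⟩

theorem exists_detects_singular {L : List (PBlock F)}
    (hL : ∀ b ∈ L, T12i b ∨ T12ii b ∨ T12iii b) (h : ∃ b ∈ L, T12i b) :
    ∃ b ∈ L, Detects L b := by
  obtain ⟨b, hb, ⟨n, hn, rfl⟩, hmin⟩ := exists_mem_minimal L T12i (fun X => (X.1 : ℤ)) h
  refine ⟨_, hb, testDim (Fmat F (n + 1)) (Gmat F (n + 1)),
    testDim (0 : Matrix (Fin 0) (Fin 0) F) 0, ⟨_, _, _, _, rfl⟩, ⟨_, _, _, _, rfl⟩,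
    fun Y _ => ?_, ?_, fun Y hY hne => ?_⟩
  · rw [testDim_eq_zero_of_isEmpty]
    exact Nat.zero_le _
  · rw [testDim_eq_zero_of_isEmpty]
    exact (intertwinerDim_Fmat_Gmat_pos hn).trans_eq (testDim_Fmat_Gmat_singularBlock _ _).symm
  · rw [testDim_eq_zero_of_isEmpty] at hne
    rcases hL Y hY with hT | ⟨p, l, _, _, _, rfl⟩ | ⟨m, _, rfl⟩
    · have hle := hmin Y hY hT
      obtain ⟨m, hm, rfl⟩ := hT
      have hnm : n = m := by
        simp only [Nat.cast_le] at hle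
        by_contra hnm
        exact hne ((testDim_Fmat_Gmat_singularBlock _ _).trans
          (intertwinerDim_Fmat_Gmat_eq_zero (by omega))).symm
      rw [hnm]
    · exact absurd (testDim_Fmat_Gmat_regularBlock _ _).symm hne
    · exact absurd (testDim_Fmat_Gmat_nilpotentBlock _ _).symm hne

theorem exists_detects_nilpotent {L : List (PBlock F)}
    (hL : ∀ b ∈ L, T12ii b ∨ T12iii b) (h : ∃ b ∈ L, T12iii b) :
    ∃ b ∈ L, Detects L b := by
  obtain ⟨b, hb, ⟨n, hn, rfl⟩, hmin⟩ := exists_mem_minimal L T12iii (fun X => -(X.1 : ℤ)) h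
  refine ⟨_, hb, testDim 1 (J F n 0), testDim 1 (J F (n - 1) 0), ⟨_, _, _, _, rfl⟩,
    ⟨_, _, _, _, rfl⟩, fun Y hY => ?_, ?_, fun Y hY hne => ?_⟩
  · rcases hL Y hY with ⟨p, l, _, _, _, rfl⟩ | ⟨m, _, rfl⟩
    · exact ((testDim_J_regularBlock _ _).trans (testDim_J_regularBlock _ _).symm).le
    · change testDim _ _ (nilpotentBlock F m) ≤ testDim _ _ (nilpotentBlock F m)
      rw [testDim_nilpotentBlock, testDim_nilpotentBlock]
      exact nullityDim_mono _ (pow_dvd_pow X (Nat.sub_le n 1))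
  · change testDim _ _ (nilpotentBlock F n) < testDim _ _ (nilpotentBlock F n)
    rw [testDim_nilpotentBlock, testDim_nilpotentBlock]
    exact (isCompanion_J n).nullityDim_lt hn irreducible_X hn
  · rcases hL Y hY with ⟨p, l, _, _, _, rfl⟩ | hT
    · exact absurd ((testDim_J_regularBlock _ _).trans (testDim_J_regularBlock _ _).symm) hne
    · have hle := hmin Y hY hT
      obtain ⟨m, hm, rfl⟩ := hT
      have hnm : n = m := by
        simp only [neg_le_neg_iff, Nat.cast_le] at hle
        by_contra hnm
        change testDim _ _ (nilpotentBlock F m) ≠ testDim _ _ (nilpotentBlock F m) at hne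
        rw [testDim_nilpotentBlock, testDim_nilpotentBlock] at hne
        exact hne ((isCompanion_J m).nullityDim_eq hm monic_X irreducible_X monic_X irreducible_X
          fun _ => by omega)
      rw [hnm]

theorem exists_detects_regular {L : List (PBlock F)} (hL : ∀ b ∈ L, T12ii b) (hne : L ≠ []) :
    ∃ b ∈ L, Detects L b := by
  have h : ∃ b ∈ L, T12ii b := by
    obtain ⟨b, hb⟩ := List.exists_mem_of_ne_nil L hne
    exact ⟨b, hb, hL b hb⟩
  obtain ⟨b, hb, ⟨p, l, hpm, hp, hl, rfl⟩, hmin⟩ :=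
    exists_mem_minimal L T12ii (fun X => -(X.1 : ℤ)) h
  have hdeg : ∀ {q : F[X]} {m : ℕ}, Irreducible q → 0 < m → 0 < (q ^ m).natDegree := by
    intro q m hq hm
    rw [natDegree_pow]
    exact Nat.mul_pos hm hq.natDegree_pos
  refine ⟨_, hb, testDim (companion F (p ^ l)) 1, testDim (companion F (p ^ (l - 1))) 1,
    ⟨_, _, _, _, rfl⟩, ⟨_, _, _, _, rfl⟩, fun Y hY => ?_, ?_, fun Y hY hne => ?_⟩
  · obtain ⟨q, m, hqm, hq, hm, rfl⟩ := hL Y hY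
    change testDim _ _ (regularBlock _) ≤ testDim _ _ (regularBlock _)
    rw [testDim_regularBlock (hpm.pow _), testDim_regularBlock (hpm.pow _)]
    exact nullityDim_mono _ (pow_dvd_pow p (Nat.sub_le l 1))
  · change testDim _ _ (regularBlock _) < testDim _ _ (regularBlock _)
    rw [testDim_regularBlock (hpm.pow _), testDim_regularBlock (hpm.pow _)]
    exact (isCompanion_companion (hpm.pow l)).nullityDim_lt (hdeg hp hl) hp hl
  · have hle := hmin Y hY (hL Y hY)
    obtain ⟨q, m, hqm, hq, hm, rfl⟩ := hL Y hY
    change testDim _ _ (regularBlock _) ≠ testDim _ _ (regularBlock _) at hne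
    rw [testDim_regularBlock (hpm.pow _), testDim_regularBlock (hpm.pow _)] at hne
    have hqp : q = p ∧ ¬ m < l := by
      by_contra hcon
      exact hne ((isCompanion_companion (hqm.pow m)).nullityDim_eq (hdeg hq hm) hpm hp hqm hq
        fun hqp => by_contra fun hml => hcon ⟨hqp, hml⟩)
    obtain ⟨rfl, hml⟩ := hqp
    have hmul : m * q.natDegree ≤ l * q.natDegree := by
      simp only [neg_le_neg_iff, Nat.cast_le, natDegree_pow] at hle
      omega
    have := Nat.le_of_mul_le_mul_right hmul hq.natDegree_pos
    obtain rfl : m = l := by omega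
    rfl

theorem exists_detects {L : List (PBlock F)} (hL : ∀ b ∈ L, T12i b ∨ T12ii b ∨ T12iii b)
    (hne : L ≠ []) : ∃ b ∈ L, Detects L b := by
  by_cases h1 : ∃ b ∈ L, T12i b
  · exact exists_detects_singular hL h1
  have hL' : ∀ b ∈ L, T12ii b ∨ T12iii b := fun b hb =>
    (hL b hb).resolve_left fun h => h1 ⟨b, hb, h⟩
  by_cases h3 : ∃ b ∈ L, T12iii b
  · exact exists_detects_nilpotent hL' h3
  exact exists_detects_regular
    (fun b hb => (hL' b hb).resolve_right fun h => h3 ⟨b, hb, h⟩) hne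

theorem Detects.mem {L L₁ L₂ : List (PBlock F)} {b : PBlock F} (hD : Detects L b)
    (h1 : L₁ ⊆ L) (h2 : L₂ ⊆ L)
    (hsum : ∀ h : PBlock F → ℕ, IsTest h → (L₁.map h).sum = (L₂.map h).sum) (hb : b ∈ L₁) :
    b ∈ L₂ := by
  obtain ⟨h, h', ht, ht', hle, hlt, heq⟩ := hD
  by_contra hb2
  have hmap : L₂.map h' = L₂.map h := List.map_congr_left fun Y hY =>
    by_contra fun hne => hb2 (heq Y (h2 hY) hne ▸ hY)
  have hlt' : (L₁.map h').sum < (L₁.map h).sum :=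
    List.sum_lt_sum h' h (fun Y hY => hle Y (h1 hY)) ⟨b, hb, hlt⟩
  rw [hsum h ht, hsum h' ht', hmap] at hlt'
  exact lt_irrefl _ hlt'

theorem perm_of_sum_eq (k : ℕ) : ∀ {L₁ L₂ : List (PBlock F)}, L₁.length = k →
    (∀ b ∈ L₁, T12i b ∨ T12ii b ∨ T12iii b) → (∀ b ∈ L₂, T12i b ∨ T12ii b ∨ T12iii b) →
    (∀ h : PBlock F → ℕ, IsTest h → (L₁.map h).sum = (L₂.map h).sum) → L₁.Perm L₂ := by
  classical
  induction k with
  | zero =>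
    intro L₁ L₂ hk h1 h2 hsum
    obtain rfl := List.length_eq_zero_iff.1 hk
    rcases eq_or_ne L₂ [] with rfl | hne
    · exact List.Perm.refl _
    · obtain ⟨b, hb, hD⟩ := exists_detects h2 hne
      have := hD.mem (L₁ := L₂) (L₂ := []) (List.Subset.refl _) (List.nil_subset _)
        (fun h ht => (hsum h ht).symm) hb
      simp at this
  | succ k ih =>
    intro L₁ L₂ hk h1 h2 hsum
    have hne : L₁ ++ L₂ ≠ [] := by
      rintro h
      simp [(List.append_eq_nil_iff.1 h).1] at hk
    have hL : ∀ b ∈ L₁ ++ L₂, T12i b ∨ T12ii b ∨ T12iii b := fun b hb =>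
      (List.mem_append.1 hb).elim (h1 b) (h2 b)
    obtain ⟨b, hb, hD⟩ := exists_detects hL hne
    obtain ⟨hb1, hb2⟩ : b ∈ L₁ ∧ b ∈ L₂ := by
      rcases List.mem_append.1 hb with hb | hb
      · exact ⟨hb, hD.mem (List.subset_append_left _ _) (List.subset_append_right _ _) hsum hb⟩
      · exact ⟨hD.mem (List.subset_append_right _ _) (List.subset_append_left _ _)
          (fun h ht => (hsum h ht).symm) hb, hb⟩
    have p1 := List.perm_cons_erase hb1
    have p2 := List.perm_cons_erase hb2
    refine p1.trans (((ih ?_ (fun X hX => h1 X (List.mem_of_mem_erase hX))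
      (fun X hX => h2 X (List.mem_of_mem_erase hX)) fun h ht => ?_).cons b).trans p2.symm)
    · rw [List.length_erase_of_mem hb1, hk, Nat.add_sub_cancel]
    · have := hsum h ht
      rw [(p1.map h).sum_eq, (p2.map h).sum_eq, List.map_cons, List.map_cons, List.sum_cons,
        List.sum_cons] at this
      exact Nat.add_left_cancel this

end Uniqueness

theorem stmt12 (F : Type*) [Field F] (hchar : (2 : F) ≠ 0)
    (n : ℕ) (A B : Mat F n) (hA : Aᵀ = -A) (hB : Bᵀ = -B) :
    (∃ L : List (PBlock F), (∀ b ∈ L, T12i b ∨ T12ii b ∨ T12iii b) ∧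
      PCong ⟨n, (A, B)⟩ (psum L)) ∧
    (∀ L₁ L₂ : List (PBlock F),
      (∀ b ∈ L₁, T12i b ∨ T12ii b ∨ T12iii b) → (∀ b ∈ L₂, T12i b ∨ T12ii b ∨ T12iii b) →
      PCong ⟨n, (A, B)⟩ (psum L₁) → PCong ⟨n, (A, B)⟩ (psum L₂) → L₁.Perm L₂) := by
  refine ⟨?_, fun L₁ L₂ h1 h2 hc1 hc2 => perm_of_sum_eq _ rfl h1 h2 ?_⟩
  · obtain ⟨L, hL, hR⟩ := exists_realizes_psum hchar _
      (a := Matrix.toLinearMap₂' F A) (b := Matrix.toLinearMap₂' F B)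
      (toLinearMap₂'_skew hA) (toLinearMap₂'_skew hB) rfl
    exact ⟨L, hL, hR.pCong⟩
  · rintro _ ⟨d, e, P, Q, rfl⟩
    rw [← testDim_psum, ← testDim_psum, ← testDim_eq_of_pCong P Q hc1,
      ← testDim_eq_of_pCong P Q hc2]

end Stmt12
end
end Can
end

section
/- Let F be a field of characteristic not 2 and let Φ be an n×n nonsingular Frobenius block over F such that there exists a nonsingular matrix M over F with M = MᵀΦ. Then deg p_Φ(x) is even or p_Φ(x) = x + (−1)ⁿ. -/
open Polynomial Matrix

namespace Can

noncomputable section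

variable {F : Type*} [Field F]

/-- The companion matrix of a monic polynomial represents multiplication by the root in
`F[X] / (f)`. -/
theorem exists_algHom_root_eq_companion {f : F[X]} (hf : f.Monic) :
    ∃ L : AdjoinRoot f →ₐ[F] Mat F f.natDegree, Function.Injective L ∧
      L (AdjoinRoot.root f) = companion F f ∧ (companion F f).charpoly = f := by
  have hmin : minpoly F (AdjoinRoot.powerBasis' hf).gen = f := by
    change minpoly F (AdjoinRoot.root f) = f
    rw [AdjoinRoot.minpoly_root hf.ne_zero, hf.leadingCoeff, inv_one, C.map_one, mul_one]
  have hL : Algebra.leftMulMatrix (AdjoinRoot.powerBasis' hf).basis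
      (AdjoinRoot.powerBasis' hf).gen = companion F f := by
    by_cases hA : Nontrivial (AdjoinRoot f)
    · rw [PowerBasis.leftMulMatrix, PowerBasis.minpolyGen_eq, hmin]
      ext i j
      have hi := i.isLt
      have hd := AdjoinRoot.powerBasis'_dim hf
      rw [Matrix.of_apply]
      change _ = if (i : ℕ) = (j : ℕ) + 1 then 1
        else if (j : ℕ) + 1 = f.natDegree then -f.coeff i else 0
      split_ifs <;> first | rfl | omega
    · have := not_nontrivial_iff_subsingleton.mp hA
      have h0 : f.natDegree = 0 := by
        have := AdjoinRoot.powerBasis'_dim hf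
        rw [← this, ← PowerBasis.finrank]
        exact Module.finrank_zero_of_subsingleton
      ext i
      exact absurd i.isLt (by simp [h0])
  refine ⟨Algebra.leftMulMatrix (AdjoinRoot.powerBasis' hf).basis,
    Algebra.leftMulMatrix_injective _, hL, ?_⟩
  rw [← hL]
  exact (charpoly_leftMulMatrix (AdjoinRoot.powerBasis' hf)).trans hmin

theorem transpose_aeval_mul_of_eq_transpose_mul {n : ℕ} {M P Q : Mat F n}
    (hM : M = Mᵀ * P) (hPQ : P * Q = 1) (g : F[X]) :
    (aeval P g)ᵀ * M = M * aeval Q g := by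
  have h1 : Pᵀ * M = M * Q := by
    have hT : Mᵀ = Pᵀ * M := by
      conv_lhs => rw [hM]
      simp
    have hM' : M = Pᵀ * M * P := by rw [← hT]; exact hM
    conv_rhs => rw [hM']
    rw [Matrix.mul_assoc _ P Q, hPQ, Matrix.mul_one]
  have hpow (k : ℕ) : (P ^ k)ᵀ * M = M * Q ^ k := by
    induction k with
    | zero => simp
    | succ k ih =>
      rw [pow_succ, Matrix.transpose_mul, Matrix.mul_assoc, ih, ← Matrix.mul_assoc, h1,
        Matrix.mul_assoc, pow_succ']
  induction g using Polynomial.induction_on' with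
  | add p q hp hq => simp [Matrix.add_mul, Matrix.mul_add, hp, hq]
  | monomial k a => simp [aeval_monomial, ← Algebra.smul_def, ← hpow]

/-- A cosquare of even size that acts as a shift on the standard basis cannot be a unipotent
Jordan block. -/
theorem sub_one_pow_eq_zero_of_eq_transpose_mul (hchar : (2 : F) ≠ 0) {n : ℕ} {M P Q : Mat F n}
    (hMns : IsUnit M.det) (hM : M = Mᵀ * P) (hPQ : P * Q = 1)
    (hP : ∀ i j k : Fin n, (k : ℕ) = j + 1 → P i j = if i = k then 1 else 0)
    (hpos : 0 < n) (heven : Even n) (hnil : (P - 1) ^ n = 0) : (P - 1) ^ (n - 1) = 0 := by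
  have hshift (K : Mat F n) (i j k : Fin n) (h : (k : ℕ) = j + 1) : (K * P) i j = K i k := by
    simp [Matrix.mul_apply, hP _ j k h]
  set N := (P - 1) ^ (n - 1) with hN
  have hQP : Q * P = 1 := mul_eq_one_comm.mp hPQ
  have hPN : P * N = N := by
    have h : (P - 1) * N = 0 := by rw [hN, ← pow_succ', Nat.sub_add_cancel hpos, hnil]
    rwa [Matrix.sub_mul, Matrix.one_mul, sub_eq_zero] at h
  have hNP : N * P = N := by
    have h : N * (P - 1) = 0 := by rw [hN, ← pow_succ, Nat.sub_add_cancel hpos, hnil]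
    rwa [Matrix.mul_sub, Matrix.mul_one, sub_eq_zero] at h
  have hQN : Q * N = N := by
    conv_lhs => rw [← hPN]
    rw [← Matrix.mul_assoc, hQP, Matrix.one_mul]
  have hQkN (k : ℕ) : Q ^ k * N = N := by
    induction k with
    | zero => simp
    | succ k ih => rw [pow_succ, Matrix.mul_assoc, hQN, ih]
  have hodd : Odd (n - 1) := by
    obtain ⟨k, hk⟩ := heven
    exact ⟨k - 1, by omega⟩
  have hQ1 : (Q - 1) ^ (n - 1) = -N := by
    have hc : Commute Q (P - 1) := by
      refine Commute.sub_right ?_ (Commute.one_right Q)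
      exact hQP.trans hPQ.symm
    have : Q - 1 = -(Q * (P - 1)) := by rw [Matrix.mul_sub, hQP, Matrix.mul_one, neg_sub]
    rw [this, hodd.neg_pow, hc.mul_pow, ← hN, hQkN]
  have hNM : Nᵀ * M = -(M * N) := by
    have h := transpose_aeval_mul_of_eq_transpose_mul hM hPQ ((X - 1) ^ (n - 1))
    simp only [map_pow, map_sub, aeval_X, map_one] at h
    rw [← hN, hQ1, Matrix.mul_neg] at h
    exact h
  set K := M * N with hK
  have hKP : K * P = K := by rw [hK, Matrix.mul_assoc, hNP]
  have hskew : Kᵀ = -K := by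
    have hT : Mᵀ = Pᵀ * M := by
      conv_lhs => rw [hM]
      simp
    rw [hK, Matrix.transpose_mul, hT, ← Matrix.mul_assoc, ← Matrix.transpose_mul, hPN, hNM]
  have hconst (i : Fin n) (j : ℕ) (hj : j < n) : K i ⟨j, hj⟩ = K i ⟨0, hpos⟩ := by
    induction j with
    | zero => rfl
    | succ j ih =>
      rw [← ih (by omega), ← hshift K i ⟨j, by omega⟩ ⟨j + 1, hj⟩ rfl, hKP]
  have hneg (i j : Fin n) : K i j = -K j i := by
    have := congrFun (congrFun hskew j) i
    simpa using this
  have h00 : K ⟨0, hpos⟩ ⟨0, hpos⟩ = 0 := by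
    have h := hneg ⟨0, hpos⟩ ⟨0, hpos⟩
    have h2 : 2 * K ⟨0, hpos⟩ ⟨0, hpos⟩ = 0 := by linear_combination h
    exact (mul_eq_zero.mp h2).resolve_left hchar
  have hK0 : K = 0 := by
    ext i j
    rw [Matrix.zero_apply, hconst i j j.isLt, hneg, hconst _ i i.isLt, h00, neg_zero]
  have := congrArg (M⁻¹ * ·) hK0
  simpa only [hK, ← Matrix.mul_assoc, Matrix.nonsing_inv_mul _ hMns, Matrix.one_mul,
    Matrix.mul_zero] using this

/-- A monic irreducible polynomial of odd degree that divides its reverse is `X ± 1`. -/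
theorem eq_X_add_C_of_dvd_reverse (hchar : (2 : F) ≠ 0) {p : F[X]} (hmon : p.Monic)
    (hirr : Irreducible p) (hrev : p ∣ p.reverse)
    (hodd : Odd p.natDegree) : ∃ c : F, c ^ 2 = 1 ∧ p = X + C c := by
  obtain ⟨q, hq⟩ := hrev
  have hr0 : p.reverse ≠ 0 := by simpa using hmon.ne_zero
  have hq0 : q ≠ 0 := by rintro rfl; simp [hr0] at hq
  have hdeg : q.natDegree = 0 := by
    have h := reverse_natDegree_le p
    rw [hq, natDegree_mul hmon.ne_zero hq0] at h
    omega
  obtain ⟨c, rfl⟩ := natDegree_eq_zero.mp hdeg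
  have hc0 : c * p.coeff 0 = 1 := by
    have h := congrArg (coeff · 0) hq
    simp only [coeff_zero_reverse, hmon.leadingCoeff, coeff_mul_C] at h
    rw [h, mul_comm]
  have hc : c = p.coeff 0 := by
    have h := congrArg (coeff · p.natDegree) hq
    simpa [coeff_reverse, revAt_le le_rfl, hmon.coeff_natDegree, eq_comm] using h
  have hsq : c ^ 2 = 1 := by rw [sq]; nth_rewrite 2 [hc]; exact hc0
  have hroot : p.eval (-c) = 0 := by
    let _ : Invertible (-c) := ⟨-c, by linear_combination hsq, by linear_combination hsq⟩
    have h := eval₂_reverse_mul_pow (RingHom.id F) (-c) p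
    have hpow : (-c) ^ p.natDegree = -c := by
      obtain ⟨k, hk⟩ := hodd
      rw [hk, pow_succ, pow_mul, neg_sq, hsq, one_pow, one_mul]
    have hinv : ⅟(-c) = -c := rfl
    rw [hpow, hinv, hq, ← eval, ← eval, eval_mul, eval_C] at h
    have h2 : 2 * p.eval (-c) = 0 := by linear_combination (-1) * h - p.eval (-c) * hsq
    exact (mul_eq_zero.mp h2).resolve_left hchar
  refine ⟨c, hsq, ?_⟩
  have hdvd : X - C (-c) ∣ p := dvd_iff_isRoot.mpr hroot
  have := (irreducible_X_sub_C (-c)).associated_of_dvd hirr hdvd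
  rw [← eq_of_monic_of_associated (monic_X_sub_C _) hmon this]
  simp

theorem aeval_reverse_of_mul_eq_one {A : Type*} [Ring A] [Algebra F A] {x y : A}
    (hxy : x * y = 1) (f : F[X]) : aeval x f.reverse = x ^ f.natDegree * aeval y f := by
  have hpow (k : ℕ) : x ^ k * y ^ k = 1 := by
    induction k with
    | zero => simp
    | succ k ih => rw [pow_succ, pow_succ', mul_assoc, ← mul_assoc x, hxy, one_mul, ih]
  rw [aeval_eq_sum_range' (Nat.lt_succ_of_le (reverse_natDegree_le f)), aeval_eq_sum_range,
    Finset.mul_sum, ← Finset.sum_range_reflect]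
  refine Finset.sum_congr rfl fun i hi => ?_
  have hi : i ≤ f.natDegree := Nat.lt_succ_iff.mp (Finset.mem_range.mp hi)
  rw [Nat.succ_sub_one, coeff_reverse, revAt_le (Nat.sub_le _ _), Nat.sub_sub_self hi,
    mul_smul_comm]
  nth_rewrite 2 [← Nat.sub_add_cancel hi]
  rw [pow_add, mul_assoc, hpow, mul_one]

/-- The characteristic polynomial of a companion matrix that is a cosquare divides its own
reverse. -/
theorem dvd_reverse_of_eq_transpose_mul_companion {f : F[X]} (hf : f.Monic)
    {M Q : Mat F f.natDegree} (hMns : IsUnit M.det) (hM : M = Mᵀ * companion F f)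
    (hPQ : companion F f * Q = 1) : f ∣ f.reverse := by
  obtain ⟨L, hLinj, hLroot, -⟩ := exists_algHom_root_eq_companion hf
  have hP : aeval (companion F f) f = 0 := by
    rw [← hLroot, aeval_algHom_apply]
    simp
  have hQ : aeval Q f = 0 := by
    have h := transpose_aeval_mul_of_eq_transpose_mul hM hPQ f
    rw [hP, Matrix.transpose_zero, Matrix.zero_mul] at h
    have := congrArg (M⁻¹ * ·) h.symm
    simpa only [← Matrix.mul_assoc, Matrix.nonsing_inv_mul _ hMns, Matrix.one_mul,
      Matrix.mul_zero] using this
  have hrev : aeval (companion F f) f.reverse = 0 := by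
    rw [aeval_reverse_of_mul_eq_one hPQ, hQ, mul_zero]
  rw [← hLroot, aeval_algHom_apply, map_eq_zero_iff L hLinj, AdjoinRoot.aeval_eq,
    AdjoinRoot.mk_eq_zero] at hrev
  exact hrev

theorem companion_apply_of_eq_succ {f : F[X]} (i j k : Fin f.natDegree) (h : (k : ℕ) = j + 1) :
    companion F f i j = if i = k then 1 else 0 := by
  have hj : (j : ℕ) + 1 ≠ f.natDegree := by omega
  simp [companion, Fin.ext_iff, hj, h]

theorem stmt13 (F : Type*) [Field F] (hchar : (2 : F) ≠ 0)
    (pp : Polynomial F) (l : ℕ) (hmon : pp.Monic) (hirr : Irreducible pp) (hl : 0 < l)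
    (hns : (pp ^ l).eval 0 ≠ 0)
    (M : Mat F (pp ^ l).natDegree) (hMns : IsUnit M.det)
    (hM : M = Mᵀ * companion F (pp ^ l)) :
    Even pp.natDegree ∨ pp = X + C ((-1 : F) ^ (pp ^ l).natDegree) := by
  refine or_iff_not_imp_left.mpr fun hodd => ?_
  rw [Nat.not_even_iff_odd] at hodd
  have hf : (pp ^ l).Monic := hmon.pow l
  obtain ⟨L, hLinj, hLroot, hchp⟩ := exists_algHom_root_eq_companion hf
  have hdet : (companion F (pp ^ l)).det = 1 := by
    have h := congrArg Matrix.det hM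
    rw [Matrix.det_mul, Matrix.det_transpose] at h
    exact mul_left_cancel₀ hMns.ne_zero (by rw [← h, mul_one])
  have hPQ : companion F (pp ^ l) * (companion F (pp ^ l))⁻¹ = 1 :=
    Matrix.mul_nonsing_inv _ (by simp [hdet])
  have hdvd : pp ∣ pp.reverse := by
    have h := (dvd_pow_self pp hl.ne').trans
      (dvd_reverse_of_eq_transpose_mul_companion hf hMns hM hPQ)
    have hrev : (pp ^ l).reverse = pp.reverse ^ l := by
      clear * -
      induction l with
      | zero => rw [pow_zero, pow_zero, ← C_1, reverse_C]
      | succ k ih => rw [pow_succ, pow_succ, reverse_mul_of_domain, ih]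
    rw [hrev] at h
    exact hirr.prime.dvd_of_dvd_pow h
  obtain ⟨c, hc, hp⟩ := eq_X_add_C_of_dvd_reverse hchar hmon hirr hdvd hodd
  have hn : (pp ^ l).natDegree = l := by simp [hp]
  have hcn : (-c) ^ l = 1 := by
    rw [Matrix.det_eq_sign_charpoly_coeff, hchp, Fintype.card_fin, hn, coeff_zero_eq_eval_zero,
      hp, eval_pow, eval_add, eval_X, eval_C, zero_add, ← mul_pow, neg_one_mul] at hdet
    exact hdet
  rw [hn]
  suffices h : c = (-1) ^ l by rw [← h]; exact hp
  rcases Nat.even_or_odd l with hl2 | hl2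
  · rw [hl2.neg_one_pow]
    by_contra hne
    have hc1 : c = -1 := (sq_eq_sq_iff_eq_or_eq_neg.mp (hc.trans (one_pow 2).symm)).resolve_left hne
    have hp1 : pp = X - 1 := by rw [hp, hc1, C_neg, C_1, ← sub_eq_add_neg]
    have hpow (k : ℕ) : (companion F (pp ^ l) - 1) ^ k = L (AdjoinRoot.mk (pp ^ l) (pp ^ k)) := by
      have : AdjoinRoot.mk (pp ^ l) pp = AdjoinRoot.root (pp ^ l) - 1 := by
        rw [← AdjoinRoot.mk_X, ← map_one (AdjoinRoot.mk (pp ^ l)), ← map_sub, ← hp1]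
      rw [map_pow, this, map_pow, map_sub, hLroot, map_one]
    have hz := sub_one_pow_eq_zero_of_eq_transpose_mul hchar hMns hM hPQ
      companion_apply_of_eq_succ (by omega) (by rwa [hn]) (by
        have h : pp ^ (pp ^ l).natDegree = pp ^ l := congrArg (pp ^ ·) hn
        rw [hpow, h, AdjoinRoot.mk_self, map_zero])
    rw [hpow, map_eq_zero_iff L hLinj, AdjoinRoot.mk_eq_zero,
      pow_dvd_pow_iff hirr.ne_zero hirr.not_isUnit] at hz
    omega
  · rw [hl2.neg_pow] at hcn
    have hcl : c ^ l = c := by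
      obtain ⟨k, rfl⟩ := hl2
      rw [pow_succ, pow_mul, hc, one_pow, one_mul]
    rw [hl2.neg_one_pow, ← hcn, hcl, neg_neg]
end
end Can
end
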